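/- arXiv:2304.10364 — 2 statements merged into one kernel-verified Lean document; each statement's English description precedes it below -/
import Mathlib

section
/- Assume E_0, …, E_{N−1} are pairwise distinct and set z_j = E_{j−1}^{3/2}/√λ − κ for j = 1,…,N. For t ∈ ℝ^N let Z_diag(t) = Z[diag(t_1,…,t_N)]. Then for every n ≥ 3 and pairwise distinct indices a^1, …, a^n ∈ {1,…,N}, the mixed partial derivative (∂^n/∂t_{a^1}⋯∂t_{a^n}) log Z_diag(t) |_{t=0} equals (∂^n/∂s_{a^1}⋯∂s_{a^n}) log P_N(s_1,…,s_N) evaluated at s = (z_1,…,z_N); consequently the n-boundary n-point function G_{|a^1|⋯|a^n|} = V^{n−2}(∂^n/∂t_{a^1}⋯∂t_{a^n}) log Z_diag |_{t=0} equals V^{n−2}(∂^n/∂s_{a^1}⋯∂s_{a^n}) log P_N at z. -/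
open MeasureTheory Matrix Polynomial BigOperators

/-- Index set for the strictly-upper-triangular entries. -/
abbrev OffIdx (N : ℕ) := {p : Fin N × Fin N // p.1 < p.2}

/-- Real coordinates of a Hermitian matrix: the diagonal entries and the
(complex) strictly-upper-triangular entries. -/
abbrev HCoords (N : ℕ) := (Fin N → ℝ) × (OffIdx N → ℂ)

/-- The Hermitian matrix with the given coordinates. -/
noncomputable def hermOf {N : ℕ} (c : HCoords N) : Matrix (Fin N) (Fin N) ℂ :=
  Matrix.of fun i j =>
    if h : i < j then c.2 ⟨(i, j), h⟩
    else if h' : j < i then star (c.2 ⟨(j, i), h'⟩)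
    else (c.1 i : ℂ)

/-- The diagonal matrix `M = diag (√E_0, …, √E_{N-1})`. -/
noncomputable def Mmat (N : ℕ) (Ev : Fin N → ℝ) : Matrix (Fin N) (Fin N) ℂ :=
  Matrix.diagonal fun i => (Real.sqrt (Ev i) : ℂ)

/-- The diagonal matrix `E = diag (E_0, …, E_{N-1})`. -/
noncomputable def Emat (N : ℕ) (Ev : Fin N → ℝ) : Matrix (Fin N) (Fin N) ℂ :=
  Matrix.diagonal fun i => (Ev i : ℂ)

/-- The action `S[Φ] = V tr (EΦ² + κΦ + ½MΦMΦ + √λ MΦ³ + (λ/4)Φ⁴)`. -/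
noncomputable def action (N : ℕ) (Vc lam kap : ℝ) (Ev : Fin N → ℝ)
    (Φ : Matrix (Fin N) (Fin N) ℂ) : ℝ :=
  Vc * (Matrix.trace (Emat N Ev * Φ ^ 2 + (kap : ℂ) • Φ
      + (1 / 2 : ℂ) • (Mmat N Ev * Φ * Mmat N Ev * Φ)
      + ((Real.sqrt lam : ℝ) : ℂ) • (Mmat N Ev * Φ ^ 3)
      + ((lam : ℂ) / 4) • Φ ^ 4)).re

/-- The partition function `Z[J] = ∫ DΦ exp (−S[Φ] + V tr (JΦ))`. -/
noncomputable def Zfun (N : ℕ) (Vc lam kap : ℝ) (Ev : Fin N → ℝ)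
    (J : Matrix (Fin N) (Fin N) ℂ) : ℝ :=
  ∫ c : HCoords N,
    Real.exp (- action N Vc lam kap Ev (hermOf c)
      + Vc * (Matrix.trace (J * hermOf c)).re)

/-- `P(z) = ∫ℝ exp(−(λV/4)x⁴ + Vxz) dx`. -/
noncomputable def Pint (Vc lam : ℝ) (z : ℝ) : ℝ :=
  ∫ x : ℝ, Real.exp (- (lam * Vc / 4) * x ^ 4 + Vc * x * z)

/-- `P_N(s₁,…,s_N) = det (P^{(i−1)}(s_j))`. -/
noncomputable def PNdet (N : ℕ) (Vc lam : ℝ) (s : Fin N → ℝ) : ℝ :=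
  Matrix.det (Matrix.of fun i j : Fin N => iteratedDeriv (i : ℕ) (Pint Vc lam) (s j))

/-- The partial derivative in the `i`-th coordinate of a function of `N` real variables. -/
noncomputable def pd (N : ℕ) (i : Fin N) (f : (Fin N → ℝ) → ℝ) : (Fin N → ℝ) → ℝ :=
  fun x => deriv (fun t => f (Function.update x i t)) (x i)


open Filter Topology in
theorem second_deriv_test (f f1 : ℝ → ℝ) (f2 x : ℝ) (hm : IsLocalMax f x)
    (h1 : ∀ᶠ r in 𝓝 x, HasDerivAt f (f1 r) r) (h2 : HasDerivAt f1 f2 x) : f2 ≤ 0 := by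
  by_contra hcon
  push Not at hcon
  have e1 : deriv f =ᶠ[𝓝 x] f1 := h1.mono fun r hr => hr.deriv
  have hd : deriv (deriv f) x = f2 := by rw [e1.deriv_eq]; exact h2.deriv
  have hmin : IsLocalMin f x := by
    apply isLocalMin_of_deriv_deriv_pos
    · rw [hd]; exact hcon
    · exact hm.deriv_eq_zero
    · exact h1.self_of_nhds.continuousAt
  have hconst : f =ᶠ[𝓝 x] fun _ => f x := by
    filter_upwards [hm, hmin] with r a b using le_antisymm a b
  have : deriv (deriv f) x = 0 := by
    have := hconst.deriv
    rw [this.deriv_eq]; simp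
  linarith

open Filter Topology Set in
theorem left_max_deriv (f : ℝ → ℝ) (f' t0 T : ℝ) (h0 : 0 < t0) (hT : t0 ≤ T)
    (hm : ∀ t ∈ Icc 0 T, f t ≤ f t0) (h : HasDerivAt f f' t0) : 0 ≤ f' := by
  have h1 : Tendsto (slope f t0) (𝓝[<] t0) (𝓝 f') := by
    have := (hasDerivAt_iff_tendsto_slope.1 h)
    exact this.mono_left (nhdsWithin_mono _ (fun x hx => ne_of_lt hx))
  apply ge_of_tendsto h1
  have : Ioo 0 t0 ∈ 𝓝[<] t0 := Ioo_mem_nhdsLT h0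
  filter_upwards [this] with t ht
  rw [slope_def_field]
  apply div_nonneg_of_nonpos
  · have := hm t ⟨ht.1.le, ht.2.le.trans hT⟩
    linarith
  · linarith [ht.2]

open Filter Topology Set in
theorem heat_max {N : ℕ} (T : ℝ) (D : ℝ → (Fin N → ℝ) → ℝ)
    (hc : Continuous (fun p : ℝ × (Fin N → ℝ) => D p.1 p.2))
    (h0 : ∀ s, D 0 s ≤ 0)
    (hgrow : ∀ ε > 0, ∃ R, ∀ t ∈ Icc 0 T, ∀ s : Fin N → ℝ, R < ‖s‖ →
      D t s ≤ ε * (1 + ∑ i, Real.cosh (s i)))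
    (hheat : ∀ t > 0, ∀ s, 0 < D t s → ∃ (Dt : ℝ) (D1 : Fin N → ℝ → ℝ) (D2 : Fin N → ℝ),
      HasDerivAt (fun τ => D τ s) Dt t ∧
      (∀ i, ∀ᶠ r in 𝓝 (s i), HasDerivAt (fun r => D t (Function.update s i r)) (D1 i r) r) ∧
      (∀ i, HasDerivAt (D1 i) (D2 i) (s i)) ∧ Dt = (1/2) * ∑ i, D2 i) :
    ∀ t ∈ Icc 0 T, ∀ s, D t s ≤ 0 := by
  intro t1 ht1 s1
  by_contra hpos
  push Not at hpos
  set B : ℝ → (Fin N → ℝ) → ℝ := fun t s => Real.exp t * (1 + ∑ i, Real.cosh (s i)) with hB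
  have hSpos : ∀ s : Fin N → ℝ, 0 < 1 + ∑ i, Real.cosh (s i) := fun s => by
    have : 0 ≤ ∑ i, Real.cosh (s i) := Finset.sum_nonneg fun i _ => (Real.cosh_pos _).le
    linarith
  have hBpos : ∀ t s, 0 < B t s := fun t s => mul_pos (Real.exp_pos _) (hSpos s)
  set ε := D t1 s1 / (2 * B t1 s1) with hε
  have hεpos : 0 < ε := div_pos hpos (by have := hBpos t1 s1; positivity)
  obtain ⟨R, hR⟩ := hgrow ε hεpos
  set f : ℝ → (Fin N → ℝ) → ℝ := fun t s => D t s - ε * B t s with hf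
  have hf1 : 0 < f t1 s1 := by
    have : ε * B t1 s1 = D t1 s1 / 2 := by
      rw [hε]; have := (hBpos t1 s1).ne'; field_simp
    simp only [hf, this]; linarith
  have hfc : Continuous (fun p : ℝ × (Fin N → ℝ) => f p.1 p.2) := by
    simp only [hf, hB]
    refine hc.sub (continuous_const.mul ?_)
    refine (Real.continuous_exp.comp continuous_fst).mul (continuous_const.add ?_)
    refine continuous_finsetSum _ fun i _ => Real.continuous_cosh.comp ?_
    exact (continuous_apply i).comp continuous_snd
  have hcomp : IsCompact (Icc 0 T ×ˢ Metric.closedBall (0 : Fin N → ℝ) (max R ‖s1‖)) :=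
    isCompact_Icc.prod (isCompact_closedBall _ _)
  obtain ⟨⟨t0, s0⟩, ⟨hmem1, hmem2⟩, hmax⟩ := hcomp.exists_isMaxOn
    ⟨(t1, s1), ⟨ht1, by simp⟩⟩ hfc.continuousOn
  simp only at hmem1 hmem2
  have hf0 : 0 < f t0 s0 := lt_of_lt_of_le hf1 (hmax (a := (t1, s1)) ⟨ht1, by simp⟩)
  have hglob : ∀ t ∈ Icc 0 T, ∀ s, f t s ≤ f t0 s0 := by
    intro t ht s
    by_cases hs : ‖s‖ ≤ max R ‖s1‖
    · exact hmax (a := (t, s)) ⟨ht, by simpa using hs⟩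
    · push Not at hs
      have h2 := hR t ht s (lt_of_le_of_lt (le_max_left _ _) hs)
      have h3 : ε * (1 + ∑ i, Real.cosh (s i)) ≤ ε * B t s := by
        apply mul_le_mul_of_nonneg_left _ hεpos.le
        have := Real.one_le_exp ht.1
        have h4 := hSpos s
        simp only [hB]
        nlinarith
      have : f t s ≤ 0 := by simp only [hf]; linarith
      linarith
  have ht0 : 0 < t0 := by
    rcases hmem1.1.lt_or_eq with h | h
    · exact h
    · exfalso
      rw [← h] at hf0
      have := h0 s0
      have h5 := mul_pos hεpos (hBpos 0 s0)
      simp only [hf] at hf0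
      linarith
  have hDpos : 0 < D t0 s0 := by
    have h5 := mul_pos hεpos (hBpos t0 s0)
    simp only [hf] at hf0
    linarith
  obtain ⟨Dt, D1, D2, hDt, hD1, hD2, heq⟩ := hheat t0 ht0 s0 hDpos
  have hA : 0 ≤ Dt - ε * B t0 s0 := by
    refine left_max_deriv (fun t => f t s0) _ t0 T ht0 hmem1.2 (fun t ht => hglob t ht s0) ?_
    refine hDt.sub (HasDerivAt.const_mul ε ?_)
    simp only [hB]
    exact (Real.hasDerivAt_exp t0).mul_const _
  have hsec : ∀ i, D2 i ≤ ε * (Real.exp t0 * Real.cosh (s0 i)) := by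
    intro i
    have key : D2 i - ε * (Real.exp t0 * Real.cosh (s0 i)) ≤ 0 := by
      refine second_deriv_test (fun r => f t0 (Function.update s0 i r))
        (fun r => D1 i r - ε * (Real.exp t0 * Real.sinh r)) _ (s0 i) ?_ ?_ ?_
      · refine Eventually.of_forall fun r => ?_
        simp only [Function.update_eq_self]
        exact hglob t0 hmem1 _
      · filter_upwards [hD1 i] with r hr
        refine hr.sub (HasDerivAt.const_mul ε ?_)
        simp only [hB]
        refine HasDerivAt.const_mul _ ?_
        have : (fun r => 1 + ∑ j, Real.cosh (Function.update s0 i r j)) =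
            fun r => (1 + ∑ j ∈ Finset.univ.erase i, Real.cosh (s0 j)) + Real.cosh r := by
          funext r
          rw [← Finset.add_sum_erase _ _ (Finset.mem_univ i)]
          have : ∑ j ∈ Finset.univ.erase i, Real.cosh (Function.update s0 i r j)
              = ∑ j ∈ Finset.univ.erase i, Real.cosh (s0 j) :=
            Finset.sum_congr rfl fun j hj => by
              rw [Function.update_of_ne (Finset.ne_of_mem_erase hj)]
          rw [this]; simp; ring
        rw [this]
        exact (Real.hasDerivAt_cosh r).const_add _
      · exact (hD2 i).sub (((Real.hasDerivAt_sinh (s0 i)).const_mul _).const_mul _)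
    linarith
  have hsum : ∑ i, D2 i ≤ ε * B t0 s0 := by
    calc ∑ i, D2 i ≤ ∑ i, ε * (Real.exp t0 * Real.cosh (s0 i)) :=
          Finset.sum_le_sum fun i _ => hsec i
      _ = ε * (Real.exp t0 * ∑ i, Real.cosh (s0 i)) := by simp [Finset.mul_sum]
      _ ≤ ε * B t0 s0 := by
          apply mul_le_mul_of_nonneg_left _ hεpos.le
          simp only [hB]
          have := Real.exp_pos t0
          nlinarith
  have := mul_pos hεpos (hBpos t0 s0)
  rw [heq] at hA
  linarith


theorem exp_neg_div_le_one {q t : ℝ} (hq : 0 ≤ q) (ht : 0 < t) : Real.exp (-q / (2 * t)) ≤ 1 := by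
  apply Real.exp_le_one_iff.2
  rw [neg_div]; have : 0 ≤ q / (2 * t) := by positivity
  linarith

theorem kint {Ω : Type*} [MeasurableSpace Ω] {μ : Measure Ω} (g h q b : Ω → ℝ) (t C : ℝ)
    (hg : Measurable g) (hh : Measurable h) (hq : Measurable q) (hq0 : ∀ ω, 0 ≤ q ω) (ht : 0 < t)
    (hb : ∀ ω, |h ω| ≤ C * b ω)
    (hI : Integrable (fun ω => |g ω| * b ω) μ) :
    Integrable (fun ω => g ω * h ω * Real.exp (-(q ω) / (2 * t))) μ := by
  refine (hI.const_mul C).mono' (by fun_prop) (Filter.Eventually.of_forall fun ω => ?_)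
  rw [Real.norm_eq_abs, abs_mul, abs_mul, abs_of_pos (Real.exp_pos _)]
  have h1 := exp_neg_div_le_one (hq0 ω) ht
  have h2 := hb ω
  calc |g ω| * |h ω| * Real.exp (-(q ω) / (2 * t)) ≤ |g ω| * |h ω| * 1 := by gcongr
    _ ≤ |g ω| * (C * b ω) := by rw [mul_one]; gcongr
    _ = _ := by ring

theorem kderiv1 {Ω : Type*} [MeasurableSpace Ω] {μ : Measure Ω} (g η ρ : Ω → ℝ) (t r0 : ℝ)
    (hg : Measurable g) (hη : Measurable η) (hρ : Measurable ρ) (hρ0 : ∀ ω, 0 ≤ ρ ω) (ht : 0 < t)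
    (hI : Integrable (fun ω => |g ω| * (1 + η ω ^ 2)) μ) :
    HasDerivAt (fun r => ∫ ω, g ω * Real.exp (-((r - η ω) ^ 2 + ρ ω) / (2 * t)) ∂μ)
      (∫ ω, g ω * ((η ω - r0) / t) * Real.exp (-((r0 - η ω) ^ 2 + ρ ω) / (2 * t)) ∂μ) r0 := by
  refine (hasDerivAt_integral_of_dominated_loc_of_deriv_le (𝕜 := ℝ) (μ := μ)
    (F := fun r ω => g ω * Real.exp (-((r - η ω) ^ 2 + ρ ω) / (2 * t)))
    (F' := fun r ω => g ω * ((η ω - r) / t) * Real.exp (-((r - η ω) ^ 2 + ρ ω) / (2 * t)))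
    (bound := fun ω => (((|r0| + 1) + 1) / t) * (|g ω| * (1 + η ω ^ 2)))
    (Metric.ball_mem_nhds r0 one_pos) ?_ ?_ ?_ ?_ ?_ ?_).2
  · exact Filter.Eventually.of_forall fun r => by fun_prop
  · have := kint (μ := μ) g (fun _ => 1) (fun ω => (r0 - η ω) ^ 2 + ρ ω) (fun ω => 1 + η ω ^ 2) t 1 hg
      (by fun_prop) (by fun_prop) (fun ω => by have := hρ0 ω; positivity) ht
      (fun ω => by simp; positivity) hI
    simpa using this
  · fun_prop
  · refine Filter.Eventually.of_forall fun ω r hr => ?_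
    rw [Real.norm_eq_abs, abs_mul, abs_mul, abs_of_pos (Real.exp_pos _)]
    have h1 := exp_neg_div_le_one (q := (r - η ω) ^ 2 + ρ ω) (by have := hρ0 ω; positivity) ht
    have hr' : |r| ≤ |r0| + 1 := by
      have := abs_sub_abs_le_abs_sub r r0
      rw [Metric.mem_ball, Real.dist_eq] at hr; linarith
    have h2 : |η ω - r| ≤ ((|r0| + 1) + 1) * (1 + η ω ^ 2) := by
      have h3 : |η ω| ≤ 1 + η ω ^ 2 := by
        rw [← sq_abs]; nlinarith [sq_nonneg (|η ω| - 1), abs_nonneg (η ω)]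
      have := abs_sub (η ω) r
      have h4 := abs_nonneg r0
      nlinarith [sq_nonneg (η ω)]
    have h5 : |(η ω - r) / t| ≤ ((|r0| + 1) + 1) / t * (1 + η ω ^ 2) := by
      rw [abs_div, abs_of_pos ht, div_mul_eq_mul_div]; gcongr
    calc |g ω| * |(η ω - r) / t| * Real.exp (-((r - η ω) ^ 2 + ρ ω) / (2 * t))
        ≤ |g ω| * |(η ω - r) / t| * 1 := by gcongr
      _ ≤ |g ω| * (((|r0| + 1) + 1) / t * (1 + η ω ^ 2)) := by rw [mul_one]; gcongr
      _ = _ := by ring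
  · exact hI.const_mul _
  · refine Filter.Eventually.of_forall fun ω r hr => ?_
    have h1 : HasDerivAt (fun r => -((r - η ω) ^ 2 + ρ ω) / (2 * t)) ((η ω - r) / t) r := by
      have := (((((hasDerivAt_id r).sub_const (η ω)).pow 2).add_const (ρ ω)).neg).div_const (2 * t)
      refine this.congr_deriv ?_
      simp; field_simp; try ring
    have := (h1.exp).const_mul (g ω)
    refine this.congr_deriv ?_
    ring

theorem kderiv2 {Ω : Type*} [MeasurableSpace Ω] {μ : Measure Ω} (g η ρ : Ω → ℝ) (t r0 : ℝ)
    (hg : Measurable g) (hη : Measurable η) (hρ : Measurable ρ) (hρ0 : ∀ ω, 0 ≤ ρ ω) (ht : 0 < t)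
    (hI : Integrable (fun ω => |g ω| * (1 + η ω ^ 2)) μ) :
    HasDerivAt (fun r => ∫ ω, g ω * ((η ω - r) / t) * Real.exp (-((r - η ω) ^ 2 + ρ ω) / (2 * t)) ∂μ)
      (∫ ω, g ω * ((η ω - r0) ^ 2 / t ^ 2 - 1 / t) *
        Real.exp (-((r0 - η ω) ^ 2 + ρ ω) / (2 * t)) ∂μ) r0 := by
  refine (hasDerivAt_integral_of_dominated_loc_of_deriv_le (𝕜 := ℝ) (μ := μ)
    (F := fun r ω => g ω * ((η ω - r) / t) * Real.exp (-((r - η ω) ^ 2 + ρ ω) / (2 * t)))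
    (F' := fun r ω => g ω * ((η ω - r) ^ 2 / t ^ 2 - 1 / t) *
      Real.exp (-((r - η ω) ^ 2 + ρ ω) / (2 * t)))
    (bound := fun ω => ((2 * (|r0| + 1) ^ 2 + 2) / t ^ 2 + 1 / t) * (|g ω| * (1 + η ω ^ 2)))
    (Metric.ball_mem_nhds r0 one_pos) ?_ ?_ ?_ ?_ ?_ ?_).2
  · exact Filter.Eventually.of_forall fun r => by fun_prop
  · refine kint (μ := μ) g (fun ω => (η ω - r0) / t) (fun ω => (r0 - η ω) ^ 2 + ρ ω)
      (fun ω => 1 + η ω ^ 2) t ((1 + |r0|) / t) hg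
      (by fun_prop) (by fun_prop) (fun ω => by have := hρ0 ω; positivity) ht
      (fun ω => ?_) hI
    rw [abs_div, abs_of_pos ht, div_mul_eq_mul_div]
    gcongr
    have h3 : |η ω| ≤ 1 + η ω ^ 2 := by
      rw [← sq_abs]; nlinarith [sq_nonneg (|η ω| - 1), abs_nonneg (η ω)]
    have := abs_sub (η ω) r0
    have h4 := abs_nonneg r0
    nlinarith [sq_nonneg (η ω)]
  · fun_prop
  · refine Filter.Eventually.of_forall fun ω r hr => ?_
    rw [Real.norm_eq_abs, abs_mul, abs_mul, abs_of_pos (Real.exp_pos _)]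
    have h1 := exp_neg_div_le_one (q := (r - η ω) ^ 2 + ρ ω) (by have := hρ0 ω; positivity) ht
    have hr' : |r| ≤ |r0| + 1 := by
      have := abs_sub_abs_le_abs_sub r r0
      rw [Metric.mem_ball, Real.dist_eq] at hr; linarith
    have h2 : (η ω - r) ^ 2 ≤ (2 * (|r0| + 1) ^ 2 + 2) * (1 + η ω ^ 2) := by
      have h6 : r ^ 2 ≤ (|r0| + 1) ^ 2 := by
        rw [← sq_abs r]; gcongr
      nlinarith [sq_nonneg (η ω + r), sq_nonneg (|r0| + 1), mul_nonneg (sq_nonneg (|r0| + 1)) (sq_nonneg (η ω))]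
    have h5 : |(η ω - r) ^ 2 / t ^ 2 - 1 / t| ≤
        ((2 * (|r0| + 1) ^ 2 + 2) / t ^ 2 + 1 / t) * (1 + η ω ^ 2) := by
      have a1 : |(η ω - r) ^ 2 / t ^ 2 - 1 / t| ≤ (η ω - r) ^ 2 / t ^ 2 + 1 / t := by
        have := abs_sub ((η ω - r) ^ 2 / t ^ 2) (1 / t)
        rwa [abs_of_nonneg (by positivity : 0 ≤ (η ω - r) ^ 2 / t ^ 2), abs_of_pos (by positivity : 0 < 1 / t)] at this
      have a2 : (η ω - r) ^ 2 / t ^ 2 ≤ (2 * (|r0| + 1) ^ 2 + 2) / t ^ 2 * (1 + η ω ^ 2) := by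
        rw [div_mul_eq_mul_div]; gcongr
      have a3 : 1 / t ≤ 1 / t * (1 + η ω ^ 2) := by
        have : 0 < 1 / t := by positivity
        nlinarith [sq_nonneg (η ω)]
      linarith
    calc |g ω| * |(η ω - r) ^ 2 / t ^ 2 - 1 / t| * Real.exp (-((r - η ω) ^ 2 + ρ ω) / (2 * t))
        ≤ |g ω| * |(η ω - r) ^ 2 / t ^ 2 - 1 / t| * 1 := by gcongr
      _ ≤ |g ω| * (((2 * (|r0| + 1) ^ 2 + 2) / t ^ 2 + 1 / t) * (1 + η ω ^ 2)) := by
          rw [mul_one]; gcongr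
      _ = _ := by ring
  · exact hI.const_mul _
  · refine Filter.Eventually.of_forall fun ω r hr => ?_
    have h1 : HasDerivAt (fun r => -((r - η ω) ^ 2 + ρ ω) / (2 * t)) ((η ω - r) / t) r := by
      have := (((((hasDerivAt_id r).sub_const (η ω)).pow 2).add_const (ρ ω)).neg).div_const (2 * t)
      refine this.congr_deriv ?_
      simp; field_simp; try ring
    have h2 : HasDerivAt (fun r => g ω * ((η ω - r) / t)) (g ω * (-1 / t)) r :=
      (((hasDerivAt_id r).const_sub (η ω)).div_const t).const_mul (g ω)
    have := h2.mul h1.exp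
    refine this.congr_deriv ?_
    ring

theorem kderiv3 {Ω : Type*} [MeasurableSpace Ω] {μ : Measure Ω} (g q : Ω → ℝ) (t : ℝ)
    (hg : Measurable g) (hq : Measurable q) (hq0 : ∀ ω, 0 ≤ q ω) (ht : 0 < t)
    (hI : Integrable (fun ω => |g ω| * (1 + q ω)) μ) :
    HasDerivAt (fun τ => ∫ ω, g ω * Real.exp (-(q ω) / (2 * τ)) ∂μ)
      (∫ ω, g ω * (q ω / (2 * t ^ 2)) * Real.exp (-(q ω) / (2 * t)) ∂μ) t := by
  refine (hasDerivAt_integral_of_dominated_loc_of_deriv_le (𝕜 := ℝ) (μ := μ)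
    (F := fun τ ω => g ω * Real.exp (-(q ω) / (2 * τ)))
    (F' := fun τ ω => g ω * (q ω / (2 * τ ^ 2)) * Real.exp (-(q ω) / (2 * τ)))
    (bound := fun ω => (1 / (2 * (t / 2) ^ 2)) * (|g ω| * (1 + q ω)))
    (Ioi_mem_nhds (half_lt_self ht)) ?_ ?_ ?_ ?_ ?_ ?_).2
  · exact Filter.Eventually.of_forall fun r => by fun_prop
  · have := kint (μ := μ) g (fun _ => 1) q (fun ω => 1 + q ω) t 1 hg
      (by fun_prop) (by fun_prop) hq0 ht (fun ω => by simp [hq0 ω]) hI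
    simpa using this
  · fun_prop
  · refine Filter.Eventually.of_forall fun ω τ hτ => ?_
    have hτ' : t / 2 < τ := hτ
    have hτ0 : 0 < τ := by linarith
    rw [Real.norm_eq_abs, abs_mul, abs_mul, abs_of_pos (Real.exp_pos _)]
    have h1 := exp_neg_div_le_one (hq0 ω) hτ0
    have h5 : |q ω / (2 * τ ^ 2)| ≤ 1 / (2 * (t / 2) ^ 2) * (1 + q ω) := by
      rw [abs_of_nonneg (div_nonneg (hq0 ω) (by positivity)), one_div_mul_eq_div]
      have := hq0 ω
      gcongr
      linarith
    calc |g ω| * |q ω / (2 * τ ^ 2)| * Real.exp (-(q ω) / (2 * τ))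
        ≤ |g ω| * |q ω / (2 * τ ^ 2)| * 1 := by gcongr
      _ ≤ |g ω| * (1 / (2 * (t / 2) ^ 2) * (1 + q ω)) := by rw [mul_one]; gcongr
      _ = _ := by ring
  · exact hI.const_mul _
  · refine Filter.Eventually.of_forall fun ω τ hτ => ?_
    have hτ' : t / 2 < τ := hτ
    have hτ0 : 0 < τ := by linarith
    have h1 : HasDerivAt (fun τ => -(q ω) / (2 * τ)) (q ω / (2 * τ ^ 2)) τ := by
      have := (hasDerivAt_const τ (-(q ω))).div ((hasDerivAt_id τ).const_mul 2) (by simp; positivity)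
      refine this.congr_deriv ?_
      simp; field_simp; try ring
    have := (h1.exp).const_mul (g ω)
    refine this.congr_deriv ?_
    ring

/-- heat smoothing in scaled form -/
noncomputable def Tsm {E : Type*} [NormedAddCommGroup E] [NormedSpace ℝ E] [MeasureSpace E]
    {N : ℕ} (g Q : E → ℝ) (ι : (Fin N → ℝ) → E) (t : ℝ) (s : Fin N → ℝ) : ℝ :=
  ∫ y : E, g (ι s + Real.sqrt t • y) * Real.exp (-(Q y) / 2)

section Tsm
variable {E : Type*} [NormedAddCommGroup E] [NormedSpace ℝ E] [MeasureSpace E] [BorelSpace E]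
  [FiniteDimensional ℝ E] {N : ℕ} (g Q : E → ℝ) (ι : (Fin N → ℝ) → E)

theorem Tsm_cont (C : ℝ) (hgc : Continuous g) (hQ : Continuous Q) (hι : Continuous ι)
    (hC : ∀ x, |g x| ≤ C) (hint : Integrable (fun y => Real.exp (-(Q y) / 2))) :
    Continuous (fun p : ℝ × (Fin N → ℝ) => Tsm g Q ι p.1 p.2) := by
  unfold Tsm
  refine continuous_of_dominated (bound := fun y => C * Real.exp (-(Q y) / 2)) ?_ ?_ ?_ ?_
  · intro p
    apply Continuous.aestronglyMeasurable
    fun_prop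
  · intro p
    refine Filter.Eventually.of_forall fun y => ?_
    rw [Real.norm_eq_abs, abs_mul, abs_of_pos (Real.exp_pos _)]
    gcongr
    exact hC _
  · exact hint.const_mul _
  · refine Filter.Eventually.of_forall fun y => ?_
    fun_prop

theorem Tsm_bound (C : ℝ) (hC : ∀ x, |g x| ≤ C) (hint : Integrable (fun y => Real.exp (-(Q y) / 2)))
    (t : ℝ) (s : Fin N → ℝ) : |Tsm g Q ι t s| ≤ C * ∫ y, Real.exp (-(Q y) / 2) := by
  unfold Tsm
  rw [← integral_const_mul, ← Real.norm_eq_abs]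
  refine norm_integral_le_of_norm_le (hint.const_mul _) (Filter.Eventually.of_forall fun y => ?_)
  rw [Real.norm_eq_abs, abs_mul, abs_of_pos (Real.exp_pos _)]
  gcongr
  exact hC _

theorem Tsm_zero (s : Fin N → ℝ) : Tsm g Q ι 0 s = g (ι s) * ∫ y, Real.exp (-(Q y) / 2) := by
  unfold Tsm
  simp [integral_const_mul]

theorem Tsm_ker [(volume : Measure E).IsAddHaarMeasure] (hQ : ∀ (r : ℝ) y, Q (r • y) = r ^ 2 * Q y)
    (t : ℝ) (ht : 0 < t) (s : Fin N → ℝ) :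
    Tsm g Q ι t s = ((Real.sqrt t) ^ (Module.finrank ℝ E))⁻¹ *
      ∫ c : E, g c * Real.exp (-(Q (c - ι s)) / (2 * t)) := by
  unfold Tsm
  have h := Measure.integral_comp_smul (volume : Measure E)
    (fun z => g (ι s + z) * Real.exp (-(Q z) / (2 * t))) (Real.sqrt t)
  have e : ∀ y, g (ι s + Real.sqrt t • y) * Real.exp (-(Q y) / 2) =
      g (ι s + Real.sqrt t • y) * Real.exp (-(Q (Real.sqrt t • y)) / (2 * t)) := by
    intro y
    rw [hQ, Real.sq_sqrt ht.le]
    congr 2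
    field_simp
  simp_rw [e]
  rw [h, abs_of_nonneg (by positivity), smul_eq_mul]
  congr 1
  have h2 := integral_add_right_eq_self (μ := (volume : Measure E))
    (fun c => g c * Real.exp (-(Q (c - ι s)) / (2 * t))) (ι s)
  rw [← h2]
  refine integral_congr_ae (Filter.Eventually.of_forall fun c => ?_)
  simp [add_comm]
end Tsm


theorem sum_update_sq {N : ℕ} (s ξ : Fin N → ℝ) (i : Fin N) (r : ℝ) :
    ∑ j, (Function.update s i r j - ξ j) ^ 2 =
      (r - ξ i) ^ 2 + ∑ j ∈ Finset.univ.erase i, (s j - ξ j) ^ 2 := by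
  rw [← Finset.add_sum_erase _ _ (Finset.mem_univ i)]
  simp only [Function.update_self]
  congr 1
  exact Finset.sum_congr rfl fun j hj => by
    rw [Function.update_of_ne (Finset.ne_of_mem_erase hj)]

section KD
variable {Ω : Type*} [MeasurableSpace Ω] {μ : Measure Ω} {N : ℕ} (g ρ : Ω → ℝ) (ξ : Ω → Fin N → ℝ)

theorem KD_int1 (hg : Measurable g) (hξ : Measurable ξ) (hρ : Measurable ρ) (hρ0 : ∀ ω, 0 ≤ ρ ω)
    (hI : Integrable (fun ω => |g ω| * (1 + (∑ i, ξ ω i ^ 2 + ρ ω))) μ) (i : Fin N) :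
    Integrable (fun ω => |g ω| * (1 + ξ ω i ^ 2)) μ := by
  refine hI.mono' (by fun_prop) (Filter.Eventually.of_forall fun ω => ?_)
  have h1 : ξ ω i ^ 2 ≤ ∑ i, ξ ω i ^ 2 :=
    Finset.single_le_sum (f := fun i => ξ ω i ^ 2) (fun j _ => sq_nonneg _) (Finset.mem_univ i)
  have h2 := hρ0 ω
  rw [Real.norm_eq_abs, abs_mul, abs_abs, abs_of_nonneg (by positivity : 0 ≤ 1 + ξ ω i ^ 2)]
  gcongr
  linarith

theorem KD1 (hg : Measurable g) (hξ : Measurable ξ) (hρ : Measurable ρ) (hρ0 : ∀ ω, 0 ≤ ρ ω)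
    (hI : Integrable (fun ω => |g ω| * (1 + (∑ i, ξ ω i ^ 2 + ρ ω))) μ)
    (t : ℝ) (ht : 0 < t) (s : Fin N → ℝ) (i : Fin N) (r0 : ℝ) :
    HasDerivAt (fun r => ∫ ω, g ω * Real.exp (-(∑ j, (Function.update s i r j - ξ ω j) ^ 2 + ρ ω) / (2 * t)) ∂μ)
      (∫ ω, g ω * ((ξ ω i - r0) / t) *
        Real.exp (-(∑ j, (Function.update s i r0 j - ξ ω j) ^ 2 + ρ ω) / (2 * t)) ∂μ) r0 := by
  simp_rw [sum_update_sq, add_assoc]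
  have hξi : Measurable fun ω => ξ ω i := (measurable_pi_apply i).comp hξ
  exact kderiv1 g (fun ω => ξ ω i) (fun ω => ∑ j ∈ Finset.univ.erase i, (s j - ξ ω j) ^ 2 + ρ ω) t r0 hg
    hξi (by fun_prop)
    (fun ω => add_nonneg (Finset.sum_nonneg fun j _ => sq_nonneg _) (hρ0 ω)) ht
    (KD_int1 g ρ ξ hg hξ hρ hρ0 hI i)

theorem KD2 (hg : Measurable g) (hξ : Measurable ξ) (hρ : Measurable ρ) (hρ0 : ∀ ω, 0 ≤ ρ ω)
    (hI : Integrable (fun ω => |g ω| * (1 + (∑ i, ξ ω i ^ 2 + ρ ω))) μ)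
    (t : ℝ) (ht : 0 < t) (s : Fin N → ℝ) (i : Fin N) (r0 : ℝ) :
    HasDerivAt (fun r => ∫ ω, g ω * ((ξ ω i - r) / t) *
        Real.exp (-(∑ j, (Function.update s i r j - ξ ω j) ^ 2 + ρ ω) / (2 * t)) ∂μ)
      (∫ ω, g ω * ((ξ ω i - r0) ^ 2 / t ^ 2 - 1 / t) *
        Real.exp (-(∑ j, (Function.update s i r0 j - ξ ω j) ^ 2 + ρ ω) / (2 * t)) ∂μ) r0 := by
  simp_rw [sum_update_sq, add_assoc]
  have hξi : Measurable fun ω => ξ ω i := (measurable_pi_apply i).comp hξ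
  exact kderiv2 g (fun ω => ξ ω i) (fun ω => ∑ j ∈ Finset.univ.erase i, (s j - ξ ω j) ^ 2 + ρ ω) t r0 hg
    hξi (by fun_prop)
    (fun ω => add_nonneg (Finset.sum_nonneg fun j _ => sq_nonneg _) (hρ0 ω)) ht
    (KD_int1 g ρ ξ hg hξ hρ hρ0 hI i)

theorem KD_q0 (hρ0 : ∀ ω, 0 ≤ ρ ω) (s : Fin N → ℝ) (ω : Ω) : 0 ≤ ∑ j, (s j - ξ ω j) ^ 2 + ρ ω :=
  add_nonneg (Finset.sum_nonneg fun j _ => sq_nonneg _) (hρ0 ω)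

theorem KD_qle (hρ0 : ∀ ω, 0 ≤ ρ ω) (s : Fin N → ℝ) (ω : Ω) :
    1 + (∑ j, (s j - ξ ω j) ^ 2 + ρ ω) ≤ (2 + 2 * ∑ j, s j ^ 2) * (1 + (∑ i, ξ ω i ^ 2 + ρ ω)) := by
  have h1 : ∑ j, (s j - ξ ω j) ^ 2 ≤ 2 * ∑ j, s j ^ 2 + 2 * ∑ i, ξ ω i ^ 2 := by
    rw [Finset.mul_sum, Finset.mul_sum, ← Finset.sum_add_distrib]
    refine Finset.sum_le_sum fun j _ => ?_
    nlinarith [sq_nonneg (s j + ξ ω j)]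
  have h2 : 0 ≤ ∑ j, s j ^ 2 := Finset.sum_nonneg fun j _ => sq_nonneg _
  have h3 : 0 ≤ ∑ j, ξ ω j ^ 2 := Finset.sum_nonneg fun j _ => sq_nonneg _
  have h4 := hρ0 ω
  nlinarith [mul_nonneg h2 h3, mul_nonneg h2 h4]

theorem KD_int (hg : Measurable g) (hξ : Measurable ξ) (hρ : Measurable ρ) (hρ0 : ∀ ω, 0 ≤ ρ ω)
    (hI : Integrable (fun ω => |g ω| * (1 + (∑ i, ξ ω i ^ 2 + ρ ω))) μ)
    (t : ℝ) (ht : 0 < t) (s : Fin N → ℝ) (h : Ω → ℝ) (hh : Measurable h) (C : ℝ)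
    (hC : ∀ ω, |h ω| ≤ C * (1 + (∑ i, ξ ω i ^ 2 + ρ ω))) :
    Integrable (fun ω => g ω * h ω * Real.exp (-(∑ j, (s j - ξ ω j) ^ 2 + ρ ω) / (2 * t))) μ :=
  kint g h (fun ω => ∑ j, (s j - ξ ω j) ^ 2 + ρ ω) _ t C hg hh (by fun_prop)
    (KD_q0 ρ ξ hρ0 s) ht hC hI

theorem KD3 (hg : Measurable g) (hξ : Measurable ξ) (hρ : Measurable ρ) (hρ0 : ∀ ω, 0 ≤ ρ ω)
    (hI : Integrable (fun ω => |g ω| * (1 + (∑ i, ξ ω i ^ 2 + ρ ω))) μ)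
    (t : ℝ) (ht : 0 < t) (s : Fin N → ℝ) :
    HasDerivAt (fun τ => ∫ ω, g ω * Real.exp (-(∑ j, (s j - ξ ω j) ^ 2 + ρ ω) / (2 * τ)) ∂μ)
      (∫ ω, g ω * ((∑ j, (s j - ξ ω j) ^ 2 + ρ ω) / (2 * t ^ 2)) *
        Real.exp (-(∑ j, (s j - ξ ω j) ^ 2 + ρ ω) / (2 * t)) ∂μ) t := by
  refine kderiv3 g (fun ω => ∑ j, (s j - ξ ω j) ^ 2 + ρ ω) t hg (by fun_prop) (KD_q0 ρ ξ hρ0 s) ht ?_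
  refine (hI.const_mul (2 + 2 * ∑ j, s j ^ 2)).mono' (by fun_prop) (Filter.Eventually.of_forall fun ω => ?_)
  have := KD_q0 ρ ξ hρ0 s ω
  rw [Real.norm_eq_abs, abs_mul, abs_abs,
    abs_of_nonneg (by positivity : 0 ≤ 1 + (∑ j, (s j - ξ ω j) ^ 2 + ρ ω))]
  calc _ ≤ |g ω| * ((2 + 2 * ∑ j, s j ^ 2) * (1 + (∑ i, ξ ω i ^ 2 + ρ ω))) := by
        gcongr; exact KD_qle ρ ξ hρ0 s ω
    _ = _ := by ring

/-- total energy moment splits -/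
theorem KD_lap (hg : Measurable g) (hξ : Measurable ξ) (hρ : Measurable ρ) (hρ0 : ∀ ω, 0 ≤ ρ ω)
    (hI : Integrable (fun ω => |g ω| * (1 + (∑ i, ξ ω i ^ 2 + ρ ω))) μ)
    (t : ℝ) (ht : 0 < t) (s : Fin N → ℝ) :
    ∫ ω, g ω * ((∑ j, (s j - ξ ω j) ^ 2 + ρ ω) / (2 * t ^ 2)) *
        Real.exp (-(∑ j, (s j - ξ ω j) ^ 2 + ρ ω) / (2 * t)) ∂μ
    = (1 / 2) * ∑ i, (∫ ω, g ω * ((ξ ω i - s i) ^ 2 / t ^ 2 - 1 / t) *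
        Real.exp (-(∑ j, (s j - ξ ω j) ^ 2 + ρ ω) / (2 * t)) ∂μ)
      + (N / (2 * t)) * (∫ ω, g ω * Real.exp (-(∑ j, (s j - ξ ω j) ^ 2 + ρ ω) / (2 * t)) ∂μ)
      + (1 / (2 * t ^ 2)) * (∫ ω, g ω * ρ ω * Real.exp (-(∑ j, (s j - ξ ω j) ^ 2 + ρ ω) / (2 * t)) ∂μ) := by
  have i1 := KD_int g ρ ξ hg hξ hρ hρ0 hI t ht s ρ hρ 1 (fun ω => by
    have h3 : 0 ≤ ∑ j, ξ ω j ^ 2 := Finset.sum_nonneg fun j _ => sq_nonneg _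
    rw [abs_of_nonneg (hρ0 ω)]; linarith)
  have i2 := KD_int g ρ ξ hg hξ hρ hρ0 hI t ht s (fun _ => 1) measurable_const 1 (fun ω => by
    have h3 : 0 ≤ ∑ j, ξ ω j ^ 2 := Finset.sum_nonneg fun j _ => sq_nonneg _
    have := hρ0 ω
    simp; linarith)
  simp only [mul_one] at i2
  have i3 : ∀ i, Integrable (fun ω => g ω * ((ξ ω i - s i) ^ 2 / t ^ 2 - 1 / t) *
        Real.exp (-(∑ j, (s j - ξ ω j) ^ 2 + ρ ω) / (2 * t))) μ := fun i => by
    refine KD_int g ρ ξ hg hξ hρ hρ0 hI t ht s _ (by fun_prop)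
      ((2 + 2 * ∑ j, s j ^ 2) * (1 / t ^ 2 + 1 / t)) (fun ω => ?_)
    have a1 : |(ξ ω i - s i) ^ 2 / t ^ 2 - 1 / t| ≤ (ξ ω i - s i) ^ 2 / t ^ 2 + 1 / t := by
      have := abs_sub ((ξ ω i - s i) ^ 2 / t ^ 2) (1 / t)
      rwa [abs_of_nonneg (by positivity : 0 ≤ (ξ ω i - s i) ^ 2 / t ^ 2), abs_of_pos (by positivity : 0 < 1 / t)] at this
    have a2 := KD_qle ρ ξ hρ0 s ω
    have h1 : (s i - ξ ω i) ^ 2 ≤ ∑ j, (s j - ξ ω j) ^ 2 :=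
      Finset.single_le_sum (f := fun j => (s j - ξ ω j) ^ 2) (fun j _ => sq_nonneg _) (Finset.mem_univ i)
    have h2 := hρ0 ω
    have a3 : (ξ ω i - s i) ^ 2 = (s i - ξ ω i) ^ 2 := by ring
    set Y := (2 + 2 * ∑ j, s j ^ 2) * (1 + (∑ i, ξ ω i ^ 2 + ρ ω)) with hY
    have b1 : (ξ ω i - s i) ^ 2 / t ^ 2 ≤ Y / t ^ 2 := by
      gcongr; linarith
    have b2 : 1 / t ≤ Y / t := by
      gcongr
      have := sq_nonneg (s i - ξ ω i)
      linarith
    calc _ ≤ Y / t ^ 2 + Y / t := by linarith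
      _ = _ := by rw [hY]; ring
  rw [← integral_finsetSum _ (fun i _ => i3 i), ← integral_const_mul, ← integral_const_mul,
    ← integral_const_mul, ← integral_add, ← integral_add]
  · refine integral_congr_ae (Filter.Eventually.of_forall fun ω => ?_)
    simp only
    rw [← Finset.sum_mul, ← Finset.mul_sum, Finset.sum_sub_distrib, ← Finset.sum_div]
    have : ∑ j, (ξ ω j - s j) ^ 2 = ∑ j, (s j - ξ ω j) ^ 2 := Finset.sum_congr rfl fun j _ => by ring
    rw [this]
    simp
    field_simp
    ring
  · exact ((integrable_finsetSum _ fun i _ => i3 i).const_mul _).add (i2.const_mul _)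
  · exact i1.const_mul _
  · exact (integrable_finsetSum _ fun i _ => i3 i).const_mul _
  · exact i2.const_mul _
end KD

/-! Vandermonde -/

noncomputable def vd {N : ℕ} (s : Fin N → ℝ) : ℝ := (Matrix.vandermonde s).det

noncomputable def hh {N : ℕ} (s : Fin N → ℝ) (i : Fin N) : ℝ := ∑ j, (s i - s j)⁻¹

theorem vd_cont {N : ℕ} : Continuous (vd : (Fin N → ℝ) → ℝ) := by
  unfold vd
  simp_rw [Matrix.det_vandermonde]
  fun_prop

theorem vd_ne {N : ℕ} {s : Fin N → ℝ} : vd s ≠ 0 ↔ Function.Injective s :=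
  Matrix.det_vandermonde_ne_zero_iff

theorem hasDerivAt_prod_log {ι : Type*} [DecidableEq ι] (P : Finset ι) (F : ι → ℝ → ℝ) (F' : ι → ℝ) (r : ℝ)
    (h : ∀ p ∈ P, HasDerivAt (F p) (F' p) r) (h0 : ∀ p ∈ P, F p r ≠ 0) :
    HasDerivAt (fun r => ∏ p ∈ P, F p r) ((∏ p ∈ P, F p r) * ∑ p ∈ P, F' p / F p r) r := by
  induction P using Finset.induction_on with
  | empty => simpa using hasDerivAt_const r (1 : ℝ)
  | insert a P ha ih =>
    have ih' := ih (fun p hp => h p (Finset.mem_insert_of_mem hp)) (fun p hp => h0 p (Finset.mem_insert_of_mem hp))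
    have h1 := (h a (Finset.mem_insert_self _ _)).mul ih'
    have e : (fun r => ∏ p ∈ insert a P, F p r) = fun r => F a r * ∏ p ∈ P, F p r := by
      funext r; rw [Finset.prod_insert ha]
    rw [e]
    refine h1.congr_deriv ?_
    rw [Finset.prod_insert ha, Finset.sum_insert ha]
    have := h0 a (Finset.mem_insert_self _ _)
    field_simp

theorem vd_deriv {N : ℕ} (s : Fin N → ℝ) (i : Fin N) (r : ℝ)
    (hr : Function.Injective (Function.update s i r)) :
    HasDerivAt (fun r => vd (Function.update s i r))
      (vd (Function.update s i r) * hh (Function.update s i r) i) r := by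
  set u := Function.update s i r with hu
  have hupd : ∀ k, HasDerivAt (fun r => Function.update s i r k) (if k = i then 1 else 0) r := by
    intro k
    by_cases hk : k = i
    · subst hk; simpa using hasDerivAt_id' r
    · simpa [hk] using hasDerivAt_const r (s k)
  have e : (fun r => vd (Function.update s i r)) = fun r => ∏ p ∈ Finset.univ.filter
      (fun p : Fin N × Fin N => p.1 < p.2), (Function.update s i r p.2 - Function.update s i r p.1) := by
    funext r
    unfold vd
    rw [Matrix.det_vandermonde, Finset.prod_filter, Fintype.prod_prod_type]
    refine Finset.prod_congr rfl fun a _ => ?_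
    rw [← Finset.prod_filter]
    refine Finset.prod_congr ?_ fun _ _ => rfl
    ext b; simp
  have h1 := hasDerivAt_prod_log (Finset.univ.filter (fun p : Fin N × Fin N => p.1 < p.2))
    (fun p r => Function.update s i r p.2 - Function.update s i r p.1)
    (fun p => (if p.2 = i then 1 else 0) - (if p.1 = i then 1 else 0)) r
    (fun p _ => (hupd p.2).sub (hupd p.1))
    (fun p hp => by
      simp at hp
      rw [sub_ne_zero]
      exact fun hc => hp.ne' (hr hc))
  have e2 := congrFun e r
  beta_reduce at e2
  rw [e, hu, e2]
  refine h1.congr_deriv ?_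
  congr 1
  rw [← hu, Finset.sum_filter, Fintype.sum_prod_type]
  unfold hh
  have : ∀ a b : Fin N, (if a < b then ((if b = i then (1:ℝ) else 0) - (if a = i then 1 else 0)) / (u b - u a) else 0)
      = (if b = i then (if a < i then (u i - u a)⁻¹ else 0) else 0)
        + (if a = i then (if i < b then (u i - u b)⁻¹ else 0) else 0) := by
    intro a b
    by_cases h1 : b = i <;> by_cases h2 : a = i
    · subst h1; subst h2; simp
    · subst h1; simp [h2]
    · subst h2; simp [h1]
      rw [← neg_sub (u a) (u b), neg_div_neg_eq, one_div]
    · simp [h1, h2]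
  simp_rw [this, Finset.sum_add_distrib]
  simp only [Finset.sum_ite_eq', Finset.sum_ite_eq, Finset.mem_univ, if_true]
  rw [Finset.sum_comm (f := fun a b => if a = i then (if i < b then (u i - u b)⁻¹ else 0) else 0)]
  simp only [Finset.sum_ite_eq', Finset.sum_ite_eq, Finset.mem_univ, if_true]
  rw [← Finset.sum_add_distrib]
  refine Finset.sum_congr rfl fun a _ => ?_
  rcases lt_trichotomy a i with h | h | h
  · simp [h, h.not_gt]
  · subst h; simp
  · simp [h, h.not_gt]

theorem hh_deriv {N : ℕ} (s : Fin N → ℝ) (i : Fin N) (hs : Function.Injective s) :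
    HasDerivAt (fun r => hh (Function.update s i r) i) (-∑ j, ((s i - s j)⁻¹) ^ 2) (s i) := by
  unfold hh
  rw [← Finset.sum_neg_distrib]
  apply HasDerivAt.fun_sum
  intro j _
  by_cases hj : j = i
  · subst hj; simpa using hasDerivAt_const (s j) (0 : ℝ)
  · simp only [Function.update_self, Function.update_of_ne hj]
    have hne : s i - s j ≠ 0 := sub_ne_zero.2 fun h => hj (hs h).symm
    have := ((hasDerivAt_id' (s i)).sub_const (s j)).inv hne
    refine this.congr_deriv ?_
    field_simp

theorem hh_identity {N : ℕ} (s : Fin N → ℝ) (hs : Function.Injective s) :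
    ∑ i, ((hh s i) ^ 2 - ∑ j, ((s i - s j)⁻¹) ^ 2) = 0 := by
  unfold hh
  set a : Fin N → Fin N → ℝ := fun i j => (s i - s j)⁻¹ with ha
  have e1 : ∑ i, (∑ j, a i j) ^ 2 = ∑ i, ∑ j, ∑ k, a i j * a i k := by
    refine Finset.sum_congr rfl fun i _ => ?_
    rw [sq, Finset.sum_mul_sum]
  have c1 : ∑ i, ∑ j, ∑ k, a i j * a i k = ∑ i, ∑ j, ∑ k, a j k * a j i := by
    rw [Finset.sum_comm]
    refine Finset.sum_congr rfl fun i _ => ?_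
    refine Finset.sum_congr rfl fun j _ => ?_
    refine Finset.sum_congr rfl fun k _ => ?_
    ring
  have c2 : ∑ i, ∑ j, ∑ k, a i j * a i k = ∑ i, ∑ j, ∑ k, a k i * a k j := by
    symm
    calc ∑ i, ∑ j, ∑ k, a k i * a k j = ∑ i, ∑ k, ∑ j, a k i * a k j :=
          Finset.sum_congr rfl fun i _ => Finset.sum_comm
      _ = ∑ k, ∑ i, ∑ j, a k i * a k j := Finset.sum_comm
  have key : ∀ i j k, a i j * a i k + a j k * a j i + a k i * a k j =
      (if j = k then a i j ^ 2 else 0) + (if i = j then a k i ^ 2 else 0) + (if i = k then a j i ^ 2 else 0) := by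
    intro i j k
    have a0 : ∀ i, a i i = 0 := by simp [ha]
    by_cases h1 : i = j
    · subst h1
      by_cases h2 : i = k
      · subst h2; simp [a0]
      · simp [a0, h2, sq]
    · by_cases h2 : i = k
      · subst h2; simp [a0, h1, Ne.symm h1, sq]
      · by_cases h3 : j = k
        · subst h3; simp [a0, h1, sq]
        · simp only [h1, h2, h3, if_false, ha]
          have n1 : s i - s j ≠ 0 := sub_ne_zero.2 fun h => h1 (hs h)
          have n2 : s i - s k ≠ 0 := sub_ne_zero.2 fun h => h2 (hs h)
          have n3 : s j - s k ≠ 0 := sub_ne_zero.2 fun h => h3 (hs h)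
          rw [← neg_sub (s i) (s j), ← neg_sub (s i) (s k), ← neg_sub (s j) (s k)]
          field_simp
          ring
  have tot : ∑ i, ∑ j, ∑ k, (a i j * a i k + a j k * a j i + a k i * a k j) = 3 * ∑ i, ∑ j, a i j ^ 2 := by
    simp_rw [key, Finset.sum_add_distrib]
    have t2 : ∑ i, ∑ j, ∑ k, (if i = j then a k i ^ 2 else 0) = ∑ i, ∑ j, a i j ^ 2 := by
      have : ∀ i : Fin N, ∑ j, ∑ k, (if i = j then a k i ^ 2 else 0) = ∑ k, a k i ^ 2 := by
        intro i; rw [Finset.sum_comm]; simp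
      rw [Finset.sum_congr rfl fun i _ => this i, Finset.sum_comm]
    have t3 : ∑ i, ∑ j, ∑ k, (if i = k then a j i ^ 2 else 0) = ∑ i, ∑ j, a i j ^ 2 := by
      simp
      rw [Finset.sum_comm]
    rw [t2, t3]
    simp
    ring
  simp_rw [Finset.sum_add_distrib] at tot
  rw [← c1, ← c2] at tot
  rw [Finset.sum_sub_distrib, e1]
  linarith


section Herm
variable {N : ℕ}

theorem hermOf_diag (c : HCoords N) (i : Fin N) : hermOf c i i = (c.1 i : ℂ) := by
  simp [hermOf]

theorem hermOf_lt (c : HCoords N) (p : OffIdx N) : hermOf c p.1.1 p.1.2 = c.2 p := by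
  simp [hermOf, p.2]

theorem hermOf_star (c : HCoords N) (i j : Fin N) : star (hermOf c i j) = hermOf c j i := by
  rcases lt_trichotomy i j with h | h | h
  · simp [hermOf, h, h.not_gt]
  · subst h; simp [hermOf]
  · simp [hermOf, h, h.not_gt]

theorem hermOf_conjT (c : HCoords N) : (hermOf c)ᴴ = hermOf c := by
  ext i j; rw [conjTranspose_apply, hermOf_star]

noncomputable def toC (Y : Matrix (Fin N) (Fin N) ℂ) : HCoords N :=
  (fun i => (Y i i).re, fun p => Y p.1.1 p.1.2)

theorem toC_hermOf (c : HCoords N) : toC (hermOf c) = c := by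
  refine Prod.ext ?_ ?_
  · funext i; simp [toC, hermOf_diag]
  · funext p; exact hermOf_lt c p

theorem hermOf_toC (Y : Matrix (Fin N) (Fin N) ℂ) (hY : Yᴴ = Y) : hermOf (toC Y) = Y := by
  have hs : ∀ i j, star (Y i j) = Y j i := fun i j => by
    conv_rhs => rw [← hY]
    rfl
  ext i j
  rcases lt_trichotomy i j with h | h | h
  · simp [hermOf, h, toC]
  · subst h
    simp only [hermOf, toC, of_apply, lt_irrefl, dite_false]
    have := hs i i
    exact Complex.conj_eq_iff_re.1 this
  · simp only [hermOf, toC, of_apply, h.not_gt, h, dite_false, dite_true]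
    exact hs j i

theorem hermOf_add (c d : HCoords N) : hermOf (c + d) = hermOf c + hermOf d := by
  ext i j
  simp only [hermOf, of_apply, Matrix.add_apply]
  split_ifs <;> simp

theorem hermOf_smul (a : ℝ) (c : HCoords N) : hermOf (a • c) = a • hermOf c := by
  ext i j
  simp only [hermOf, of_apply, Matrix.smul_apply]
  split_ifs <;> simp

theorem hermOf_cont : Continuous (hermOf : HCoords N → _) := by
  refine continuous_matrix fun i j => ?_
  simp only [hermOf, of_apply]
  split_ifs <;> fun_prop

noncomputable def rho (c : HCoords N) : ℝ := ∑ i, ∑ j, if i = j then 0 else ‖hermOf c i j‖ ^ 2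

noncomputable def Qh (c : HCoords N) : ℝ := ∑ i, c.1 i ^ 2 + rho c

noncomputable def tr4 (c : HCoords N) : ℝ := (trace ((hermOf c) ^ 4)).re

theorem entry_cont (i j : Fin N) : Continuous fun c : HCoords N => hermOf c i j :=
  hermOf_cont.matrix_elem i j

theorem rho_cont : Continuous (rho : HCoords N → ℝ) := by
  unfold rho
  refine continuous_finsetSum _ fun i _ => continuous_finsetSum _ fun j _ => ?_
  have := entry_cont (N := N) i j
  split_ifs <;> fun_prop

theorem Qh_cont : Continuous (Qh : HCoords N → ℝ) := by
  unfold Qh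
  have := rho_cont (N := N)
  fun_prop

theorem tr4_cont : Continuous (tr4 : HCoords N → ℝ) := by
  unfold tr4
  exact Complex.continuous_re.comp ((hermOf_cont.pow 4).matrix_trace)

theorem rho_nonneg (c : HCoords N) : 0 ≤ rho c :=
  Finset.sum_nonneg fun i _ => Finset.sum_nonneg fun j _ => by split_ifs <;> positivity

theorem Qh_nonneg (c : HCoords N) : 0 ≤ Qh c :=
  add_nonneg (Finset.sum_nonneg fun i _ => sq_nonneg _) (rho_nonneg c)

theorem trace_sq_herm (Y : Matrix (Fin N) (Fin N) ℂ) (hY : Yᴴ = Y) :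
    (trace (Y * Y)).re = ∑ i, ∑ j, ‖Y i j‖ ^ 2 := by
  have hs : ∀ i j, star (Y i j) = Y j i := fun i j => by
    conv_rhs => rw [← hY]
    rfl
  simp only [trace, diag_apply, mul_apply, Complex.re_sum]
  refine Finset.sum_congr rfl fun i _ => Finset.sum_congr rfl fun j _ => ?_
  rw [← hs i j]
  have : Y i j * star (Y i j) = ((‖Y i j‖ ^ 2 : ℝ) : ℂ) := by
    rw [Complex.star_def, Complex.mul_conj, Complex.normSq_eq_norm_sq]
  rw [this, Complex.ofReal_re]

theorem Qh_eq_sum (c : HCoords N) : Qh c = ∑ i, ∑ j, ‖hermOf c i j‖ ^ 2 := by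
  unfold Qh rho
  rw [← Finset.sum_add_distrib]
  refine Finset.sum_congr rfl fun i _ => ?_
  rw [← Finset.add_sum_erase _ (fun j => ‖hermOf c i j‖ ^ 2) (Finset.mem_univ i),
    ← Finset.add_sum_erase _ (fun j => if i = j then 0 else ‖hermOf c i j‖ ^ 2) (Finset.mem_univ i)]
  simp only [if_true, zero_add, hermOf_diag]
  congr 1
  · simp
  · exact Finset.sum_congr rfl fun j hj => by rw [if_neg (Finset.ne_of_mem_erase hj).symm]

theorem Qh_eq (c : HCoords N) : Qh c = (trace (hermOf c * hermOf c)).re := by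
  rw [trace_sq_herm _ (hermOf_conjT c), Qh_eq_sum]

theorem Qh_smul (r : ℝ) (c : HCoords N) : Qh (r • c) = r ^ 2 * Qh c := by
  simp only [Qh_eq_sum, hermOf_smul, Finset.mul_sum]
  refine Finset.sum_congr rfl fun i _ => Finset.sum_congr rfl fun j _ => ?_
  simp [mul_pow]

theorem tr4_ge (c : HCoords N) : Qh c ^ 2 ≤ N * tr4 c := by
  set Y := hermOf c * hermOf c with hYd
  have hY : Yᴴ = Y := by rw [hYd, conjTranspose_mul, hermOf_conjT]
  have e : tr4 c = (trace (Y * Y)).re := by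
    unfold tr4; rw [hYd]; congr 2; noncomm_ring
  rw [e, trace_sq_herm Y hY, Qh_eq, trace, Complex.re_sum]
  have h1 : (∑ i, (diag Y i).re) ^ 2 ≤ (Finset.univ : Finset (Fin N)).card * ∑ i, (diag Y i).re ^ 2 :=
    sq_sum_le_card_mul_sum_sq
  rw [Finset.card_univ, Fintype.card_fin] at h1
  refine h1.trans ?_
  gcongr with i
  have h2 : (diag Y i).re ^ 2 ≤ ‖Y i i‖ ^ 2 := by
    rw [← sq_abs]; gcongr; exact Complex.abs_re_le_norm _
  exact h2.trans (Finset.single_le_sum (f := fun j => ‖Y i j‖ ^ 2) (fun j _ => by positivity) (Finset.mem_univ i))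

theorem int_exp_complex (a : ℝ) (ha : 0 < a) : Integrable (fun z : ℂ => Real.exp (-a * ‖z‖ ^ 2)) := by
  have := (GaussianFourier.integrable_cexp_neg_mul_sq_norm_add (V := ℂ) (b := (a : ℂ)) (by simpa using ha) 0 0).norm
  refine this.congr (Filter.Eventually.of_forall fun z => ?_)
  simp only [Complex.norm_exp]
  congr 1
  simp
  left
  rw [← Complex.ofReal_pow, Complex.ofReal_re]

theorem int_exp_Q (a : ℝ) (ha : 0 < a) : Integrable (fun c : HCoords N => Real.exp (-a * Qh c)) := by
  have h1 : Integrable (fun x : Fin N → ℝ => ∏ i, Real.exp (-a * x i ^ 2)) :=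
    Integrable.fintype_prod (f := fun _ (x : ℝ) => Real.exp (-a * x ^ 2)) fun i => integrable_exp_neg_mul_sq ha
  have h2 : Integrable (fun z : OffIdx N → ℂ => ∏ p, Real.exp (-a * ‖z p‖ ^ 2)) :=
    Integrable.fintype_prod (f := fun _ (x : ℂ) => Real.exp (-a * ‖x‖ ^ 2)) fun i => int_exp_complex a ha
  have h3 := h1.mul_prod h2
  refine h3.mono' (by have := Qh_cont (N := N); apply Continuous.aestronglyMeasurable; fun_prop)
    (Filter.Eventually.of_forall fun c => ?_)
  rw [Real.norm_eq_abs, abs_of_pos (Real.exp_pos _), ← Real.exp_sum, ← Real.exp_sum, ← Real.exp_add]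
  apply Real.exp_le_exp.2
  rw [← Finset.mul_sum, ← Finset.mul_sum, ← mul_add]
  have : ∑ p, ‖c.2 p‖ ^ 2 ≤ rho c := by
    unfold rho
    rw [← Fintype.sum_prod_type' (f := fun i j => if i = j then 0 else ‖hermOf c i j‖ ^ 2)]
    have e : ∑ p, ‖c.2 p‖ ^ 2 = ∑ p ∈ (Finset.univ.filter fun p : Fin N × Fin N => p.1 < p.2),
        (if p.1 = p.2 then 0 else ‖hermOf c p.1 p.2‖ ^ 2) := by
      rw [← Finset.sum_subtype_eq_sum_filter, Finset.subtype_univ]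
      refine Finset.sum_congr rfl fun p _ => ?_
      rw [if_neg p.2.ne, hermOf_lt]
    rw [e]
    exact Finset.sum_le_sum_of_subset_of_nonneg (Finset.filter_subset _ _)
      fun p _ _ => by split_ifs <;> positivity
  unfold Qh
  nlinarith

theorem finrank_H : Module.finrank ℝ (HCoords N) = N * N := by
  have h : Fintype.card (OffIdx N) * 2 + N = N * N := by
    have e1 : Fintype.card (OffIdx N) = ((Finset.univ : Finset (Fin N × Fin N)).filter fun p => p.1 < p.2).card :=
      Fintype.card_subtype _
    have e2 : ((Finset.univ : Finset (Fin N × Fin N)).filter fun p => p.2 < p.1).card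
        = ((Finset.univ : Finset (Fin N × Fin N)).filter fun p => p.1 < p.2).card := by
      refine Finset.card_bij (fun p _ => (p.2, p.1)) ?_ ?_ ?_
      · intro p hp; simpa using hp
      · rintro ⟨a, b⟩ _ ⟨a', b'⟩ _ h; simp at h ⊢; exact ⟨h.2, h.1⟩
      · rintro ⟨a, b⟩ hp; exact ⟨(b, a), by simpa using hp, rfl⟩
    have e3 : ((Finset.univ : Finset (Fin N × Fin N)).filter fun p => p.1 = p.2).card = N := by
      have := Finset.diag_card (Finset.univ : Finset (Fin N))
      rw [Finset.card_univ, Fintype.card_fin] at this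
      conv_rhs => rw [← this]
      congr 1
      ext ⟨a, b⟩; simp
    have e4 := Finset.card_filter_add_card_filter_not (s := (Finset.univ : Finset (Fin N × Fin N))) (fun p => p.1 < p.2)
    have e5 := Finset.card_filter_add_card_filter_not
      (s := (Finset.univ : Finset (Fin N × Fin N)).filter fun p => ¬ p.1 < p.2) (fun p => p.1 = p.2)
    rw [Finset.filter_filter, Finset.filter_filter] at e5
    have e6 : ((Finset.univ : Finset (Fin N × Fin N)).filter fun p => ¬ p.1 < p.2 ∧ p.1 = p.2)
      = (Finset.univ : Finset (Fin N × Fin N)).filter fun p => p.1 = p.2 := by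
      ext p; simp; intro h; exact h.ge
    have e7 : ((Finset.univ : Finset (Fin N × Fin N)).filter fun p => ¬ p.1 < p.2 ∧ ¬ p.1 = p.2)
      = (Finset.univ : Finset (Fin N × Fin N)).filter fun p => p.2 < p.1 := by
      ext p; simp; constructor
      · rintro ⟨h1, h2⟩; exact lt_of_le_of_ne h1 (Ne.symm h2)
      · intro h; exact ⟨h.le, h.ne'⟩
    rw [e6, e7, e2, e3] at e5
    have e8 : (Finset.univ : Finset (Fin N × Fin N)).card = N * N := by simp
    omega
  rw [Module.finrank_prod, Module.finrank_pi, Module.finrank_pi_fintype]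
  simp only [Complex.finrank_real_complex, Finset.sum_const, smul_eq_mul, Fintype.card_fin, Finset.card_univ]
  omega

noncomputable def conjL (U : Matrix (Fin N) (Fin N) ℂ) : HCoords N →ₗ[ℝ] HCoords N where
  toFun c := toC (U * hermOf c * Uᴴ)
  map_add' c d := by
    rw [hermOf_add, mul_add, add_mul]; rfl
  map_smul' a c := by
    rw [hermOf_smul, mul_smul_comm, smul_mul_assoc]
    refine Prod.ext ?_ ?_
    · funext i; simp [toC]
    · funext p; simp [toC]

theorem hermOf_conjL (U : Matrix (Fin N) (Fin N) ℂ) (c : HCoords N) :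
    hermOf (conjL U c) = U * hermOf c * Uᴴ := by
  apply hermOf_toC
  rw [conjTranspose_mul, conjTranspose_mul, conjTranspose_conjTranspose, hermOf_conjT, mul_assoc]

theorem conjL_inv (U : Matrix (Fin N) (Fin N) ℂ) (hU : Uᴴ * U = 1) (c : HCoords N) :
    conjL Uᴴ (conjL U c) = c := by
  have : hermOf (conjL Uᴴ (conjL U c)) = hermOf c := by
    rw [hermOf_conjL, hermOf_conjL, conjTranspose_conjTranspose]
    calc Uᴴ * (U * hermOf c * Uᴴ) * U = (Uᴴ * U) * hermOf c * (Uᴴ * U) := by noncomm_ring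
      _ = _ := by rw [hU]; simp
  rw [← toC_hermOf (conjL Uᴴ (conjL U c)), this, toC_hermOf]

theorem Qh_conjL (U : Matrix (Fin N) (Fin N) ℂ) (hU : Uᴴ * U = 1) (c : HCoords N) :
    Qh (conjL U c) = Qh c := by
  rw [Qh_eq, Qh_eq, hermOf_conjL]
  congr 1
  calc trace (U * hermOf c * Uᴴ * (U * hermOf c * Uᴴ))
      = trace (U * (hermOf c * (Uᴴ * U) * hermOf c * Uᴴ)) := by congr 1; noncomm_ring
    _ = trace (hermOf c * (Uᴴ * U) * hermOf c * (Uᴴ * U)) := by rw [trace_mul_comm, mul_assoc]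
    _ = _ := by rw [hU]; simp

theorem conj_mul_conj (U Y Z : Matrix (Fin N) (Fin N) ℂ) (hU : Uᴴ * U = 1) :
    (U * Y * Uᴴ) * (U * Z * Uᴴ) = U * (Y * Z) * Uᴴ := by
  calc (U * Y * Uᴴ) * (U * Z * Uᴴ) = U * Y * (Uᴴ * U) * Z * Uᴴ := by simp only [mul_assoc]
    _ = _ := by rw [hU]; simp only [mul_assoc, one_mul]

theorem tr4_conjL (U : Matrix (Fin N) (Fin N) ℂ) (hU : Uᴴ * U = 1) (c : HCoords N) :
    tr4 (conjL U c) = tr4 c := by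
  unfold tr4
  rw [hermOf_conjL]
  generalize hermOf c = Y
  have h4 : ∀ X : Matrix (Fin N) (Fin N) ℂ, X ^ 4 = (X * X) * (X * X) := fun X => by
    rw [show (4:ℕ) = 2 + 2 from rfl, pow_add, pow_two]
  rw [h4, h4, conj_mul_conj _ _ _ hU, conj_mul_conj _ _ _ hU, mul_assoc U, trace_mul_comm, mul_assoc, hU, mul_one]

theorem vol_haar : (volume : Measure (HCoords N)).IsAddHaarMeasure := by
  have : (volume : Measure (Fin N → ℝ)).IsAddHaarMeasure := inferInstance
  have : (volume : Measure (OffIdx N → ℂ)).IsAddHaarMeasure := inferInstance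
  exact inferInstanceAs (((volume : Measure (Fin N → ℝ)).prod (volume : Measure (OffIdx N → ℂ))).IsAddHaarMeasure)

theorem vol_ne : NeZero (volume : Measure (HCoords N)) := by
  have : (volume : Measure (HCoords N)).IsAddHaarMeasure := vol_haar
  exact ⟨fun h => isOpen_univ.measure_ne_zero (volume : Measure (HCoords N)) Set.univ_nonempty (by rw [h]; rfl)⟩

theorem integral_conjL (U : Matrix (Fin N) (Fin N) ℂ) (hU : Uᴴ * U = 1) (f : HCoords N → ℝ) :
    ∫ c, f (conjL U c) = ∫ c, f c := by
  have : (volume : Measure (HCoords N)).IsAddHaarMeasure := vol_haar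
  have hU' : U * Uᴴ = 1 := mul_eq_one_comm.1 hU
  let e : HCoords N ≃ₗ[ℝ] HCoords N := LinearEquiv.ofLinearMap (conjL U) (conjL Uᴴ)
    (LinearMap.ext fun c => by
      have := conjL_inv Uᴴ (by rwa [conjTranspose_conjTranspose]) c
      rw [conjTranspose_conjTranspose] at this
      exact this)
    (LinearMap.ext fun c => conjL_inv U hU c)
  have hdet : LinearMap.det (conjL U) ≠ 0 := (LinearEquiv.isUnit_det' e).ne_zero
  have hmap := Measure.map_linearMap_addHaar_eq_smul_addHaar (volume : Measure (HCoords N)) hdet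
  have hemb : MeasurableEmbedding (conjL U) := e.toContinuousLinearEquiv.toHomeomorph.measurableEmbedding
  have key : ∀ f : HCoords N → ℝ, ∫ c, f (conjL U c) = |(LinearMap.det (conjL U))⁻¹| * ∫ c, f c := by
    intro f
    rw [← hemb.integral_map, hmap, integral_smul_measure, ENNReal.toReal_ofReal (abs_nonneg _), smul_eq_mul]
  have h1 := key fun c => Real.exp (-1 * Qh c)
  simp_rw [Qh_conjL U hU] at h1
  have : NeZero (volume : Measure (HCoords N)) := vol_ne
  have hpos : 0 < ∫ c : HCoords N, Real.exp (-1 * Qh c) := integral_exp_pos (int_exp_Q 1 one_pos)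
  have h2 : |(LinearMap.det (conjL U))⁻¹| = 1 := by
    have : (|(LinearMap.det (conjL U))⁻¹| - 1) * ∫ c : HCoords N, Real.exp (-1 * Qh c) = 0 := by linarith
    rcases mul_eq_zero.1 this with h | h
    · linarith
    · exact absurd h hpos.ne'
  rw [key, h2, one_mul]
end Herm


theorem rot_abs {Ω : Type*} [MeasurableSpace Ω] {μ : Measure Ω} (φ E d p : Ω → ℝ) (δ t : ℝ) (ht : 0 < t)
    (hφ : Measurable φ) (hE : Measurable E) (hd : Measurable d) (hp : Measurable p)
    (hE0 : ∀ θ ω, 0 ≤ E ω - 2 * δ * ((Real.cos θ * d ω - Real.sin θ * p ω) - d ω))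
    (hI : Integrable (fun ω => |φ ω| * (1 + (d ω ^ 2 + p ω ^ 2))) μ)
    (hconst : ∀ θ, ∫ ω, φ ω * (Real.sin θ * d ω + Real.cos θ * p ω) *
        Real.exp (-(E ω - 2 * δ * ((Real.cos θ * d ω - Real.sin θ * p ω) - d ω)) / (2 * t)) ∂μ
      = ∫ ω, φ ω * p ω * Real.exp (-(E ω) / (2 * t)) ∂μ) :
    ∫ ω, φ ω * (d ω - δ * p ω ^ 2 / t) * Real.exp (-(E ω) / (2 * t)) ∂μ = 0 := by
  have hexp : ∀ θ ω, Real.exp (-(E ω - 2 * δ * ((Real.cos θ * d ω - Real.sin θ * p ω) - d ω)) / (2 * t)) ≤ 1 := by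
    intro θ ω
    rw [Real.exp_le_one_iff]
    apply div_nonpos_of_nonpos_of_nonneg
    · linarith [hE0 θ ω]
    · positivity
  have hw : ∀ θ x y : ℝ, (Real.sin θ * x + Real.cos θ * y) ^ 2 ≤ x ^ 2 + y ^ 2 := by
    intro θ x y
    nlinarith [Real.sin_sq_add_cos_sq θ, sq_nonneg (Real.cos θ * x - Real.sin θ * y)]
  have hv : ∀ θ x y : ℝ, (Real.cos θ * x - Real.sin θ * y) ^ 2 ≤ x ^ 2 + y ^ 2 := by
    intro θ x y
    nlinarith [Real.sin_sq_add_cos_sq θ, sq_nonneg (Real.sin θ * x + Real.cos θ * y)]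
  have main := hasDerivAt_integral_of_dominated_loc_of_deriv_le (μ := μ) (x₀ := (0:ℝ)) (s := Set.univ)
    (F := fun θ ω => φ ω * (Real.sin θ * d ω + Real.cos θ * p ω) *
        Real.exp (-(E ω - 2 * δ * ((Real.cos θ * d ω - Real.sin θ * p ω) - d ω)) / (2 * t)))
    (F' := fun θ ω => φ ω * ((Real.cos θ * d ω - Real.sin θ * p ω)
        - δ * (Real.sin θ * d ω + Real.cos θ * p ω) ^ 2 / t) *
        Real.exp (-(E ω - 2 * δ * ((Real.cos θ * d ω - Real.sin θ * p ω) - d ω)) / (2 * t)))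
    (bound := fun ω => (1 + |δ| / t) * (|φ ω| * (1 + (d ω ^ 2 + p ω ^ 2))))
    Filter.univ_mem
    (Filter.Eventually.of_forall fun θ => by fun_prop) ?_ (by fun_prop) ?_ (hI.const_mul _) ?_
  · have h1 := main.2
    have h2 : (fun θ => ∫ ω, φ ω * (Real.sin θ * d ω + Real.cos θ * p ω) *
        Real.exp (-(E ω - 2 * δ * ((Real.cos θ * d ω - Real.sin θ * p ω) - d ω)) / (2 * t)) ∂μ)
        = fun _ => ∫ ω, φ ω * p ω * Real.exp (-(E ω) / (2 * t)) ∂μ := funext hconst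
    rw [h2] at h1
    have h3 := h1.unique (hasDerivAt_const (0:ℝ) _)
    rw [← h3]
    refine integral_congr_ae (Filter.Eventually.of_forall fun ω => ?_)
    simp
  · refine hI.mono' (by fun_prop) (Filter.Eventually.of_forall fun ω => ?_)
    rw [Real.norm_eq_abs, abs_mul, abs_mul, Real.abs_exp]
    have h1 : |Real.sin 0 * d ω + Real.cos 0 * p ω| ≤ 1 + (d ω ^ 2 + p ω ^ 2) := by
      have := hw 0 (d ω) (p ω)
      have h5 := sq_abs (Real.sin 0 * d ω + Real.cos 0 * p ω)
      nlinarith [sq_nonneg (|Real.sin 0 * d ω + Real.cos 0 * p ω| - 1)]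
    calc _ ≤ |φ ω| * |Real.sin 0 * d ω + Real.cos 0 * p ω| * 1 := by gcongr; exact hexp 0 ω
      _ ≤ _ := by rw [mul_one]; gcongr
  · refine Filter.Eventually.of_forall fun ω θ _ => ?_
    rw [Real.norm_eq_abs, abs_mul, abs_mul, Real.abs_exp]
    have h1 : |(Real.cos θ * d ω - Real.sin θ * p ω) - δ * (Real.sin θ * d ω + Real.cos θ * p ω) ^ 2 / t|
        ≤ (1 + |δ| / t) * (1 + (d ω ^ 2 + p ω ^ 2)) := by
      have a1 := hv θ (d ω) (p ω)
      have a2 := hw θ (d ω) (p ω)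
      generalize Real.cos θ * d ω - Real.sin θ * p ω = v at *
      generalize Real.sin θ * d ω + Real.cos θ * p ω = w at *
      have a3 : |v| ≤ 1 + (d ω ^ 2 + p ω ^ 2) := by
        have h5 := sq_abs v
        nlinarith [sq_nonneg (|v| - 1)]
      have a4 : |δ * w ^ 2 / t| ≤ |δ| / t * (1 + (d ω ^ 2 + p ω ^ 2)) := by
        rw [abs_div, abs_mul, abs_of_pos ht, abs_of_nonneg (sq_nonneg w), mul_div_right_comm]
        gcongr
        linarith
      calc _ ≤ |v| + |δ * w ^ 2 / t| := abs_sub _ _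
        _ ≤ _ := by linarith
    calc _ ≤ |φ ω| * ((1 + |δ| / t) * (1 + (d ω ^ 2 + p ω ^ 2))) * 1 := by gcongr; exact hexp θ ω
      _ = _ := by ring
  · refine Filter.Eventually.of_forall fun ω θ _ => ?_
    have c1 := Real.hasDerivAt_cos θ
    have s1 := Real.hasDerivAt_sin θ
    have v1 := (c1.mul_const (d ω)).sub (s1.mul_const (p ω))
    have w1 := (s1.mul_const (d ω)).add (c1.mul_const (p ω))
    have e1 := ((((v1.sub_const (d ω)).const_mul (2 * δ)).const_sub (E ω)).neg.div_const (2 * t)).exp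
    refine ((w1.const_mul (φ ω)).mul e1).congr_deriv ?_
    simp only [Pi.sub_apply, Pi.add_apply, Pi.neg_apply]
    field_simp
    ring

section Herm
variable {N : ℕ}

theorem conj_entry (U X : Matrix (Fin N) (Fin N) ℂ) (k l : Fin N) :
    (U * X * Uᴴ) k l = ∑ a, ∑ b, U k a * X a b * star (U l b) := by
  simp only [Matrix.mul_apply, conjTranspose_apply, Finset.sum_mul]
  rw [Finset.sum_comm]

/-- rotation rows -/
noncomputable def rotU (i j : Fin N) (α : ℝ) : Matrix (Fin N) (Fin N) ℂ := fun k a =>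
  if k = i then (if a = i then (Real.cos α : ℂ) else if a = j then -(Real.sin α : ℂ) else 0)
  else if k = j then (if a = i then (Real.sin α : ℂ) else if a = j then (Real.cos α : ℂ) else 0)
  else if a = k then 1 else 0

theorem sum_two (i j : Fin N) (h : i ≠ j) (x y : ℂ) (f : Fin N → ℂ) :
    ∑ a, (if a = i then x else if a = j then y else 0) * f a = x * f i + y * f j := by
  rw [Finset.sum_eq_add_of_mem i j (Finset.mem_univ _) (Finset.mem_univ _) h]
  · simp [h.symm]
  · rintro c - ⟨h1, h2⟩; simp [h1, h2]

theorem rot_form (i j : Fin N) (h : i ≠ j) (α : ℝ) (X : Matrix (Fin N) (Fin N) ℂ) (k l : Fin N) :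
    (rotU i j α * X * (rotU i j α)ᴴ) k l = ∑ a, rotU i j α k a * ∑ b, rotU i j α l b * X a b := by
  rw [conj_entry]
  refine Finset.sum_congr rfl fun a _ => ?_
  rw [Finset.mul_sum]
  refine Finset.sum_congr rfl fun b _ => ?_
  have : star (rotU i j α l b) = rotU i j α l b := by
    unfold rotU
    split_ifs <;> simp [← Complex.ofReal_cos, ← Complex.ofReal_sin, -Complex.ofReal_cos, -Complex.ofReal_sin]
  rw [this]; ring

theorem rot_i (i j : Fin N) (h : i ≠ j) (α : ℝ) (f : Fin N → ℂ) :
    ∑ a, rotU i j α i a * f a = (Real.cos α : ℂ) * f i - (Real.sin α : ℂ) * f j := by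
  have : ∀ a, rotU i j α i a = if a = i then (Real.cos α : ℂ) else if a = j then -(Real.sin α : ℂ) else 0 :=
    fun a => by simp [rotU]
  simp_rw [this]
  rw [sum_two i j h]; ring

theorem rot_j (i j : Fin N) (h : i ≠ j) (α : ℝ) (f : Fin N → ℂ) :
    ∑ a, rotU i j α j a * f a = (Real.sin α : ℂ) * f i + (Real.cos α : ℂ) * f j := by
  have : ∀ a, rotU i j α j a = if a = i then (Real.sin α : ℂ) else if a = j then (Real.cos α : ℂ) else 0 :=
    fun a => by simp [rotU, h.symm]
  simp_rw [this]
  rw [sum_two i j h]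

theorem rot_k (i j k : Fin N) (hi : k ≠ i) (hj : k ≠ j) (α : ℝ) (f : Fin N → ℂ) :
    ∑ a, rotU i j α k a * f a = f k := by
  simp [rotU, hi, hj]

theorem rot_unit (i j : Fin N) (h : i ≠ j) (α : ℝ) : (rotU i j α)ᴴ * rotU i j α = 1 := by
  rw [mul_eq_one_comm]
  have e := rot_form i j h α 1
  rw [mul_one] at e
  have hcs : (Real.cos α : ℂ) * (Real.cos α : ℂ) + (Real.sin α : ℂ) * (Real.sin α : ℂ) = 1 := by
    rw [← Complex.ofReal_mul, ← Complex.ofReal_mul, ← Complex.ofReal_add, ← Complex.ofReal_one]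
    congr 1
    nlinarith [Real.sin_sq_add_cos_sq α]
  ext k l
  rw [e]
  have hrow : ∀ k, (k = i ∨ k = j ∨ (k ≠ i ∧ k ≠ j)) := fun k => by tauto
  rcases hrow k with rfl | rfl | ⟨hk1, hk2⟩ <;> rcases hrow l with rfl | rfl | ⟨hl1, hl2⟩
  · simp only [rot_i _ _ h, Matrix.one_apply, h, h.symm, if_true, if_false]; linear_combination hcs
  · simp only [rot_i k l h, rot_j k l h, Matrix.one_apply, h, h.symm, if_true, if_false]; ring
  · simp only [rot_i k j h, rot_k k j l hl1 hl2, Matrix.one_apply, h, h.symm, hl1.symm, hl2.symm, if_true, if_false]; ring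
  · simp only [rot_i l k h, rot_j l k h, Matrix.one_apply, h, h.symm, if_true, if_false]; ring
  · simp only [rot_j _ _ h, Matrix.one_apply, h, h.symm, if_true, if_false]; linear_combination hcs
  · simp only [rot_j i k h, rot_k i k l hl1 hl2, Matrix.one_apply, h, h.symm, hl1.symm, hl2.symm, if_true, if_false]; ring
  · simp only [rot_i l j h, rot_k l j k hk1 hk2, Matrix.one_apply, h, h.symm, hk1, hk2, if_true, if_false]; ring
  · simp only [rot_j i l h, rot_k i l k hk1 hk2, Matrix.one_apply, h, h.symm, hk1, hk2, if_true, if_false]; ring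
  · simp only [rot_k i j l hl1 hl2, rot_k i j k hk1 hk2]

theorem conjL_diag (U : Matrix (Fin N) (Fin N) ℂ) (c : HCoords N) (k : Fin N) :
    (conjL U c).1 k = ((U * hermOf c * Uᴴ) k k).re := by
  rw [← hermOf_conjL, hermOf_diag, Complex.ofReal_re]

theorem re_ji (c : HCoords N) (i j : Fin N) : (hermOf c j i).re = (hermOf c i j).re := by
  rw [← hermOf_star]; simp

theorem rot_diag_i (i j : Fin N) (h : i ≠ j) (α : ℝ) (c : HCoords N) :
    (conjL (rotU i j α) c).1 i = Real.cos α ^ 2 * c.1 i + Real.sin α ^ 2 * c.1 j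
      - 2 * Real.cos α * Real.sin α * (hermOf c i j).re := by
  rw [conjL_diag, rot_form i j h, rot_i i j h, rot_i i j h, rot_i i j h, hermOf_diag, hermOf_diag]
  simp only [Complex.sub_re, Complex.re_ofReal_mul, Complex.ofReal_re, re_ji c i j]
  ring

theorem rot_diag_j (i j : Fin N) (h : i ≠ j) (α : ℝ) (c : HCoords N) :
    (conjL (rotU i j α) c).1 j = Real.sin α ^ 2 * c.1 i + Real.cos α ^ 2 * c.1 j
      + 2 * Real.cos α * Real.sin α * (hermOf c i j).re := by
  rw [conjL_diag, rot_form i j h, rot_j i j h, rot_j i j h, rot_j i j h, hermOf_diag, hermOf_diag]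
  simp only [Complex.add_re, Complex.re_ofReal_mul, Complex.ofReal_re, re_ji c i j]
  ring

theorem rot_diag_k (i j : Fin N) (h : i ≠ j) (α : ℝ) (c : HCoords N) (k : Fin N) (hi : k ≠ i) (hj : k ≠ j) :
    (conjL (rotU i j α) c).1 k = c.1 k := by
  rw [conjL_diag, rot_form i j h, rot_k i j k hi hj, rot_k i j k hi hj, hermOf_diag, Complex.ofReal_re]

theorem rot_off (i j : Fin N) (h : i ≠ j) (α : ℝ) (c : HCoords N) :
    (hermOf (conjL (rotU i j α) c) i j).re = Real.cos α * Real.sin α * (c.1 i - c.1 j)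
      + (Real.cos α ^ 2 - Real.sin α ^ 2) * (hermOf c i j).re := by
  rw [hermOf_conjL, rot_form i j h, rot_i i j h, rot_j i j h, rot_j i j h, hermOf_diag, hermOf_diag]
  simp only [Complex.add_re, Complex.sub_re, Complex.re_ofReal_mul, Complex.ofReal_re, re_ji c i j]
  ring

theorem energy_eq (s : Fin N → ℝ) (c : HCoords N) :
    ∑ k, (s k - c.1 k) ^ 2 + rho c = ∑ k, s k ^ 2 + Qh c - 2 * ∑ k, s k * c.1 k := by
  unfold Qh
  rw [Finset.mul_sum, ← sub_eq_zero]
  have : ∑ k, (s k - c.1 k) ^ 2 = ∑ k, s k ^ 2 + ∑ k, c.1 k ^ 2 - ∑ k, 2 * (s k * c.1 k) := by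
    rw [← Finset.sum_add_distrib, ← Finset.sum_sub_distrib]
    exact Finset.sum_congr rfl fun k _ => by ring
  rw [this]; ring

theorem rot_energy (i j : Fin N) (h : i ≠ j) (α : ℝ) (s : Fin N → ℝ) (c : HCoords N) :
    ∑ k, (s k - (conjL (rotU i j α) c).1 k) ^ 2 + rho (conjL (rotU i j α) c) =
      (∑ k, (s k - c.1 k) ^ 2 + rho c) - 2 * (s i - s j) *
      ((Real.cos (2 * α) * ((c.1 i - c.1 j) / 2) - Real.sin (2 * α) * (hermOf c i j).re) - (c.1 i - c.1 j) / 2) := by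
  rw [energy_eq, energy_eq, Qh_conjL _ (rot_unit i j h α)]
  have key : ∑ k, s k * (conjL (rotU i j α) c).1 k - ∑ k, s k * c.1 k =
      s i * ((conjL (rotU i j α) c).1 i - c.1 i) + s j * ((conjL (rotU i j α) c).1 j - c.1 j) := by
    rw [← Finset.sum_sub_distrib, Finset.sum_eq_add_of_mem i j (Finset.mem_univ _) (Finset.mem_univ _) h]
    · ring
    · rintro k - ⟨h1, h2⟩
      rw [rot_diag_k i j h α c k h1 h2]; ring
  rw [rot_diag_i i j h, rot_diag_j i j h] at key
  rw [Real.cos_two_mul, Real.sin_two_mul]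
  have := Real.sin_sq_add_cos_sq α
  have h2 : Real.sin α ^ 2 = 1 - Real.cos α ^ 2 := by linarith
  rw [h2] at key
  linear_combination (-2) * key

theorem phase_unit (i : Fin N) : (Matrix.diagonal (Function.update (fun _ => (1:ℂ)) i Complex.I))ᴴ *
    Matrix.diagonal (Function.update (fun _ => (1:ℂ)) i Complex.I) = 1 := by
  rw [diagonal_conjTranspose, diagonal_mul_diagonal, ← diagonal_one]
  congr 1
  funext k
  by_cases hk : k = i
  · subst hk; simp
  · simp [hk]

theorem herm_rot (φ : HCoords N → ℝ) (hφ : Continuous φ)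
    (hφU : ∀ U : Matrix (Fin N) (Fin N) ℂ, Uᴴ * U = 1 → ∀ c, φ (conjL U c) = φ c)
    (hI : Integrable (fun c : HCoords N => |φ c| * (1 + (∑ i, c.1 i ^ 2 + rho c))))
    (t : ℝ) (ht : 0 < t) (s : Fin N → ℝ) (i j : Fin N) (hij : i ≠ j) :
    (s i - s j) * (∫ c, φ c * ‖hermOf c i j‖ ^ 2 * Real.exp (-(∑ k, (s k - c.1 k) ^ 2 + rho c) / (2 * t)))
     = t * ∫ c, φ c * (c.1 i - c.1 j) * Real.exp (-(∑ k, (s k - c.1 k) ^ 2 + rho c) / (2 * t)) := by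
  have hrc := rho_cont (N := N)
  have hec := entry_cont (N := N) i j
  have hre : Measurable fun c : HCoords N => (hermOf c i j).re := (Complex.continuous_re.comp hec).measurable
  have him : Measurable fun c : HCoords N => (hermOf c i j).im := (Complex.continuous_im.comp hec).measurable
  have hEm : Measurable fun c : HCoords N => ∑ k, (s k - c.1 k) ^ 2 + rho c :=
    (Continuous.add (by fun_prop) hrc).measurable
  have hnorm : ∀ c : HCoords N, ‖hermOf c i j‖ ^ 2 = (hermOf c i j).re ^ 2 + (hermOf c i j).im ^ 2 := fun c => by
    rw [← Complex.normSq_eq_norm_sq, Complex.normSq_apply]; ring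
  have hrho : ∀ c : HCoords N, ‖hermOf c i j‖ ^ 2 ≤ rho c := fun c => by
    unfold rho
    have h1 := Finset.single_le_sum (f := fun b => if i = b then 0 else ‖hermOf c i b‖ ^ 2)
      (fun b _ => by positivity) (Finset.mem_univ j)
    have h2 := Finset.single_le_sum (f := fun a => ∑ b, if a = b then 0 else ‖hermOf c a b‖ ^ 2)
      (fun a _ => Finset.sum_nonneg fun b _ => by positivity) (Finset.mem_univ i)
    simp only [hij, if_false] at h1
    exact h1.trans h2
  have hci : ∀ (c : HCoords N) k, c.1 k ^ 2 ≤ ∑ i, c.1 i ^ 2 := fun c k =>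
    Finset.single_le_sum (f := fun k => c.1 k ^ 2) (fun b _ => sq_nonneg _) (Finset.mem_univ k)
  have hre2 : ∀ c : HCoords N, (hermOf c i j).re ^ 2 ≤ rho c := fun c => by
    have := hrho c; rw [hnorm] at this; nlinarith [sq_nonneg (hermOf c i j).im]
  have him2 : ∀ c : HCoords N, (hermOf c i j).im ^ 2 ≤ rho c := fun c => by
    have := hrho c; rw [hnorm] at this; nlinarith [sq_nonneg (hermOf c i j).re]
  have key := rot_abs φ (fun c => ∑ k, (s k - c.1 k) ^ 2 + rho c) (fun c => (c.1 i - c.1 j) / 2)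
    (fun c => (hermOf c i j).re) (s i - s j) t ht hφ.measurable hEm (by fun_prop) hre
    (fun θ c => by
      have := rot_energy i j hij (θ / 2) s c
      rw [mul_div_cancel₀ θ two_ne_zero] at this
      rw [← this]
      exact add_nonneg (Finset.sum_nonneg fun k _ => sq_nonneg _) (rho_nonneg _))
    (by
      refine hI.mono' (by fun_prop) (Filter.Eventually.of_forall fun c => ?_)
      have h0 := sq_nonneg ((c.1 i - c.1 j) / 2)
      have h0' := sq_nonneg (hermOf c i j).re
      rw [Real.norm_eq_abs, abs_mul, abs_abs, abs_of_nonneg (by positivity : 0 ≤ 1 + (((c.1 i - c.1 j) / 2) ^ 2 + (hermOf c i j).re ^ 2))]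
      gcongr
      · nlinarith [sq_nonneg (c.1 i + c.1 j), hci c i, hci c j]
      · exact hre2 c)
    (fun θ => by
      rw [← integral_conjL (rotU i j (θ / 2)) (rot_unit i j hij _)
        (fun c => φ c * (hermOf c i j).re * Real.exp (-(∑ k, (s k - c.1 k) ^ 2 + rho c) / (2 * t)))]
      refine integral_congr_ae (Filter.Eventually.of_forall fun c => ?_)
      simp only
      rw [rot_energy i j hij, hφU _ (rot_unit i j hij _), rot_off i j hij, mul_div_cancel₀ θ two_ne_zero]
      have e1 : Real.sin θ = 2 * Real.sin (θ / 2) * Real.cos (θ / 2) := by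
        rw [← Real.sin_two_mul, mul_div_cancel₀ θ two_ne_zero]
      have e2 : Real.cos θ = Real.cos (θ / 2) ^ 2 - Real.sin (θ / 2) ^ 2 := by
        rw [← Real.cos_two_mul', mul_div_cancel₀ θ two_ne_zero]
      congr 2
      rw [e1, e2]; ring)
  have phase : ∫ c, φ c * (hermOf c i j).im ^ 2 * Real.exp (-(∑ k, (s k - c.1 k) ^ 2 + rho c) / (2 * t))
     = ∫ c, φ c * (hermOf c i j).re ^ 2 * Real.exp (-(∑ k, (s k - c.1 k) ^ 2 + rho c) / (2 * t)) := by
    rw [← integral_conjL _ (phase_unit i)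
        (fun c => φ c * (hermOf c i j).re ^ 2 * Real.exp (-(∑ k, (s k - c.1 k) ^ 2 + rho c) / (2 * t)))]
    refine integral_congr_ae (Filter.Eventually.of_forall fun c => ?_)
    simp only
    have hent : ∀ k l, hermOf (conjL (Matrix.diagonal (Function.update (fun _ => (1:ℂ)) i Complex.I)) c) k l
      = (Function.update (fun _ => (1:ℂ)) i Complex.I) k * hermOf c k l *
        star ((Function.update (fun _ => (1:ℂ)) i Complex.I) l) := fun k l => by
      rw [hermOf_conjL, diagonal_conjTranspose, mul_diagonal, diagonal_mul]; rfl
    have hd : (conjL (Matrix.diagonal (Function.update (fun _ => (1:ℂ)) i Complex.I)) c).1 = c.1 := by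
      funext k
      have h1 := hent k k
      rw [hermOf_diag, hermOf_diag] at h1
      have h2 : (Function.update (fun _ => (1:ℂ)) i Complex.I) k * star ((Function.update (fun _ => (1:ℂ)) i Complex.I) k) = 1 := by
        by_cases hk : k = i
        · subst hk; simp
        · simp [hk]
      have h3 : (((conjL (Matrix.diagonal (Function.update (fun _ => (1:ℂ)) i Complex.I)) c).1 k : ℝ) : ℂ) = (c.1 k : ℂ) := by
        rw [h1]; linear_combination (c.1 k : ℂ) * h2
      exact_mod_cast h3
    rw [energy_eq, energy_eq, Qh_conjL _ (phase_unit i), hφU _ (phase_unit i), hd, hent]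
    simp [hij.symm]
  have ii := fun (h : HCoords N → ℝ) (hh : Measurable h) C hC =>
    KD_int φ rho (fun c : HCoords N => c.1) hφ.measurable measurable_fst hrc.measurable rho_nonneg hI t ht s h hh C hC
  have pos : ∀ c : HCoords N, 0 ≤ ∑ i, c.1 i ^ 2 := fun c => Finset.sum_nonneg fun k _ => sq_nonneg _
  have i1 := ii (fun c => (hermOf c i j).re ^ 2) (by fun_prop) 1 (fun c => by
    rw [abs_of_nonneg (sq_nonneg _)]; linarith [pos c, hre2 c])
  have i2 := ii (fun c => (hermOf c i j).im ^ 2) (by fun_prop) 1 (fun c => by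
    rw [abs_of_nonneg (sq_nonneg _)]; linarith [pos c, him2 c])
  have i3 := ii (fun c => c.1 i - c.1 j) (by fun_prop) 2 (fun c => by
    have := hci c i; have := hci c j; have := rho_nonneg c; have := pos c
    rw [abs_le]; constructor <;> nlinarith [sq_nonneg (c.1 i - 1), sq_nonneg (c.1 j - 1), sq_nonneg (c.1 i + 1), sq_nonneg (c.1 j + 1)])
  have e1 : ∫ c, φ c * ‖hermOf c i j‖ ^ 2 * Real.exp (-(∑ k, (s k - c.1 k) ^ 2 + rho c) / (2 * t))
      = 2 * ∫ c, φ c * (hermOf c i j).re ^ 2 * Real.exp (-(∑ k, (s k - c.1 k) ^ 2 + rho c) / (2 * t)) := by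
    have e0 := integral_add i1 i2
    rw [phase, ← two_mul] at e0
    rw [← e0]
    refine integral_congr_ae (Filter.Eventually.of_forall fun c => ?_)
    simp only; rw [hnorm]; ring
  have e2 : ∫ c, φ c * ((c.1 i - c.1 j) / 2 - (s i - s j) * (hermOf c i j).re ^ 2 / t) *
        Real.exp (-(∑ k, (s k - c.1 k) ^ 2 + rho c) / (2 * t)) =
      (1/2) * (∫ c, φ c * (c.1 i - c.1 j) * Real.exp (-(∑ k, (s k - c.1 k) ^ 2 + rho c) / (2 * t)))
      - ((s i - s j) / t) * ∫ c, φ c * (hermOf c i j).re ^ 2 * Real.exp (-(∑ k, (s k - c.1 k) ^ 2 + rho c) / (2 * t)) := by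
    rw [← integral_const_mul, ← integral_const_mul, ← integral_sub (i3.const_mul _) (i1.const_mul _)]
    refine integral_congr_ae (Filter.Eventually.of_forall fun c => ?_)
    simp only; ring
  rw [e2] at key
  rw [e1]
  generalize (∫ c, φ c * (c.1 i - c.1 j) * Real.exp (-(∑ k, (s k - c.1 k) ^ 2 + rho c) / (2 * t))) = X1 at *
  generalize (∫ c, φ c * (hermOf c i j).re ^ 2 * Real.exp (-(∑ k, (s k - c.1 k) ^ 2 + rho c) / (2 * t))) = X2 at *
  have h9 : (s i - s j) / t * X2 = X1 / 2 := by linarith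
  rw [div_mul_eq_mul_div, div_eq_iff ht.ne'] at h9
  linear_combination 2 * h9
end Herm


def HeatAt {N : ℕ} (D : ℝ → (Fin N → ℝ) → ℝ) (t : ℝ) (s : Fin N → ℝ) : Prop :=
  ∃ (Dt : ℝ) (D1 : Fin N → ℝ → ℝ) (D2 : Fin N → ℝ), HasDerivAt (fun τ => D τ s) Dt t ∧
    (∀ i, ∀ᶠ r in nhds (s i), HasDerivAt (fun r => D t (Function.update s i r)) (D1 i r) r) ∧
    (∀ i, HasDerivAt (D1 i) (D2 i) (s i)) ∧ Dt = 1 / 2 * ∑ i, D2 i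

theorem HeatAt.lin {N : ℕ} {D E : ℝ → (Fin N → ℝ) → ℝ} {t : ℝ} {s : Fin N → ℝ} (a b : ℝ)
    (h1 : HeatAt D t s) (h2 : HeatAt E t s) : HeatAt (fun t s => a * D t s + b * E t s) t s := by
  obtain ⟨Dt, D1, D2, x1, x2, x3, x4⟩ := h1
  obtain ⟨Et, E1, E2, y1, y2, y3, y4⟩ := h2
  refine ⟨a * Dt + b * Et, fun i r => a * D1 i r + b * E1 i r, fun i => a * D2 i + b * E2 i,
    (x1.const_mul a).add (y1.const_mul b), fun i => ?_, fun i => ((x3 i).const_mul a).add ((y3 i).const_mul b), ?_⟩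
  · filter_upwards [x2 i, y2 i] with r h1 h2
    exact (h1.const_mul a).add (h2.const_mul b)
  · rw [x4, y4, Finset.sum_add_distrib, ← Finset.mul_sum, ← Finset.mul_sum]; ring

theorem sqrt_pow_deriv (n : ℕ) (t : ℝ) (ht : 0 < t) :
    HasDerivAt (fun τ => (Real.sqrt τ ^ n)⁻¹) (-(n / (2 * t)) * (Real.sqrt t ^ n)⁻¹) t := by
  have hs : 0 < Real.sqrt t := Real.sqrt_pos.2 ht
  have hd := Real.hasDerivAt_sqrt ht.ne'
  have h : HasDerivAt (fun τ => (Real.sqrt τ ^ n)⁻¹) _ t :=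
    HasDerivAt.fun_inv (HasDerivAt.fun_pow hd n) (pow_pos hs n).ne'
  refine h.congr_deriv ?_
  have h2 : Real.sqrt t ^ 2 = t := Real.sq_sqrt ht.le
  generalize Real.sqrt t = q at *
  subst h2
  rcases n with _ | n
  · simp
  · simp
    field_simp
    ring

section HR
variable {N : ℕ}

/-- heat equation for the scalar kernel on `ℝ^N` -/
theorem heat_flat (G : (Fin N → ℝ) → ℝ) (hG : Measurable G)
    (hI : Integrable (fun x : Fin N → ℝ => |G x| * (1 + (∑ i, x i ^ 2 + 0)))) (t : ℝ) (ht : 0 < t) (s : Fin N → ℝ) :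
    HeatAt (fun t s => (Real.sqrt t ^ N)⁻¹ * ∫ x, G x * Real.exp (-(∑ j, (s j - x j) ^ 2 + 0) / (2 * t))) t s := by
  have hk := sqrt_pow_deriv N t ht
  have h3 := KD3 G (fun _ => (0:ℝ)) (fun x => x) hG measurable_id measurable_const (fun _ => le_rfl) hI t ht s
  have h1 := KD1 G (fun _ => (0:ℝ)) (fun x => x) hG measurable_id measurable_const (fun _ => le_rfl) hI t ht s
  have h2 := KD2 G (fun _ => (0:ℝ)) (fun x => x) hG measurable_id measurable_const (fun _ => le_rfl) hI t ht s
  have hl := KD_lap G (fun _ => (0:ℝ)) (fun x => x) hG measurable_id measurable_const (fun _ => le_rfl) hI t ht s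
  refine ⟨_, _, _, hk.mul h3, fun i => Filter.Eventually.of_forall fun r => (h1 i r).const_mul _,
    fun i => (h2 i (s i)).const_mul _, ?_⟩
  rw [hl]
  simp only [Function.update_eq_self]
  rw [← Finset.mul_sum]
  simp only [mul_zero, zero_mul, integral_zero]
  ring

theorem herm_sum (φ : HCoords N → ℝ) (hφ : Continuous φ)
    (hφU : ∀ U : Matrix (Fin N) (Fin N) ℂ, Uᴴ * U = 1 → ∀ c, φ (conjL U c) = φ c)
    (hI : Integrable (fun c : HCoords N => |φ c| * (1 + (∑ i, c.1 i ^ 2 + rho c))))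
    (t : ℝ) (ht : 0 < t) (s : Fin N → ℝ) (hs : Function.Injective s) :
    ∑ i, hh s i * (∫ c, φ c * ((c.1 i - s i) / t) * Real.exp (-(∑ k, (s k - c.1 k) ^ 2 + rho c) / (2 * t)))
     = (1 / (2 * t ^ 2)) * (∫ c, φ c * rho c * Real.exp (-(∑ k, (s k - c.1 k) ^ 2 + rho c) / (2 * t)))
      - ((N * N - N) / (2 * t)) * ∫ c, φ c * Real.exp (-(∑ k, (s k - c.1 k) ^ 2 + rho c) / (2 * t)) := by
  have hrc := rho_cont (N := N)
  have pos : ∀ c : HCoords N, 0 ≤ ∑ i, c.1 i ^ 2 := fun c => Finset.sum_nonneg fun k _ => sq_nonneg _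
  have hci : ∀ (c : HCoords N) k, c.1 k ^ 2 ≤ ∑ i, c.1 i ^ 2 := fun c k =>
    Finset.single_le_sum (f := fun k => c.1 k ^ 2) (fun b _ => sq_nonneg _) (Finset.mem_univ k)
  have ii := fun (h : HCoords N → ℝ) (hh : Measurable h) C hC =>
    KD_int φ rho (fun c : HCoords N => c.1) hφ.measurable measurable_fst hrc.measurable rho_nonneg hI t ht s h hh C hC
  have i0 := ii (fun c => 1) (by fun_prop) 1 (fun c => by
    have := rho_nonneg c; have := pos c
    simp; linarith)
  have ic := fun i => ii (fun c => c.1 i) (by fun_prop) 1 (fun c => by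
    have := hci c i; have := rho_nonneg c; have := pos c
    rw [abs_le]; constructor <;> nlinarith [sq_nonneg (c.1 i - 1), sq_nonneg (c.1 i + 1)])
  have hrho : ∀ (i j : Fin N), i ≠ j → ∀ c : HCoords N, ‖hermOf c i j‖ ^ 2 ≤ rho c := fun i j hij c => by
    unfold rho
    have h1 := Finset.single_le_sum (f := fun b => if i = b then 0 else ‖hermOf c i b‖ ^ 2)
      (fun b _ => by positivity) (Finset.mem_univ j)
    have h2 := Finset.single_le_sum (f := fun a => ∑ b, if a = b then 0 else ‖hermOf c a b‖ ^ 2)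
      (fun a _ => Finset.sum_nonneg fun b _ => by positivity) (Finset.mem_univ i)
    simp only [hij, if_false] at h1
    exact h1.trans h2
  have ix : ∀ i j, Integrable (fun c : HCoords N => φ c * (if i = j then 0 else ‖hermOf c i j‖ ^ 2) *
      Real.exp (-(∑ k, (s k - c.1 k) ^ 2 + rho c) / (2 * t))) := fun i j => by
    refine ii (fun c => if i = j then 0 else ‖hermOf c i j‖ ^ 2) ?_ 1 (fun c => ?_)
    · have := (entry_cont (N := N) i j).norm.measurable
      split_ifs
      · exact measurable_const
      · exact this.pow_const 2
    · have := rho_nonneg c; have := pos c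
      split_ifs with h
      · simp; linarith
      · rw [abs_of_nonneg (sq_nonneg _)]
        linarith [hrho i j h c]
  simp only [mul_one] at i0
  have rot := herm_rot φ hφ hφU hI t ht s
  set K : HCoords N → ℝ := fun c => Real.exp (-(∑ k, (s k - c.1 k) ^ 2 + rho c) / (2 * t)) with hK
  set I0 := ∫ c, φ c * K c with hI0
  set J : Fin N → ℝ := fun i => ∫ c, φ c * c.1 i * K c with hJ
  set X : Fin N → Fin N → ℝ := fun i j => ∫ c, φ c * (if i = j then 0 else ‖hermOf c i j‖ ^ 2) * K c with hX
  have e1 : ∀ i, ∫ c, φ c * ((c.1 i - s i) / t) * K c = (J i - s i * I0) / t := fun i => by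
    rw [hJ, hI0, ← integral_const_mul, ← integral_sub (ic i) (i0.const_mul _), ← integral_div]
    refine integral_congr_ae (Filter.Eventually.of_forall fun c => ?_)
    simp only; ring
  have e2 : ∫ c, φ c * rho c * K c = ∑ i, ∑ j, X i j := by
    simp only [hX]
    rw [Finset.sum_congr rfl fun i _ => (integral_finsetSum _ fun j _ => ix i j).symm,
      ← integral_finsetSum _ fun i _ => integrable_finsetSum _ fun j _ => ix i j]
    refine integral_congr_ae (Filter.Eventually.of_forall fun c => ?_)
    simp only [rho]
    rw [Finset.mul_sum, Finset.sum_mul]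
    refine Finset.sum_congr rfl fun i _ => ?_
    rw [Finset.mul_sum, Finset.sum_mul]
    rfl
  have e3 : ∀ i j, i ≠ j → (s i - s j) * X i j = t * (J i - J j) := fun i j hij => by
    have h1 := rot i j hij
    have h2 : ∫ c, φ c * (c.1 i - c.1 j) * K c = J i - J j := by
      rw [hJ]; simp only
      rw [← integral_sub (ic i) (ic j)]
      refine integral_congr_ae (Filter.Eventually.of_forall fun c => ?_)
      simp only; ring
    change (s i - s j) * _ = t * ∫ c, φ c * (c.1 i - c.1 j) * K c at h1
    rw [h2] at h1
    rw [← h1]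
    simp only [hX, hij, if_false]
    rfl
  change ∑ i, hh s i * (∫ c, φ c * ((c.1 i - s i) / t) * K c) = (1 / (2 * t ^ 2)) * (∫ c, φ c * rho c * K c) - _ * I0
  simp only [e1, e2, hh]
  have e4 : ∀ i j, (s i - s j)⁻¹ * ((J i - s i * I0) / t) + (s j - s i)⁻¹ * ((J j - s j * I0) / t)
      = X i j / t ^ 2 - (1 - if i = j then 1 else 0) * I0 / t := fun i j => by
    by_cases hij : i = j
    · subst hij; simp [hX]
    · have hne : s i - s j ≠ 0 := sub_ne_zero.2 fun h => hij (hs h)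
      have := e3 i j hij
      rw [if_neg hij, show s j - s i = -(s i - s j) by ring, inv_neg]
      have h5 : J i - J j = (s i - s j) * X i j / t := by rw [this]; field_simp
      have : J i = J j + (s i - s j) * X i j / t := by linarith
      rw [this]
      field_simp
      ring
  have e5 : ∑ i, (∑ j, (s i - s j)⁻¹) * ((J i - s i * I0) / t) =
      ∑ i, ∑ j, (s i - s j)⁻¹ * ((J i - s i * I0) / t) := by
    simp_rw [Finset.sum_mul]
  have e6 : ∑ i, ∑ j, (s i - s j)⁻¹ * ((J i - s i * I0) / t) =
      ∑ i, ∑ j, (s j - s i)⁻¹ * ((J j - s j * I0) / t) := Finset.sum_comm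
  have e7 : ∑ i, ∑ j, (s i - s j)⁻¹ * ((J i - s i * I0) / t) +
      ∑ i, ∑ j, (s j - s i)⁻¹ * ((J j - s j * I0) / t) =
      (∑ i, ∑ j, X i j) / t ^ 2 - (N * N - N) * I0 / t := by
    simp_rw [← Finset.sum_add_distrib, e4, Finset.sum_sub_distrib, ← Finset.sum_div, ← Finset.sum_mul, Finset.sum_sub_distrib]
    simp
  rw [e5]
  rw [← e6] at e7
  have : ∑ i, ∑ j, (s i - s j)⁻¹ * ((J i - s i * I0) / t) =
    (1/2) * ((∑ i, ∑ j, X i j) / t ^ 2 - (N * N - N) * I0 / t) := by linarith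
  rw [this]
  field_simp

theorem heat_herm (φ : HCoords N → ℝ) (hφ : Continuous φ)
    (hφU : ∀ U : Matrix (Fin N) (Fin N) ℂ, Uᴴ * U = 1 → ∀ c, φ (conjL U c) = φ c)
    (hI : Integrable (fun c : HCoords N => |φ c| * (1 + (∑ i, c.1 i ^ 2 + rho c))))
    (t : ℝ) (ht : 0 < t) (s : Fin N → ℝ) (hs : Function.Injective s) :
    HeatAt (fun t s => vd s * ((Real.sqrt t ^ (N * N))⁻¹ *
      ∫ c, φ c * Real.exp (-(∑ k, (s k - c.1 k) ^ 2 + rho c) / (2 * t)))) t s := by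
  have hrm := (rho_cont (N := N)).measurable
  have hk := sqrt_pow_deriv (N * N) t ht
  have h3 := KD3 φ rho (fun c => c.1) hφ.measurable measurable_fst hrm rho_nonneg hI t ht s
  have h1 := KD1 φ rho (fun c => c.1) hφ.measurable measurable_fst hrm rho_nonneg hI t ht s
  have h2 := KD2 φ rho (fun c => c.1) hφ.measurable measurable_fst hrm rho_nonneg hI t ht s
  have hl := KD_lap φ rho (fun c => c.1) hφ.measurable measurable_fst hrm rho_nonneg hI t ht s
  have hsum := herm_sum φ hφ hφU hI t ht s hs
  have hinj : ∀ i, ∀ᶠ r in nhds (s i), Function.Injective (Function.update s i r) := fun i => by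
    have hc : Continuous fun r => vd (Function.update s i r) := vd_cont.comp (continuous_const.update i continuous_id)
    have h0 : vd (Function.update s i (s i)) ≠ 0 := by
      rw [Function.update_eq_self]; exact vd_ne.2 hs
    filter_upwards [hc.continuousAt.eventually_ne h0] with r hr
    exact vd_ne.1 hr
  have hss : ∀ i, Function.Injective (Function.update s i (s i)) := fun i => by
    rw [Function.update_eq_self]; exact hs
  refine ⟨_, fun i r => (vd (Function.update s i r) * hh (Function.update s i r) i) *
      ((Real.sqrt t ^ (N * N))⁻¹ * ∫ c, φ c * Real.exp (-(∑ k, (Function.update s i r k - c.1 k) ^ 2 + rho c) / (2 * t)))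
      + vd (Function.update s i r) * ((Real.sqrt t ^ (N * N))⁻¹ * ∫ c, φ c * ((c.1 i - r) / t) *
        Real.exp (-(∑ k, (Function.update s i r k - c.1 k) ^ 2 + rho c) / (2 * t))), ?D2,
    (hk.mul h3).const_mul (vd s), fun i => ?_, fun i => ?_, ?_⟩
  case D2 =>
   exact fun i =>
     (vd s * hh s i * hh s i + vd s * -∑ j, ((s i - s j)⁻¹) ^ 2) * ((Real.sqrt t ^ (N * N))⁻¹ * ∫ c : HCoords N, φ c * Real.exp (-(∑ k, (s k - c.1 k) ^ 2 + rho c) / (2 * t))) +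
     vd s * hh s i * ((Real.sqrt t ^ (N * N))⁻¹ * ∫ c : HCoords N, φ c * ((c.1 i - s i) / t) * Real.exp (-(∑ k, (s k - c.1 k) ^ 2 + rho c) / (2 * t))) +
     (vd s * hh s i * ((Real.sqrt t ^ (N * N))⁻¹ * ∫ c : HCoords N, φ c * ((c.1 i - s i) / t) * Real.exp (-(∑ k, (s k - c.1 k) ^ 2 + rho c) / (2 * t))) +
      vd s * ((Real.sqrt t ^ (N * N))⁻¹ * ∫ c : HCoords N, φ c * ((c.1 i - s i) ^ 2 / t ^ 2 - 1 / t) * Real.exp (-(∑ k, (s k - c.1 k) ^ 2 + rho c) / (2 * t))))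
  · filter_upwards [hinj i] with r hr
    exact (vd_deriv s i r hr).mul ((h1 i r).const_mul _)
  · have := (((vd_deriv s i (s i) (hss i)).mul (hh_deriv s i hs)).mul ((h1 i (s i)).const_mul (Real.sqrt t ^ (N * N))⁻¹)).add
      ((vd_deriv s i (s i) (hss i)).mul ((h2 i (s i)).const_mul (Real.sqrt t ^ (N * N))⁻¹))
    refine this.congr_deriv ?_
    simp only [Function.update_eq_self, Pi.mul_apply]
  rw [hl]
  generalize (Real.sqrt t ^ (N * N))⁻¹ = k at *
  generalize (∫ c : HCoords N, φ c * Real.exp (-(∑ k, (s k - c.1 k) ^ 2 + rho c) / (2 * t))) = I0 at *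
  generalize (∫ c : HCoords N, φ c * rho c * Real.exp (-(∑ k, (s k - c.1 k) ^ 2 + rho c) / (2 * t))) = R0 at *
  have hid := hh_identity s hs
  have : ∀ i, (vd s * hh s i * hh s i + vd s * -∑ j, ((s i - s j)⁻¹) ^ 2) * (k * I0) +
     vd s * hh s i * (k * ∫ c : HCoords N, φ c * ((c.1 i - s i) / t) * Real.exp (-(∑ k, (s k - c.1 k) ^ 2 + rho c) / (2 * t))) +
     (vd s * hh s i * (k * ∫ c : HCoords N, φ c * ((c.1 i - s i) / t) * Real.exp (-(∑ k, (s k - c.1 k) ^ 2 + rho c) / (2 * t))) +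
      vd s * (k * ∫ c : HCoords N, φ c * ((c.1 i - s i) ^ 2 / t ^ 2 - 1 / t) * Real.exp (-(∑ k, (s k - c.1 k) ^ 2 + rho c) / (2 * t))))
     = vd s * k * I0 * (hh s i ^ 2 - ∑ j, ((s i - s j)⁻¹) ^ 2)
     + 2 * vd s * k * (hh s i * ∫ c : HCoords N, φ c * ((c.1 i - s i) / t) * Real.exp (-(∑ k, (s k - c.1 k) ^ 2 + rho c) / (2 * t)))
     + vd s * k * (∫ c : HCoords N, φ c * ((c.1 i - s i) ^ 2 / t ^ 2 - 1 / t) * Real.exp (-(∑ k, (s k - c.1 k) ^ 2 + rho c) / (2 * t))) := fun i => by ring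
  rw [Finset.sum_congr rfl fun i _ => this i]
  rw [Finset.sum_add_distrib, Finset.sum_add_distrib, ← Finset.mul_sum, ← Finset.mul_sum, ← Finset.mul_sum, hid, hsum]
  push_cast
  field_simp
  ring
end HR


section P7
variable {N : ℕ}

theorem quad_bound (A n b M q : ℝ) (hA : 0 < A) (hn : 0 < n) :
    -A * (q ^ 2 / n) + b * q ≤ n * (b + M) ^ 2 / (4 * A) - M * q := by
  have : n * (b + M) ^ 2 / (4 * A) - M * q - (-A * (q ^ 2 / n) + b * q)
      = (A * q - n * (b + M) / 2) ^ 2 / (A * n) := by field_simp; ring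
  have h2 : 0 ≤ (A * q - n * (b + M) / 2) ^ 2 / (A * n) := by positivity
  linarith

noncomputable def phiH (A b : ℝ) (c : HCoords N) : ℝ := Real.exp (-A * tr4 c + b * Qh c)

theorem phiH_le (hN : 0 < N) (A b M : ℝ) (hA : 0 < A) (c : HCoords N) :
    phiH A b c ≤ Real.exp (N * (b + M) ^ 2 / (4 * A)) * Real.exp (-M * Qh c) := by
  unfold phiH
  rw [← Real.exp_add]
  apply Real.exp_le_exp.2
  have hn : (0:ℝ) < N := by exact_mod_cast hN
  have h1 := quad_bound A N b M (Qh c) hA hn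
  have h2 : Qh c ^ 2 / N ≤ tr4 c := by
    rw [div_le_iff₀ hn]; linarith [tr4_ge c]
  nlinarith

theorem phiH_cont (A b : ℝ) : Continuous (phiH A b : HCoords N → ℝ) := by
  have h1 := Qh_cont (N := N)
  have h2 := tr4_cont (N := N)
  unfold phiH
  fun_prop

theorem exp_mul_one_add (q : ℝ) (hq : 0 ≤ q) : Real.exp (-2 * q) * (1 + q) ≤ Real.exp (-1 * q) := by
  have h1 := Real.add_one_le_exp q
  calc _ ≤ Real.exp (-2 * q) * Real.exp q := by gcongr; linarith
    _ = _ := by rw [← Real.exp_add]; congr 1; ring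

theorem phiH_hI (hN : 0 < N) (A b : ℝ) (hA : 0 < A) :
    Integrable (fun c : HCoords N => |phiH A b c| * (1 + (∑ i, c.1 i ^ 2 + rho c))) := by
  have h1 := phiH_cont (N := N) A b
  have h2 := rho_cont (N := N)
  refine ((int_exp_Q (N := N) 1 one_pos).const_mul (Real.exp (N * (b + 2) ^ 2 / (4 * A)))).mono'
    (by apply Continuous.aestronglyMeasurable; fun_prop) (Filter.Eventually.of_forall fun c => ?_)
  have hq := Qh_nonneg c
  change ‖|phiH A b c| * (1 + Qh c)‖ ≤ _
  have hp : 0 < phiH A b c := Real.exp_pos _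
  rw [abs_of_pos hp, Real.norm_eq_abs, abs_of_nonneg (by positivity)]
  calc _ ≤ Real.exp (N * (b + 2) ^ 2 / (4 * A)) * Real.exp (-2 * Qh c) * (1 + Qh c) := by
        gcongr; exact phiH_le hN A b 2 hA c
    _ = Real.exp (N * (b + 2) ^ 2 / (4 * A)) * (Real.exp (-2 * Qh c) * (1 + Qh c)) := by ring
    _ ≤ _ := by gcongr; exact exp_mul_one_add _ hq

theorem vd_le_prod (s : Fin N → ℝ) (B : ℝ) (h : ∀ i j, i < j → |s j - s i| ≤ B) :
    |vd s| ≤ B ^ (∑ i : Fin N, (Finset.Ioi i).card) := by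
  unfold vd
  rw [det_vandermonde, Finset.abs_prod, ← Finset.prod_pow_eq_pow_sum]
  refine Finset.prod_le_prod (fun i _ => abs_nonneg _) fun i _ => ?_
  rw [Finset.abs_prod, ← Finset.prod_const]
  exact Finset.prod_le_prod (fun j _ => abs_nonneg _) fun j hj => h i j (Finset.mem_Ioi.1 hj)

theorem vd_le_exp : ∃ m : ℕ, ∀ x : Fin N → ℝ, |vd x| ≤ Real.exp (m * ∑ i, x i ^ 2) := by
  refine ⟨∑ i : Fin N, (Finset.Ioi i).card, fun x => ?_⟩
  rw [Real.exp_nat_mul]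
  refine vd_le_prod x _ fun i j _ => ?_
  have h1 := Real.add_one_le_exp (∑ i, x i ^ 2)
  have hci : ∀ k, x k ^ 2 ≤ ∑ i, x i ^ 2 := fun k =>
    Finset.single_le_sum (f := fun k => x k ^ 2) (fun b _ => sq_nonneg _) (Finset.mem_univ k)
  have := hci i; have := hci j
  rw [abs_le]
  constructor <;> nlinarith [sq_nonneg (x i - 1), sq_nonneg (x j - 1), sq_nonneg (x i + 1), sq_nonneg (x j + 1)]

theorem vd_le_norm : ∃ m : ℕ, ∀ x : Fin N → ℝ, |vd x| ≤ (2 * ‖x‖) ^ m := by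
  refine ⟨∑ i : Fin N, (Finset.Ioi i).card, fun x => vd_le_prod x _ fun i j _ => ?_⟩
  have h1 := norm_le_pi_norm x i
  have h2 := norm_le_pi_norm x j
  rw [Real.norm_eq_abs] at h1 h2
  calc _ ≤ |x j| + |x i| := abs_sub _ _
    _ ≤ _ := by linarith

noncomputable def phiR (A b : ℝ) (x : Fin N → ℝ) : ℝ := Real.exp (-A * ∑ i, x i ^ 4 + b * ∑ i, x i ^ 2)

noncomputable def GR (A b : ℝ) (x : Fin N → ℝ) : ℝ := phiR A b x * vd x

theorem GR_cont (A b : ℝ) : Continuous (GR A b : (Fin N → ℝ) → ℝ) := by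
  have := vd_cont (N := N)
  unfold GR phiR
  fun_prop

theorem phiR_le (hN : 0 < N) (A b M : ℝ) (hA : 0 < A) (x : Fin N → ℝ) :
    phiR A b x ≤ Real.exp (N * (b + M) ^ 2 / (4 * A)) * Real.exp (-M * ∑ i, x i ^ 2) := by
  unfold phiR
  rw [← Real.exp_add]
  apply Real.exp_le_exp.2
  have hn : (0:ℝ) < N := by exact_mod_cast hN
  have h1 := quad_bound A N b M (∑ i, x i ^ 2) hA hn
  have h2 : (∑ i, x i ^ 2) ^ 2 / N ≤ ∑ i, x i ^ 4 := by
    rw [div_le_iff₀ hn]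
    have := sq_sum_le_card_mul_sum_sq (s := Finset.univ) (f := fun i => x i ^ 2)
    simp only [← pow_mul, Finset.card_univ, Fintype.card_fin] at this
    linarith
  nlinarith

theorem GR_le (hN : 0 < N) (A b M : ℝ) (hA : 0 < A) :
    ∃ C, 0 ≤ C ∧ ∀ x : Fin N → ℝ, |GR A b x| ≤ C * Real.exp (-M * ∑ i, x i ^ 2) := by
  obtain ⟨m, hm⟩ := vd_le_exp (N := N)
  refine ⟨Real.exp (N * (b + (M + m)) ^ 2 / (4 * A)), (Real.exp_pos _).le, fun x => ?_⟩
  unfold GR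
  have hp : 0 < phiR A b x := Real.exp_pos _
  rw [abs_mul, abs_of_pos hp]
  calc _ ≤ (Real.exp (N * (b + (M + m)) ^ 2 / (4 * A)) * Real.exp (-(M + m) * ∑ i, x i ^ 2)) * Real.exp (m * ∑ i, x i ^ 2) := by
        gcongr
        · exact phiR_le hN A b _ hA x
        · exact hm x
    _ = _ := by
      rw [mul_assoc, ← Real.exp_add]; congr 2; ring

theorem int_exp_R (a : ℝ) (ha : 0 < a) : Integrable (fun x : Fin N → ℝ => Real.exp (-a * ∑ i, x i ^ 2)) := by
  have h1 : Integrable (fun x : Fin N → ℝ => ∏ i, Real.exp (-a * x i ^ 2)) :=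
    Integrable.fintype_prod (f := fun _ (x : ℝ) => Real.exp (-a * x ^ 2)) fun i => integrable_exp_neg_mul_sq ha
  simpa only [← Real.exp_sum, ← Finset.mul_sum] using h1

theorem GR_hI (hN : 0 < N) (A b : ℝ) (hA : 0 < A) :
    Integrable (fun x : Fin N → ℝ => |GR A b x| * (1 + (∑ i, x i ^ 2 + 0))) := by
  have h1 := GR_cont (N := N) A b
  obtain ⟨C, hC0, hC⟩ := GR_le hN A b 2 hA
  refine ((int_exp_R (N := N) 1 one_pos).const_mul C).mono'
    (by apply Continuous.aestronglyMeasurable; fun_prop) (Filter.Eventually.of_forall fun x => ?_)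
  have hq : 0 ≤ ∑ i, x i ^ 2 := Finset.sum_nonneg fun i _ => sq_nonneg _
  rw [add_zero, Real.norm_eq_abs, abs_mul, abs_abs, abs_of_nonneg (by positivity : 0 ≤ 1 + ∑ i, x i ^ 2)]
  calc _ ≤ C * Real.exp (-2 * ∑ i, x i ^ 2) * (1 + ∑ i, x i ^ 2) := by
        gcongr; exact hC x
    _ = C * (Real.exp (-2 * ∑ i, x i ^ 2) * (1 + ∑ i, x i ^ 2)) := by ring
    _ ≤ _ := by gcongr; exact exp_mul_one_add _ hq

theorem vd_perm (σ : Equiv.Perm (Fin N)) (x : Fin N → ℝ) : vd (x ∘ σ) = ((Equiv.Perm.sign σ : ℤ) : ℝ) * vd x := by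
  unfold vd
  rw [← Matrix.det_permute]
  rfl

theorem integral_perm (σ : Equiv.Perm (Fin N)) (f : (Fin N → ℝ) → ℝ) : ∫ x, f (x ∘ σ) = ∫ x, f x := by
  have h := (volume_measurePreserving_piCongrLeft (fun _ : Fin N => ℝ) σ.symm)
  rw [← h.integral_comp (MeasurableEquiv.measurableEmbedding _) f]
  refine integral_congr_ae (Filter.Eventually.of_forall fun x => ?_)
  simp only
  congr 1
  funext i
  have := MeasurableEquiv.piCongrLeft_apply_apply σ.symm (β := fun _ => ℝ) x (σ i)
  rw [Equiv.symm_apply_apply] at this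
  rw [this]; rfl

theorem hermOf_iota (s : Fin N → ℝ) : hermOf ((s, 0) : HCoords N) = diagonal fun i => (s i : ℂ) := by
  ext i j
  unfold hermOf
  simp only [of_apply, diagonal_apply]
  by_cases h : i = j
  · subst h; simp
  · rcases lt_or_gt_of_ne h with h1 | h1
    · simp [h1, h]
    · simp [h1, h, h1.le]

theorem rho_sub_iota (s : Fin N → ℝ) (c : HCoords N) : rho (c - (s, 0)) = rho c := by
  unfold rho
  have : c = (c - (s, 0)) + (s, 0) := by simp
  refine Finset.sum_congr rfl fun i _ => Finset.sum_congr rfl fun j _ => ?_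
  by_cases h : i = j
  · simp [h]
  · rw [if_neg h, if_neg h]
    nth_rewrite 2 [this]
    rw [hermOf_add, hermOf_iota, Matrix.add_apply, diagonal_apply_ne _ h, add_zero]

theorem Qh_sub_iota (s : Fin N → ℝ) (c : HCoords N) :
    Qh (c - (s, 0)) = ∑ k, (s k - c.1 k) ^ 2 + rho c := by
  unfold Qh
  rw [rho_sub_iota]
  congr 1
  refine Finset.sum_congr rfl fun i _ => ?_
  simp; ring

theorem phiH_iota (A b : ℝ) (s : Fin N → ℝ) : phiH A b ((s, 0) : HCoords N) = phiR A b s := by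
  unfold phiH phiR
  have h1 : tr4 ((s, 0) : HCoords N) = ∑ i, s i ^ 4 := by
    unfold tr4
    rw [hermOf_iota, diagonal_pow, trace_diagonal]
    simp [← Complex.ofReal_pow]
  have h2 : Qh ((s, 0) : HCoords N) = ∑ i, s i ^ 2 := by
    have := rho_sub_iota s ((s, 0) : HCoords N)
    rw [sub_self] at this
    unfold Qh
    rw [← this]
    have : rho (0 : HCoords N) = 0 := by
      unfold rho; simp [show (hermOf (0 : HCoords N)) = 0 from by
        have := hermOf_smul (0:ℝ) (0 : HCoords N); simpa using this]
    rw [this, add_zero]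
  rw [h1, h2]

theorem growth (hN : 0 < N) (m : ℕ) (B B' : ℝ) (hB : 0 ≤ B) (ε : ℝ) (hε : 0 < ε) :
    ∃ R : ℝ, ∀ s : Fin N → ℝ, R < ‖s‖ → (2 * ‖s‖) ^ m * B + B' ≤ ε * (1 + ∑ i, Real.cosh (s i)) := by
  have h1 := (Real.tendsto_pow_mul_exp_neg_atTop_nhds_zero m).const_mul (2 ^ m * B)
  have h2 := (Real.tendsto_pow_mul_exp_neg_atTop_nhds_zero 0).const_mul B'
  have h3 := h1.add h2
  simp only [mul_zero, add_zero] at h3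
  have h4 := h3.eventually (gt_mem_nhds (show (0:ℝ) < ε / 2 by positivity))
  obtain ⟨R, hR⟩ := Filter.eventually_atTop.1 h4
  refine ⟨R, fun s hs => ?_⟩
  have h5 := hR ‖s‖ hs.le
  have hne : Nonempty (Fin N) := ⟨⟨0, hN⟩⟩
  obtain ⟨i, hi⟩ : ∃ i, ‖s i‖ = ‖s‖ := by
    obtain ⟨i, -, hi⟩ := Finset.exists_mem_eq_sup (Finset.univ : Finset (Fin N)) Finset.univ_nonempty (fun i => ‖s i‖₊)
    refine ⟨i, ?_⟩
    rw [Pi.norm_def, hi]; rfl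
  have h6 : Real.cosh (s i) ≤ ∑ i, Real.cosh (s i) :=
    Finset.single_le_sum (f := fun i => Real.cosh (s i)) (fun j _ => (Real.cosh_pos _).le) (Finset.mem_univ i)
  have h7 : Real.exp ‖s‖ / 2 ≤ Real.cosh (s i) := by
    rw [← Real.cosh_abs, ← Real.norm_eq_abs, hi, Real.cosh_eq]
    have := Real.exp_pos (-‖s‖)
    linarith
  have h8 : (2 * ‖s‖) ^ m * B + B' = (2 ^ m * B * (‖s‖ ^ m * Real.exp (-‖s‖)) + B' * (‖s‖ ^ 0 * Real.exp (-‖s‖))) * Real.exp ‖s‖ := by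
    rw [Real.exp_neg]
    have := Real.exp_pos ‖s‖
    field_simp
    ring
  rw [h8]
  calc _ ≤ ε / 2 * Real.exp ‖s‖ := by gcongr
    _ ≤ ε * (1 + ∑ i, Real.cosh (s i)) := by nlinarith

theorem Tsm_GR_zero (A b : ℝ) (t : ℝ) (s : Fin N → ℝ) (hs : ¬ Function.Injective s) :
    Tsm (GR A b) (fun y : Fin N → ℝ => ∑ i, y i ^ 2) (fun s => s) t s = 0 := by
  obtain ⟨i, j, hij, hne⟩ : ∃ i j, s i = s j ∧ i ≠ j := by
    unfold Function.Injective at hs; push Not at hs; exact hs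
  have key := integral_perm (Equiv.swap i j) (fun y => GR A b (s + Real.sqrt t • y) * Real.exp (-(∑ i, y i ^ 2) / 2))
  have hsw : s ∘ Equiv.swap i j = s := by
    funext k
    simp only [Function.comp]
    by_cases h1 : k = i
    · subst h1; simp [hij]
    · by_cases h2 : k = j
      · subst h2; simp [hij]
      · rw [Equiv.swap_apply_of_ne_of_ne h1 h2]
  have hsum : ∀ (y : Fin N → ℝ) (k : ℕ), ∑ l, (y ∘ Equiv.swap i j) l ^ k = ∑ l, y l ^ k := fun y k =>
    Equiv.sum_comp (Equiv.swap i j) (fun l => y l ^ k)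
  have hG : ∀ y : Fin N → ℝ, GR A b (y ∘ Equiv.swap i j) = - GR A b y := fun y => by
    unfold GR phiR
    rw [vd_perm, hsum, hsum, Equiv.Perm.sign_swap hne]; simp
  have e : ∀ y : Fin N → ℝ, s + Real.sqrt t • (y ∘ Equiv.swap i j) = (s + Real.sqrt t • y) ∘ Equiv.swap i j := fun y => by
    conv_lhs => rw [← hsw]
    rfl
  simp only [e, hG, hsum, neg_mul, integral_neg] at key
  unfold Tsm
  linarith

theorem compare (hN : 0 < N) (A V : ℝ) (hA : 0 < A) (hV : 0 < V) :
    ∃ C : ℝ, ∀ s : Fin N → ℝ, vd s * ∫ c : HCoords N, Real.exp (-A * tr4 c + V * ∑ i, s i * c.1 i)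
      = C * ∫ x : Fin N → ℝ, Real.exp (-A * ∑ i, x i ^ 4 + V * ∑ i, s i * x i) * vd x := by
  have hHaar : (volume : Measure (HCoords N)).IsAddHaarMeasure := vol_haar
  set b := V / 2 with hb
  set ι : (Fin N → ℝ) → HCoords N := fun s => (s, 0) with hι
  set q : (Fin N → ℝ) → ℝ := fun y => ∑ i, y i ^ 2 with hq
  have hιc : Continuous ι := by fun_prop
  have hqc : Continuous q := by fun_prop
  have hQi : Integrable (fun c : HCoords N => Real.exp (-(Qh c) / 2)) := by
    have := int_exp_Q (N := N) (1/2) (by norm_num)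
    refine this.congr (Filter.Eventually.of_forall fun c => ?_)
    simp only; congr 1; ring
  have hqi : Integrable (fun c : Fin N → ℝ => Real.exp (-(q c) / 2)) := by
    have := int_exp_R (N := N) (1/2) (by norm_num)
    refine this.congr (Filter.Eventually.of_forall fun c => ?_)
    simp only [hq]; congr 1; ring
  have hφc := phiH_cont (N := N) A b
  have hGc := GR_cont (N := N) A b
  obtain ⟨C1, hC10, hC1⟩ := GR_le hN A b 0 hA
  simp only [neg_zero, zero_mul, Real.exp_zero, mul_one] at hC1
  have hφb : ∀ c : HCoords N, |phiH A b c| ≤ Real.exp (N * (b + 0) ^ 2 / (4 * A)) := fun c => by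
    have := phiH_le hN A b 0 hA c
    have hp : 0 < phiH A b c := Real.exp_pos _
    rw [abs_of_pos hp]
    simpa using this
  set W : ℝ → (Fin N → ℝ) → ℝ := fun t s => vd s * Tsm (phiH A b) Qh ι t s with hW
  set W' : ℝ → (Fin N → ℝ) → ℝ := fun t s => Tsm (GR A b) q (fun s => s) t s with hW'
  have hker : ∀ t, 0 < t → ∀ s, W t s = vd s * ((Real.sqrt t ^ (N * N))⁻¹ *
      ∫ c, phiH A b c * Real.exp (-(∑ k, (s k - c.1 k) ^ 2 + rho c) / (2 * t))) := fun t ht s => by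
    simp only [hW]
    rw [Tsm_ker (phiH A b) Qh ι Qh_smul t ht s, finrank_H]
    simp only [hι, Qh_sub_iota]
  have hker' : ∀ t, 0 < t → ∀ s, W' t s = (Real.sqrt t ^ N)⁻¹ *
      ∫ x, GR A b x * Real.exp (-(∑ j, (s j - x j) ^ 2 + 0) / (2 * t)) := fun t ht s => by
    simp only [hW']
    rw [Tsm_ker (GR A b) q (fun s => s) (fun r y => by simp [hq, mul_pow, Finset.mul_sum]) t ht s,
      Module.finrank_fin_fun]
    congr 1
    refine integral_congr_ae (Filter.Eventually.of_forall fun x => ?_)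
    simp only [hq, add_zero, Pi.sub_apply]
    have : ∑ i, (x i - s i) ^ 2 = ∑ j, (s j - x j) ^ 2 := Finset.sum_congr rfl fun j _ => by ring
    rw [this]
  have hloc : ∀ (F G : ℝ → (Fin N → ℝ) → ℝ), (∀ t, 0 < t → ∀ s, F t s = G t s) → ∀ t, 0 < t → ∀ s,
      HeatAt G t s → HeatAt F t s := by
    rintro F G h t ht s ⟨Dt, D1, D2, x1, x2, x3, x4⟩
    refine ⟨Dt, D1, D2, x1.congr_of_eventuallyEq ?_, fun i => ?_, x3, x4⟩
    · filter_upwards [lt_mem_nhds ht] with τ hτ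
      exact h τ hτ s
    · have : (fun r => F t (Function.update s i r)) = fun r => G t (Function.update s i r) :=
        funext fun r => h t ht _
      rw [this]; exact x2 i
  have heat1 : ∀ t, 0 < t → ∀ s, Function.Injective s → HeatAt W t s := fun t ht s hs =>
    hloc _ _ hker t ht s (heat_herm (phiH A b) hφc (fun U hU c => by
      unfold phiH; rw [tr4_conjL U hU, Qh_conjL U hU]) (phiH_hI hN A b hA) t ht s hs)
  have heat2 : ∀ t, 0 < t → ∀ s, HeatAt W' t s := fun t ht s =>
    hloc _ _ hker' t ht s (heat_flat (GR A b) hGc.measurable (GR_hI hN A b hA) t ht s)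
  set kH := ∫ c : HCoords N, Real.exp (-(Qh c) / 2) with hkH
  set kR := ∫ x : Fin N → ℝ, Real.exp (-(q x) / 2) with hkR
  have hkRpos : 0 < kR := integral_exp_pos hqi
  have hWc : Continuous fun p : ℝ × (Fin N → ℝ) => W p.1 p.2 :=
    (vd_cont.comp continuous_snd).mul (Tsm_cont (phiH A b) Qh ι _ hφc Qh_cont hιc hφb hQi)
  have hWc' : Continuous fun p : ℝ × (Fin N → ℝ) => W' p.1 p.2 :=
    Tsm_cont (GR A b) q (fun s => s) _ hGc hqc continuous_id hC1 hqi
  obtain ⟨m, hm⟩ := vd_le_norm (N := N)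
  have hpt0 : ∀ s, W 0 s = kH / kR * W' 0 s := fun s => by
    simp only [hW, hW', Tsm_zero, hι, phiH_iota]
    unfold GR
    rw [← hkH, ← hkR]; field_simp
  have hWb : ∀ t s, |W t s| ≤ (2 * ‖s‖) ^ m * (Real.exp (N * (b + 0) ^ 2 / (4 * A)) * kH) := fun t s => by
    simp only [hW]
    rw [abs_mul]
    exact mul_le_mul (hm s) (Tsm_bound _ Qh ι _ hφb hQi t s) (abs_nonneg _) (by positivity)
  have hWb' : ∀ t s, |W' t s| ≤ C1 * kR := fun t s => Tsm_bound _ q _ _ hC1 hqi t s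
  have hkHn : 0 ≤ kH := integral_nonneg fun c => (Real.exp_pos _).le
  have hmain : ∀ σ : ℝ, |σ| = 1 → ∀ t ∈ Set.Icc (0:ℝ) (1 / V), ∀ s,
      σ * W t s + (-σ * (kH / kR)) * W' t s ≤ 0 := by
    intro σ hσ
    refine heat_max (1 / V) (fun t s => σ * W t s + (-σ * (kH / kR)) * W' t s) ?_ ?_ ?_ ?_
    · exact (hWc.const_mul _).add (hWc'.const_mul _)
    · intro s; rw [hpt0]; apply le_of_eq; ring
    · intro ε hε
      obtain ⟨R, hR⟩ := growth hN m (Real.exp (N * (b + 0) ^ 2 / (4 * A)) * kH) (kH / kR * (C1 * kR)) (by positivity) ε hε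
      refine ⟨R, fun t _ s hs => le_trans ?_ (hR s hs)⟩
      have h1 : σ * W t s ≤ |W t s| := by
        calc σ * W t s ≤ |σ * W t s| := le_abs_self _
          _ = _ := by rw [abs_mul, hσ, one_mul]
      have h2 : (-σ * (kH / kR)) * W' t s ≤ kH / kR * |W' t s| := by
        calc _ ≤ |(-σ * (kH / kR)) * W' t s| := le_abs_self _
          _ = _ := by rw [abs_mul, abs_mul, abs_neg, hσ, one_mul, abs_of_nonneg (by positivity : 0 ≤ kH / kR)]
      have h3 : kH / kR * |W' t s| ≤ kH / kR * (C1 * kR) := by gcongr; exact hWb' t s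
      linarith [hWb t s]
    · intro t ht s hpos
      have hinj : Function.Injective s := by
        by_contra hs
        have h1 : W' t s = 0 := Tsm_GR_zero A b t s hs
        have h2 : vd s = 0 := by
          by_contra h; exact hs (vd_ne.1 h)
        have h3 : W t s = 0 := by simp only [hW, h2, zero_mul]
        simp only [h1, h3, mul_zero, add_zero, lt_self_iff_false] at hpos
      exact (heat1 t ht s hinj).lin σ (-σ * (kH / kR)) (heat2 t ht s)
  have hTpos : 0 < 1 / V := by positivity
  have hTm : (1 / V) ∈ Set.Icc (0:ℝ) (1 / V) := ⟨hTpos.le, le_rfl⟩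
  have hfin : ∀ s, W (1 / V) s = kH / kR * W' (1 / V) s := fun s => by
    have h1 := hmain 1 (by simp) _ hTm s
    have h2 := hmain (-1) (by simp) _ hTm s
    linarith
  refine ⟨(Real.sqrt (1 / V) ^ (N * N)) * (kH / kR * (Real.sqrt (1 / V) ^ N)⁻¹), fun s => ?_⟩
  have hf := hfin s
  rw [hker _ hTpos, hker' _ hTpos] at hf
  have e1 : ∫ c : HCoords N, phiH A b c * Real.exp (-(∑ k, (s k - c.1 k) ^ 2 + rho c) / (2 * (1 / V)))
      = Real.exp (-b * ∑ k, s k ^ 2) * ∫ c : HCoords N, Real.exp (-A * tr4 c + V * ∑ i, s i * c.1 i) := by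
    rw [← integral_const_mul]
    refine integral_congr_ae (Filter.Eventually.of_forall fun c => ?_)
    simp only [phiH]
    rw [energy_eq, ← Real.exp_add, ← Real.exp_add, hb]
    congr 1
    field_simp
    ring
  have e2 : ∫ x : Fin N → ℝ, GR A b x * Real.exp (-(∑ k, (s k - x k) ^ 2 + 0) / (2 * (1 / V)))
      = Real.exp (-b * ∑ k, s k ^ 2) * ∫ x : Fin N → ℝ, Real.exp (-A * ∑ i, x i ^ 4 + V * ∑ i, s i * x i) * vd x := by
    rw [← integral_const_mul]
    refine integral_congr_ae (Filter.Eventually.of_forall fun x => ?_)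
    simp only [GR, phiR]
    have : ∑ k, (s k - x k) ^ 2 = ∑ k, s k ^ 2 + ∑ k, x k ^ 2 - 2 * ∑ k, s k * x k := by
      rw [Finset.mul_sum, ← Finset.sum_add_distrib, ← Finset.sum_sub_distrib]
      exact Finset.sum_congr rfl fun k _ => by ring
    rw [this, mul_right_comm, ← Real.exp_add, ← mul_assoc, ← Real.exp_add, hb]
    congr 2
    field_simp
    ring
  rw [e1, e2] at hf
  have hep := Real.exp_pos (-b * ∑ k, s k ^ 2)
  have hsp : 0 < Real.sqrt (1 / V) ^ (N * N) := pow_pos (Real.sqrt_pos.2 hTpos) _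
  generalize (∫ c : HCoords N, Real.exp (-A * tr4 c + V * ∑ i, s i * c.1 i)) = X1 at *
  generalize (∫ x : Fin N → ℝ, Real.exp (-A * ∑ i, x i ^ 4 + V * ∑ i, s i * x i) * vd x) = X2 at *
  apply mul_left_cancel₀ hep.ne'
  calc _ = Real.sqrt (1 / V) ^ (N * N) * (vd s * ((Real.sqrt (1 / V) ^ (N * N))⁻¹ * (Real.exp (-b * ∑ k, s k ^ 2) * X1))) := by
        field_simp
    _ = _ := by rw [hf]; ring
end P7


section P8
variable {N : ℕ}

noncomputable def dens (A : ℝ) (x : ℝ) : ENNReal := ENNReal.ofReal (Real.exp (-A * x ^ 4))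

noncomputable def muq (A : ℝ) : Measure ℝ := (volume : Measure ℝ).withDensity (dens A)

theorem dens_meas (A : ℝ) : Measurable (dens A) := by
  unfold dens
  fun_prop

theorem dens_toReal (A x : ℝ) : (dens A x).toReal = Real.exp (-A * x ^ 4) := by
  unfold dens
  rw [ENNReal.toReal_ofReal (Real.exp_pos _).le]

theorem integral_muq (A : ℝ) (g : ℝ → ℝ) : ∫ x, g x ∂(muq A) = ∫ x, Real.exp (-A * x ^ 4) * g x := by
  unfold muq
  rw [integral_withDensity_eq_integral_toReal_smul (dens_meas A) (Filter.Eventually.of_forall fun x => by simp [dens])]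
  simp only [dens_toReal, smul_eq_mul]

theorem integrable_muq (A : ℝ) (g : ℝ → ℝ) :
    Integrable g (muq A) ↔ Integrable (fun x => Real.exp (-A * x ^ 4) * g x) := by
  unfold muq
  rw [integrable_withDensity_iff_integrable_smul' (dens_meas A) (Filter.Eventually.of_forall fun x => by simp [dens])]
  simp only [dens_toReal, smul_eq_mul]

theorem quartic_int (A b : ℝ) (hA : 0 < A) : Integrable (fun x : ℝ => Real.exp (-A * x ^ 4) * Real.exp (b * x)) := by
  have h := (integrable_exp_neg_mul_sq (b := 1) one_pos).const_mul (Real.exp (1 / A + b ^ 2 / 4))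
  refine h.mono' (by fun_prop) (Filter.Eventually.of_forall fun x => ?_)
  rw [Real.norm_of_nonneg (by positivity : 0 ≤ Real.exp (-A * x ^ 4) * Real.exp (b * x)), ← Real.exp_add, ← Real.exp_add]
  apply Real.exp_le_exp.2
  have h1 : 1 / A - 2 * x ^ 2 + A * x ^ 4 = (A * x ^ 2 - 1) ^ 2 / A := by field_simp; ring
  have h2 : 0 ≤ (A * x ^ 2 - 1) ^ 2 / A := by positivity
  nlinarith [sq_nonneg (x - b / 2)]

theorem expset_univ (A V : ℝ) (hA : 0 < A) :
    ProbabilityTheory.integrableExpSet (fun x : ℝ => V * x) (muq A) = Set.univ := by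
  ext t
  simp only [ProbabilityTheory.integrableExpSet, Set.mem_setOf_eq, Set.mem_univ, iff_true]
  rw [integrable_muq]
  simpa only [mul_assoc] using quartic_int A (t * V) hA

theorem Pint_mgf (V lam : ℝ) : Pint V lam = ProbabilityTheory.mgf (fun x : ℝ => V * x) (muq (lam * V / 4)) := by
  ext z
  unfold ProbabilityTheory.mgf Pint
  rw [integral_muq]
  congr 1
  ext x
  rw [← Real.exp_add]
  congr 1; ring

theorem Pint_mem (V lam z : ℝ) (hV : 0 < V) (hl : 0 < lam) :
    z ∈ interior (ProbabilityTheory.integrableExpSet (fun x : ℝ => V * x) (muq (lam * V / 4))) := by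
  rw [expset_univ _ _ (by positivity)]; simp

theorem Pint_iter (V lam : ℝ) (hV : 0 < V) (hl : 0 < lam) (k : ℕ) (z : ℝ) :
    iteratedDeriv k (Pint V lam) z
      = ∫ x, Real.exp (-(lam * V / 4) * x ^ 4) * ((V * x) ^ k * Real.exp (z * (V * x))) := by
  rw [Pint_mgf, ProbabilityTheory.iteratedDeriv_mgf (Pint_mem V lam z hV hl), integral_muq]

theorem Pint_int (V lam : ℝ) (hV : 0 < V) (hl : 0 < lam) (k : ℕ) (z : ℝ) :
    Integrable fun x => Real.exp (-(lam * V / 4) * x ^ 4) * ((V * x) ^ k * Real.exp (z * (V * x))) := by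
  have := ProbabilityTheory.integrable_pow_mul_exp_of_mem_interior_integrableExpSet (Pint_mem V lam z hV hl) k
  rwa [integrable_muq] at this

theorem Pint_smooth (V lam : ℝ) (hV : 0 < V) (hl : 0 < lam) (k : ℕ) :
    ContDiff ℝ (⊤ : ℕ∞) (iteratedDeriv k (Pint V lam)) := by
  have h := ProbabilityTheory.analyticOnNhd_iteratedDeriv_mgf (X := fun x : ℝ => V * x) (μ := muq (lam * V / 4)) k
  rw [← Pint_mgf] at h
  rw [contDiff_iff_contDiffAt]
  intro z
  exact (h z (Pint_mem V lam z hV hl)).contDiffAt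

theorem PNdet_smooth (V lam : ℝ) (hV : 0 < V) (hl : 0 < lam) :
    ContDiff ℝ (⊤ : ℕ∞) (PNdet N V lam) := by
  have : PNdet N V lam = fun s : Fin N → ℝ => ∑ σ : Equiv.Perm (Fin N), ((Equiv.Perm.sign σ : ℤ) : ℝ) *
      ∏ j, iteratedDeriv (σ j : ℕ) (Pint V lam) (s j) := by
    ext s; unfold PNdet; rw [Matrix.det_apply']; rfl
  rw [this]
  refine ContDiff.sum fun σ _ => contDiff_const.mul (contDiff_prod fun j _ => ?_)
  exact (Pint_smooth V lam hV hl _).comp (contDiff_apply ℝ ℝ j)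

theorem PNdet_eq (V lam : ℝ) (hV : 0 < V) (hl : 0 < lam) (s : Fin N → ℝ) :
    PNdet N V lam s = (∏ i : Fin N, V ^ (i : ℕ)) *
      ∫ x : Fin N → ℝ, Real.exp (-(lam * V / 4) * ∑ i, x i ^ 4 + V * ∑ i, s i * x i) * vd x := by
  unfold PNdet
  rw [Matrix.det_apply']
  simp only [of_apply, Pint_iter V lam hV hl]
  have h1 : ∀ σ : Equiv.Perm (Fin N),
      ((Equiv.Perm.sign σ : ℤ) : ℝ) * ∏ j, ∫ x, Real.exp (-(lam * V / 4) * x ^ 4) * ((V * x) ^ (σ j : ℕ) * Real.exp (s j * (V * x)))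
      = ∫ x : Fin N → ℝ, ((Equiv.Perm.sign σ : ℤ) : ℝ) * ∏ j, (Real.exp (-(lam * V / 4) * x j ^ 4) * ((V * x j) ^ (σ j : ℕ) * Real.exp (s j * (V * x j)))) := by
    intro σ
    rw [integral_const_mul, integral_fintype_prod_volume_eq_prod
      (fun j x => Real.exp (-(lam * V / 4) * x ^ 4) * ((V * x) ^ (σ j : ℕ) * Real.exp (s j * (V * x))))]
  simp only [h1]
  rw [← integral_finset_sum, ← integral_const_mul]
  · congr 1
    ext x
    have h2 : ∀ σ : Equiv.Perm (Fin N), ((Equiv.Perm.sign σ : ℤ) : ℝ) *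
        ∏ j, (Real.exp (-(lam * V / 4) * x j ^ 4) * ((V * x j) ^ (σ j : ℕ) * Real.exp (s j * (V * x j))))
        = Real.exp (-(lam * V / 4) * ∑ i, x i ^ 4 + V * ∑ i, s i * x i) * (((Equiv.Perm.sign σ : ℤ) : ℝ) *
        ∏ j, (V * x j) ^ (σ j : ℕ)) := by
      intro σ
      simp only [Finset.prod_mul_distrib (f := fun j => Real.exp _), Finset.prod_mul_distrib (g := fun j => Real.exp _)]
      rw [← Real.exp_sum, ← Real.exp_sum, Real.exp_add, Finset.mul_sum, Finset.mul_sum]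
      have : ∑ i, s i * (V * x i) = ∑ i, V * (s i * x i) := Finset.sum_congr rfl fun i _ => by ring
      rw [this]; ring
    simp only [h2]
    rw [← Finset.mul_sum]
    have h3 : ∑ σ : Equiv.Perm (Fin N), ((Equiv.Perm.sign σ : ℤ) : ℝ) * ∏ j, (V * x j) ^ (σ j : ℕ)
        = (∏ i : Fin N, V ^ (i : ℕ)) * vd x := by
      unfold vd
      rw [← Matrix.det_transpose (vandermonde x), ← Matrix.det_mul_column, Matrix.det_apply']
      simp [vandermonde, mul_pow]
    rw [h3]; ring
  · intro σ _
    exact (Integrable.fintype_prod (f := fun j x => Real.exp (-(lam * V / 4) * x ^ 4) * ((V * x) ^ (σ j : ℕ) * Real.exp (s j * (V * x)))) fun j => Pint_int V lam hV hl _ _).const_mul _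

noncomputable def FH (A V : ℝ) (s : Fin N → ℝ) : ℝ :=
  ∫ c : HCoords N, Real.exp (-A * tr4 c + V * ∑ i, s i * c.1 i)

theorem FH_int (hN : 0 < N) (A V : ℝ) (hA : 0 < A) (s : Fin N → ℝ) :
    Integrable fun c : HCoords N => Real.exp (-A * tr4 c + V * ∑ i, s i * c.1 i) := by
  have hb := fun c : HCoords N => phiH_le hN A 1 1 hA c
  have h := (int_exp_Q (N := N) 1 one_pos).const_mul
    (Real.exp (V ^ 2 / 4 * ∑ i, s i ^ 2) * Real.exp (N * (1 + 1) ^ 2 / (4 * A)))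
  have hc := tr4_cont (N := N)
  refine h.mono' (Continuous.aestronglyMeasurable (by fun_prop)) (Filter.Eventually.of_forall fun c => ?_)
  rw [Real.norm_of_nonneg (Real.exp_pos _).le]
  have h1 : V * ∑ i, s i * c.1 i ≤ V ^ 2 / 4 * ∑ i, s i ^ 2 + 1 * Qh c := by
    have : V * ∑ i, s i * c.1 i ≤ V ^ 2 / 4 * ∑ i, s i ^ 2 + ∑ i, c.1 i ^ 2 := by
      rw [Finset.mul_sum, Finset.mul_sum, ← Finset.sum_add_distrib]
      refine Finset.sum_le_sum fun i _ => ?_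
      nlinarith [sq_nonneg (V / 2 * s i - c.1 i)]
    have h3 := rho_nonneg c
    unfold Qh; linarith
  calc _ ≤ Real.exp (V ^ 2 / 4 * ∑ i, s i ^ 2) * phiH A 1 c := by
        unfold phiH
        rw [← Real.exp_add]
        apply Real.exp_le_exp.2; linarith
    _ ≤ _ := by
        rw [mul_assoc]
        exact mul_le_mul_of_nonneg_left (hb c) (Real.exp_pos _).le

theorem FH_pos (hN : 0 < N) (A V : ℝ) (hA : 0 < A) (s : Fin N → ℝ) : 0 < FH A V s := by
  have := vol_ne (N := N)
  exact integral_exp_pos (FH_int hN A V hA s)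

theorem FH_PN (hN : 0 < N) (V lam : ℝ) (hV : 0 < V) (hl : 0 < lam) :
    ∃ C : ℝ, C ≠ 0 ∧ ∀ s : Fin N → ℝ, vd s * FH (lam * V / 4) V s = C * PNdet N V lam s := by
  obtain ⟨C, hC⟩ := compare (N := N) hN (lam * V / 4) V (by positivity) hV
  have hp : (∏ i : Fin N, V ^ (i : ℕ)) ≠ 0 := Finset.prod_ne_zero_iff.2 fun i _ => by positivity
  have key : ∀ s : Fin N → ℝ, vd s * FH (lam * V / 4) V s = (C / ∏ i : Fin N, V ^ (i : ℕ)) * PNdet N V lam s := by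
    intro s
    rw [PNdet_eq V lam hV hl, FH, hC s, ← mul_assoc, div_mul_cancel₀ _ hp]
  refine ⟨_, ?_, key⟩
  intro h0
  have h1 := key (fun i => (i : ℝ))
  rw [h0, zero_mul] at h1
  have h2 : vd (fun i : Fin N => ((i : ℕ) : ℝ)) ≠ 0 := vd_ne.2 fun i j h => by
    have h' : ((i : ℕ) : ℝ) = (j : ℕ) := h
    exact Fin.ext (by exact_mod_cast h')
  exact (mul_ne_zero h2 (FH_pos hN _ V (by positivity) _).ne') h1

end P8


section P9
variable {N : ℕ}

set_option maxHeartbeats 1000000 in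
theorem trace_quartic (a b : Matrix (Fin N) (Fin N) ℂ) :
    trace ((a + b) ^ 4) = trace (a ^ 4) + 4 * trace (b * a ^ 3) + 4 * trace (b ^ 2 * a ^ 2)
      + 2 * trace (b * a * b * a) + 4 * trace (b ^ 3 * a) + trace (b ^ 4) := by
  have e : (a + b) ^ 4 = a ^ 4 + (b * a ^ 3 + a * (b * a ^ 2) + a ^ 2 * (b * a) + a ^ 3 * b)
      + (b ^ 2 * a ^ 2 + b * a * b * a + (b * a ^ 2) * b + a * (b ^ 2 * a) + a * (b * a * b) + a ^ 2 * b ^ 2)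
      + (b ^ 3 * a + (b ^ 2 * a) * b + (b * a) * b ^ 2 + a * b ^ 3) + b ^ 4 := by noncomm_ring
  rw [e]
  simp only [trace_add]
  have h1 : trace (a * (b * a ^ 2)) = trace (b * a ^ 3) := by rw [trace_mul_comm]; congr 1; simp only [pow_succ, pow_zero, one_mul, mul_assoc]
  have h2 : trace (a ^ 2 * (b * a)) = trace (b * a ^ 3) := by rw [trace_mul_comm]; congr 1; simp only [pow_succ, pow_zero, one_mul, mul_assoc]
  have h3 : trace (a ^ 3 * b) = trace (b * a ^ 3) := by rw [trace_mul_comm]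
  have h4 : trace ((b * a ^ 2) * b) = trace (b ^ 2 * a ^ 2) := by rw [trace_mul_comm]; congr 1; simp only [pow_succ, pow_zero, one_mul, mul_assoc]
  have h5 : trace (a * (b ^ 2 * a)) = trace (b ^ 2 * a ^ 2) := by rw [trace_mul_comm]; congr 1; simp only [pow_succ, pow_zero, one_mul, mul_assoc]
  have h6 : trace (a * (b * a * b)) = trace (b * a * b * a) := by rw [trace_mul_comm]
  have h7 : trace (a ^ 2 * b ^ 2) = trace (b ^ 2 * a ^ 2) := by rw [trace_mul_comm]
  have h8 : trace ((b ^ 2 * a) * b) = trace (b ^ 3 * a) := by rw [trace_mul_comm]; congr 1; simp only [pow_succ, pow_zero, one_mul, mul_assoc]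
  have h9 : trace ((b * a) * b ^ 2) = trace (b ^ 3 * a) := by rw [trace_mul_comm]; congr 1; simp only [pow_succ, pow_zero, one_mul, mul_assoc]
  have h10 : trace (a * b ^ 3) = trace (b ^ 3 * a) := by rw [trace_mul_comm]
  rw [h1, h2, h3, h4, h5, h6, h7, h8, h9, h10]
  ring

theorem trace_diag_herm (d : Fin N → ℝ) (c : HCoords N) :
    (trace (diagonal (fun i => (d i : ℂ)) * hermOf c)).re = ∑ i, d i * c.1 i := by
  simp [trace, diagonal_mul, hermOf_diag, Complex.re_sum]

theorem trace_diag_re (d : Fin N → ℝ) :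
    (trace (diagonal (fun i => (d i : ℂ)))).re = ∑ i, d i := by
  simp [trace, Complex.re_sum]

theorem action_eq (V lam kap : ℝ) (hl : 0 < lam) (Ev : Fin N → ℝ) (hE : ∀ i, 0 < Ev i) (c : HCoords N) :
    action N V lam kap Ev (hermOf c)
      = lam * V / 4 * tr4 (c + ((fun i => Real.sqrt (Ev i) / Real.sqrt lam), 0))
        - V * ∑ i, (Ev i ^ ((3 : ℝ) / 2) / Real.sqrt lam - kap) * c.1 i
        - V / 4 * ∑ i, Ev i ^ 2 / lam := by
  set g := Real.sqrt lam with hg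
  have hg0 : g ≠ 0 := (Real.sqrt_pos.2 hl).ne'
  have hg2 : lam = g ^ 2 := (Real.sq_sqrt hl.le).symm
  set r : Fin N → ℝ := fun i => Real.sqrt (Ev i) with hr
  have h32 : ∀ i, Ev i ^ ((3 : ℝ) / 2) = r i ^ 3 := by
    intro i
    rw [hr]; simp only []; rw [Real.sqrt_eq_rpow, ← Real.rpow_natCast, ← Real.rpow_mul (hE i).le]; norm_num
  have hE2 : ∀ i, Ev i = r i ^ 2 := fun i => (Real.sq_sqrt (hE i).le).symm
  have hM : Mmat N Ev = diagonal fun i => (r i : ℂ) := rfl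
  have hEm : Emat N Ev = (diagonal fun i => (r i : ℂ)) ^ 2 := by
    unfold Emat
    rw [diagonal_pow]
    congr 1; ext i
    simp only [Pi.pow_apply]
    rw [hE2 i]; push_cast; rfl
  set D : Matrix (Fin N) (Fin N) ℂ := diagonal fun i => (r i : ℂ) with hD
  set Φ := hermOf c with hΦ
  have hb : hermOf (((fun i => r i / g), 0) : HCoords N) = ((g⁻¹ : ℝ) : ℂ) • D := by
    rw [hermOf_iota, hD, ← diagonal_smul]
    congr 1; ext i
    simp [div_eq_inv_mul]
  have ht : trace ((Φ + ((g⁻¹ : ℝ) : ℂ) • D) ^ 4) = trace (Φ ^ 4) + ((4 * g⁻¹ : ℝ) : ℂ) * trace (D * Φ ^ 3)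
      + ((4 * g⁻¹ ^ 2 : ℝ) : ℂ) * trace (D ^ 2 * Φ ^ 2) + ((2 * g⁻¹ ^ 2 : ℝ) : ℂ) * trace (D * Φ * D * Φ)
      + ((4 * g⁻¹ ^ 3 : ℝ) : ℂ) * trace (D ^ 3 * Φ) + ((g⁻¹ ^ 4 : ℝ) : ℂ) * trace (D ^ 4) := by
    rw [trace_quartic]
    simp only [_root_.smul_pow, smul_mul_assoc, mul_smul_comm, trace_smul, smul_eq_mul]
    push_cast
    ring
  have h3 : (trace (D ^ 3 * Φ)).re = ∑ i, r i ^ 3 * c.1 i := by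
    rw [← trace_diag_herm, hD, diagonal_pow]; congr 4; ext i; simp
  have h4 : (trace (D ^ 4)).re = ∑ i, r i ^ 4 := by
    rw [← trace_diag_re, hD, diagonal_pow]; congr 3; ext i; simp
  have h0 : (trace Φ).re = ∑ i, c.1 i := by
    have := trace_diag_herm (fun _ => 1) c
    simpa using this
  unfold action tr4
  rw [hermOf_add, hb, ht, hEm, hM]
  simp only [trace_add, trace_smul, smul_eq_mul, Complex.add_re, Complex.re_ofReal_mul]
  rw [h3, h4]
  have e1 : ((1 / 2 : ℂ) * trace (D * Φ * D * Φ)).re = 1 / 2 * (trace (D * Φ * D * Φ)).re := by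
    have : (1 / 2 : ℂ) = ((1 / 2 : ℝ) : ℂ) := by push_cast; rfl
    rw [this, Complex.re_ofReal_mul]
  have e2 : ((lam : ℂ) / 4 * trace (Φ ^ 4)).re = lam / 4 * (trace (Φ ^ 4)).re := by
    have : (lam : ℂ) / 4 = ((lam / 4 : ℝ) : ℂ) := by push_cast; rfl
    rw [this, Complex.re_ofReal_mul]
  rw [e1, e2, h0]
  have s1 : ∑ i, (Ev i ^ ((3 : ℝ) / 2) / g - kap) * c.1 i = g⁻¹ * (∑ i, r i ^ 3 * c.1 i) - kap * ∑ i, c.1 i := by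
    rw [Finset.mul_sum, Finset.mul_sum, ← Finset.sum_sub_distrib]
    refine Finset.sum_congr rfl fun i _ => ?_
    rw [h32]; ring
  have s2 : ∑ i, Ev i ^ 2 / lam = g⁻¹ ^ 2 * ∑ i, r i ^ 4 := by
    rw [Finset.mul_sum]
    refine Finset.sum_congr rfl fun i _ => ?_
    rw [hE2 i, hg2]
    field_simp
  rw [← hg, s1, s2, hg2]
  generalize (trace (Φ ^ 4)).re = A1
  generalize (trace (D * Φ ^ 3)).re = A2
  generalize (trace (D ^ 2 * Φ ^ 2)).re = A3
  generalize (trace (D * Φ * D * Φ)).re = A4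
  generalize (∑ i, r i ^ 3 * c.1 i) = A5
  generalize (∑ i, r i ^ 4) = A6
  generalize (∑ i, c.1 i) = A7
  field_simp
  ring

theorem Z_eq (V lam kap : ℝ) (hl : 0 < lam) (Ev : Fin N → ℝ) (hE : ∀ i, 0 < Ev i) (t : Fin N → ℝ) :
    Zfun N V lam kap Ev (diagonal fun i => (t i : ℂ))
      = Real.exp (V / 4 * ∑ i, Ev i ^ 2 / lam
          - V * ∑ i, (t i + (Ev i ^ ((3 : ℝ) / 2) / Real.sqrt lam - kap)) * (Real.sqrt (Ev i) / Real.sqrt lam))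
        * FH (lam * V / 4) V (fun i => t i + (Ev i ^ ((3 : ℝ) / 2) / Real.sqrt lam - kap)) := by
  have := vol_haar (N := N)
  unfold Zfun FH
  set m : HCoords N := ((fun i => Real.sqrt (Ev i) / Real.sqrt lam), 0) with hm
  rw [← integral_add_right_eq_self (μ := (volume : Measure (HCoords N)))
    (fun c : HCoords N => Real.exp (-(lam * V / 4) * tr4 c
      + V * ∑ i, (t i + (Ev i ^ ((3 : ℝ) / 2) / Real.sqrt lam - kap)) * c.1 i)) m, ← integral_const_mul]
  congr 1
  ext c
  rw [← Real.exp_add, action_eq V lam kap hl Ev hE c, trace_diag_herm]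
  congr 1
  have e : ∑ i, (t i + (Ev i ^ ((3 : ℝ) / 2) / Real.sqrt lam - kap)) * (c + m).1 i
      = ∑ i, (Ev i ^ ((3 : ℝ) / 2) / Real.sqrt lam - kap) * c.1 i + ∑ i, t i * c.1 i
      + ∑ i, (t i + (Ev i ^ ((3 : ℝ) / 2) / Real.sqrt lam - kap)) * (Real.sqrt (Ev i) / Real.sqrt lam) := by
    rw [← Finset.sum_add_distrib, ← Finset.sum_add_distrib]
    refine Finset.sum_congr rfl fun i _ => ?_
    simp only [hm, Prod.fst_add, Pi.add_apply]
    ring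
  rw [e]
  ring

end P9


section P10
variable {N : ℕ}

theorem pd_eqOn {U : Set (Fin N → ℝ)} (hU : IsOpen U) {f g : (Fin N → ℝ) → ℝ} (h : Set.EqOn f g U) (i : Fin N) :
    Set.EqOn (pd N i f) (pd N i g) U := by
  intro x hx
  unfold pd
  apply Filter.EventuallyEq.deriv_eq
  have hc : Continuous fun t : ℝ => Function.update x i t := continuous_const.update i continuous_id
  have : ∀ᶠ t in nhds (x i), Function.update x i t ∈ U :=
    hc.continuousAt.eventually (by simpa only [Function.update_eq_self] using hU.eventually_mem hx)
  filter_upwards [this] with t ht using h ht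

theorem pd_hasDeriv {U : Set (Fin N → ℝ)} (hU : IsOpen U) {f : (Fin N → ℝ) → ℝ}
    (hf : ContDiffOn ℝ (⊤ : ℕ∞) f U) (i : Fin N) {x : Fin N → ℝ} (hx : x ∈ U) :
    HasDerivAt (fun t => f (Function.update x i t)) (fderiv ℝ f x (Pi.single i 1)) (x i) := by
  have h1 : HasFDerivAt f (fderiv ℝ f x) (Function.update x i (x i)) := by
    rw [Function.update_eq_self]
    exact ((hf.contDiffAt (hU.mem_nhds hx)).differentiableAt (by simp)).hasFDerivAt
  exact h1.comp_hasDerivAt (x i) (hasDerivAt_update x i (x i))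

theorem pd_eq_fderiv {U : Set (Fin N → ℝ)} (hU : IsOpen U) {f : (Fin N → ℝ) → ℝ}
    (hf : ContDiffOn ℝ (⊤ : ℕ∞) f U) (i : Fin N) {x : Fin N → ℝ} (hx : x ∈ U) :
    pd N i f x = fderiv ℝ f x (Pi.single i 1) := (pd_hasDeriv hU hf i hx).deriv

theorem pd_smooth {U : Set (Fin N → ℝ)} (hU : IsOpen U) {f : (Fin N → ℝ) → ℝ}
    (hf : ContDiffOn ℝ (⊤ : ℕ∞) f U) (i : Fin N) : ContDiffOn ℝ (⊤ : ℕ∞) (pd N i f) U := by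
  have h1 : ContDiffOn ℝ (⊤ : ℕ∞) (fderiv ℝ f) U := hf.fderiv_of_isOpen hU (by simp)
  exact (h1.clm_apply contDiffOn_const).congr fun x hx => pd_eq_fderiv hU hf i hx

theorem pd_add {U : Set (Fin N → ℝ)} (hU : IsOpen U) {f g : (Fin N → ℝ) → ℝ}
    (hf : ContDiffOn ℝ (⊤ : ℕ∞) f U) (hg : ContDiffOn ℝ (⊤ : ℕ∞) g U) (i : Fin N) :
    Set.EqOn (pd N i (fun x => f x + g x)) (fun x => pd N i f x + pd N i g x) U := by
  intro x hx
  have h1 := (pd_hasDeriv hU hf i hx).add (pd_hasDeriv hU hg i hx)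
  simp only [pd_eq_fderiv hU hf i hx, pd_eq_fderiv hU hg i hx]
  exact h1.deriv

theorem D_eqOn {U : Set (Fin N → ℝ)} (hU : IsOpen U) {f g : (Fin N → ℝ) → ℝ} (h : Set.EqOn f g U) (l : List (Fin N)) :
    Set.EqOn (l.foldr (pd N) f) (l.foldr (pd N) g) U := by
  induction l with
  | nil => exact h
  | cons a l ih => exact pd_eqOn hU ih a

theorem D_smooth {U : Set (Fin N → ℝ)} (hU : IsOpen U) {f : (Fin N → ℝ) → ℝ}
    (hf : ContDiffOn ℝ (⊤ : ℕ∞) f U) (l : List (Fin N)) : ContDiffOn ℝ (⊤ : ℕ∞) (l.foldr (pd N) f) U := by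
  induction l with
  | nil => exact hf
  | cons a l ih => exact pd_smooth hU ih a

theorem D_add {U : Set (Fin N → ℝ)} (hU : IsOpen U) {f g : (Fin N → ℝ) → ℝ}
    (hf : ContDiffOn ℝ (⊤ : ℕ∞) f U) (hg : ContDiffOn ℝ (⊤ : ℕ∞) g U) (l : List (Fin N)) :
    Set.EqOn (l.foldr (pd N) (fun x => f x + g x)) (fun x => l.foldr (pd N) f x + l.foldr (pd N) g x) U := by
  induction l with
  | nil => exact fun x _ => rfl
  | cons a l ih =>
    intro x hx
    have h1 := pd_eqOn hU ih a hx
    have h2 := pd_add hU (D_smooth hU hf l) (D_smooth hU hg l) a hx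
    exact h1.trans h2

theorem D_shift (f : (Fin N → ℝ) → ℝ) (z : Fin N → ℝ) (l : List (Fin N)) :
    l.foldr (pd N) (fun t => f (t + z)) = fun t => l.foldr (pd N) f (t + z) := by
  induction l with
  | nil => rfl
  | cons a l ih =>
    simp only [List.foldr_cons]
    rw [ih]
    ext t
    generalize l.foldr (pd N) f = F
    unfold pd
    have h : ∀ r : ℝ, Function.update t a r + z = Function.update (t + z) a (r + z a) := by
      intro r
      ext j
      by_cases hj : j = a
      · subst hj; simp
      · simp [hj]
    simp only [h]
    rw [deriv_comp_add_const (fun r => F (Function.update (t + z) a r)) (z a) (t a)]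
    rfl

def DepOn (T : Set (Fin N)) (f : (Fin N → ℝ) → ℝ) : Prop := ∀ x y : Fin N → ℝ, (∀ i ∈ T, x i = y i) → f x = f y

theorem pd_zero_of_dep {T : Set (Fin N)} {f : (Fin N → ℝ) → ℝ} (h : DepOn T f) {i : Fin N} (hi : i ∉ T) (x : Fin N → ℝ) :
    pd N i f x = 0 := by
  unfold pd
  have : (fun t => f (Function.update x i t)) = fun _ => f x := by
    ext t
    refine h _ _ fun j hj => ?_
    rw [Function.update_of_ne]
    rintro rfl; exact hi hj
  rw [this, deriv_const]

theorem pd_dep {T : Set (Fin N)} {f : (Fin N → ℝ) → ℝ} (h : DepOn T f) (i : Fin N) : DepOn T (pd N i f) := by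
  intro x y hxy
  by_cases hi : i ∈ T
  · unfold pd
    rw [hxy i hi]
    congr 1
    ext t
    refine h _ _ fun j hj => ?_
    by_cases hji : j = i
    · subst hji; simp
    · simp [hji, hxy j hj]
  · rw [pd_zero_of_dep h hi, pd_zero_of_dep h hi]

theorem D_dep {T : Set (Fin N)} {f : (Fin N → ℝ) → ℝ} (h : DepOn T f) (l : List (Fin N)) :
    DepOn T (l.foldr (pd N) f) := by
  induction l with
  | nil => exact h
  | cons a l ih => exact pd_dep ih a

theorem D_kill {T : Set (Fin N)} {f : (Fin N → ℝ) → ℝ} (h : DepOn T f) {a : Fin N} (ha : a ∉ T) (l : List (Fin N))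
    (hl : a ∈ l) (x : Fin N → ℝ) : l.foldr (pd N) f x = 0 := by
  induction l generalizing x with
  | nil => simp at hl
  | cons b l ih =>
    rcases List.mem_cons.1 hl with rfl | hl
    · exact pd_zero_of_dep (D_dep h l) ha x
    · have : l.foldr (pd N) f = fun _ => 0 := funext fun x => ih hl x
      simp only [List.foldr_cons]
      rw [this]
      simp [pd]

def Kill (U : Set (Fin N → ℝ)) (l : List (Fin N)) (g : (Fin N → ℝ) → ℝ) : Prop :=
  ContDiffOn ℝ (⊤ : ℕ∞) g U ∧ ∀ x ∈ U, l.foldr (pd N) g x = 0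

theorem Kill.add {U : Set (Fin N → ℝ)} (hU : IsOpen U) {l : List (Fin N)} {f g : (Fin N → ℝ) → ℝ}
    (hf : Kill U l f) (hg : Kill U l g) : Kill U l fun x => f x + g x := by
  refine ⟨hf.1.add hg.1, fun x hx => ?_⟩
  have h := D_add hU hf.1 hg.1 l hx
  simp only [hf.2 x hx, hg.2 x hx, add_zero] at h
  exact h

theorem Kill.of_dep {U : Set (Fin N → ℝ)} {l : List (Fin N)} (hl : l.Nodup) (h3 : 3 ≤ l.length)
    (i j : Fin N) {f : (Fin N → ℝ) → ℝ} (hs : ContDiffOn ℝ (⊤ : ℕ∞) f U) (hf : DepOn {i, j} f) : Kill U l f := by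
  have : ∃ a ∈ l, a ∉ ({i, j} : Set (Fin N)) := by
    by_contra hcon
    push Not at hcon
    have h1 : l.toFinset ⊆ {i, j} := by
      intro a ha
      have := hcon a (List.mem_toFinset.1 ha)
      simpa using this
    have h2 := Finset.card_le_card h1
    rw [List.toFinset_card_of_nodup hl] at h2
    have h4 := Finset.card_le_two (a := i) (b := j)
    omega
  obtain ⟨a, ha, ha'⟩ := this
  exact ⟨hs, fun x _ => D_kill hf ha' l ha x⟩

theorem Kill.const {U : Set (Fin N → ℝ)} {l : List (Fin N)} (h3 : 3 ≤ l.length) (c : ℝ) : Kill U l fun _ => c := by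
  obtain ⟨a, ha⟩ := List.exists_mem_of_length_pos (l := l) (by omega)
  exact ⟨contDiffOn_const, fun x _ => D_kill (T := ∅) (f := fun _ => c) (fun _ _ _ => rfl) (a := a) (by simp) l ha x⟩

theorem Kill.sum {U : Set (Fin N → ℝ)} (hU : IsOpen U) {l : List (Fin N)} (h3 : 3 ≤ l.length) {ι : Type*} (S : Finset ι)
    (f : ι → (Fin N → ℝ) → ℝ) (hf : ∀ i ∈ S, Kill U l (f i)) : Kill U l fun x => ∑ i ∈ S, f i x := by
  classical
  induction S using Finset.induction_on with
  | empty => simpa using Kill.const h3 0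
  | insert a S ha ih =>
    simp only [Finset.sum_insert ha]
    exact Kill.add hU (hf a (by simp)) (ih fun i hi => hf i (by simp [hi]))

theorem inj_open : IsOpen {s : Fin N → ℝ | Function.Injective s} := by
  have : {s : Fin N → ℝ | Function.Injective s} = {s | vd s ≠ 0} := by ext s; exact vd_ne.symm
  rw [this]
  exact isOpen_ne_fun vd_cont continuous_const

theorem log_vd (s : Fin N → ℝ) (hs : Function.Injective s) :
    Real.log (vd s) = ∑ i, ∑ j ∈ Finset.Ioi i, Real.log (s j - s i) := by
  unfold vd
  have h : ∀ i : Fin N, ∀ j ∈ Finset.Ioi i, s j - s i ≠ 0 := by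
    intro i j hj h0
    have := hs (sub_eq_zero.1 h0)
    simp [this] at hj
  rw [det_vandermonde, Real.log_prod fun i _ => Finset.prod_ne_zero_iff.2 (h i)]
  exact Finset.sum_congr rfl fun i _ => Real.log_prod (h i)

theorem main_aux (hN : 0 < N) (V lam kap : ℝ) (hV : 0 < V) (hl : 0 < lam)
    (Ev : Fin N → ℝ) (hE : ∀ i, 0 < Ev i) (hinj : Function.Injective Ev) (l : List (Fin N)) (hnd : l.Nodup)
    (h3 : 3 ≤ l.length) :
    (l.foldr (pd N) (fun t => Real.log (Zfun N V lam kap Ev (Matrix.diagonal fun i => (t i : ℂ))))) (0 : Fin N → ℝ)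
    = (l.foldr (pd N) (fun s => Real.log (PNdet N V lam s)))
        (fun j => Ev j ^ ((3 : ℝ) / 2) / Real.sqrt lam - kap) := by
  set z : Fin N → ℝ := fun j => Ev j ^ ((3 : ℝ) / 2) / Real.sqrt lam - kap with hz
  set U : Set (Fin N → ℝ) := {s | Function.Injective s} with hUdef
  have hU : IsOpen U := inj_open
  have hzU : z ∈ U := by
    intro i j hij
    have h1 : Ev i ^ ((3 : ℝ) / 2) / Real.sqrt lam = Ev j ^ ((3 : ℝ) / 2) / Real.sqrt lam := by
      simpa [hz] using hij
    have h2 : Ev i ^ ((3 : ℝ) / 2) = Ev j ^ ((3 : ℝ) / 2) := by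
      have hg := (Real.sqrt_pos.2 hl).ne'
      field_simp at h1
      exact h1
    exact hinj ((Real.rpow_left_inj (hE i).le (hE j).le (by norm_num)).1 h2)
  obtain ⟨C, hC0, hC⟩ := FH_PN (N := N) hN V lam hV hl
  have hFpos := fun s : Fin N → ℝ => FH_pos hN (lam * V / 4) V (by positivity) s
  have hPne : ∀ s ∈ U, PNdet N V lam s ≠ 0 := by
    intro s hs h0
    have := hC s
    rw [h0, mul_zero] at this
    exact mul_ne_zero (vd_ne.2 hs) (hFpos s).ne' this
  set K : ℝ := V / 4 * ∑ i, Ev i ^ 2 / lam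
  set m : Fin N → ℝ := fun i => Real.sqrt (Ev i) / Real.sqrt lam
  have hL : (fun t : Fin N → ℝ => Real.log (Zfun N V lam kap Ev (Matrix.diagonal fun i => (t i : ℂ))))
      = fun t => (fun s : Fin N → ℝ => K - V * ∑ i, s i * m i + Real.log (FH (lam * V / 4) V s)) (t + z) := by
    ext t
    rw [Z_eq V lam kap hl Ev hE t, Real.log_mul (Real.exp_pos _).ne' (hFpos _).ne', Real.log_exp]
    rfl
  rw [hL, D_shift (fun s : Fin N → ℝ => K - V * ∑ i, s i * m i + Real.log (FH (lam * V / 4) V s)) z l]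
  simp only [zero_add]
  have hG : Kill U l fun s => (K + Real.log C) + ((∑ i, (-(V * m i) * s i)) + ∑ i, ∑ j ∈ Finset.Ioi i, -Real.log (s j - s i)) := by
    refine Kill.add hU (Kill.const h3 _) (Kill.add hU (Kill.sum hU h3 _ _ fun i _ => ?_)
      (Kill.sum hU h3 _ _ fun i _ => Kill.sum hU h3 _ _ fun j hj => ?_))
    · refine Kill.of_dep hnd h3 i i (ContDiff.contDiffOn (by fun_prop)) ?_
      intro x y h
      simp only [h i (by simp)]
    · refine Kill.of_dep hnd h3 i j ?_ ?_
      · refine (ContDiffOn.log (ContDiff.contDiffOn (by fun_prop)) fun s hs h0 => ?_).neg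
        have := hs (sub_eq_zero.1 h0)
        simp [this] at hj
      · intro x y h
        simp only [h i (by simp), h j (by simp)]
  have hP : ContDiffOn ℝ (⊤ : ℕ∞) (fun s => Real.log (PNdet N V lam s)) U :=
    (PNdet_smooth V lam hV hl).contDiffOn.log hPne
  have heq : Set.EqOn (fun s : Fin N → ℝ => K - V * ∑ i, s i * m i + Real.log (FH (lam * V / 4) V s))
      (fun s => Real.log (PNdet N V lam s) + ((K + Real.log C) + ((∑ i, (-(V * m i) * s i)) + ∑ i, ∑ j ∈ Finset.Ioi i, -Real.log (s j - s i)))) U := by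
    intro s hs
    have h1 := congrArg Real.log (hC s)
    rw [Real.log_mul (vd_ne.2 hs) (hFpos s).ne', Real.log_mul hC0 (hPne s hs), log_vd s hs] at h1
    have h2 : ∑ i, (-(V * m i) * s i) = -(V * ∑ i, s i * m i) := by
      rw [Finset.mul_sum, ← Finset.sum_neg_distrib]
      exact Finset.sum_congr rfl fun i _ => by ring
    simp only [Finset.sum_neg_distrib, h2]
    linarith
  have h5 := D_add hU hP hG.1 l hzU
  simp only [hG.2 z hzU, add_zero] at h5
  exact (D_eqOn hU heq l hzU).trans h5

end P10

/-- For `n ≥ 3` and pairwise distinct indices `a¹,…,aⁿ`, the mixed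
partial `(∂ⁿ/∂t_{a¹}⋯∂t_{aⁿ}) log Z_diag |_{t=0}` equals
`(∂ⁿ/∂s_{a¹}⋯∂s_{aⁿ}) log P_N` at `z`; consequently
`G_{|a¹|⋯|aⁿ|} = V^{n−2} (∂ⁿ log Z_diag)|₀ = V^{n−2} (∂ⁿ log P_N)(z)`. -/
theorem n_point_function_n_boundaries_exact
    (N : ℕ) (hN : 1 ≤ N) (Vc lam kap : ℝ) (hV : 0 < Vc) (hlam : 0 < lam)
    (Ev : Fin N → ℝ) (hE : ∀ i, 0 < Ev i) (hEdist : Function.Injective Ev)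
    (n : ℕ) (hn : 3 ≤ n) (a : Fin n → Fin N) (ha : Function.Injective a) :
    ((List.ofFn a).foldr (pd N)
        (fun t => Real.log (Zfun N Vc lam kap Ev (Matrix.diagonal fun i => (t i : ℂ)))))
      (0 : Fin N → ℝ)
    = ((List.ofFn a).foldr (pd N) (fun s => Real.log (PNdet N Vc lam s)))
        (fun j => Ev j ^ ((3 : ℝ) / 2) / Real.sqrt lam - kap)
    ∧ Vc ^ (n - 2) * ((List.ofFn a).foldr (pd N)
        (fun t => Real.log (Zfun N Vc lam kap Ev (Matrix.diagonal fun i => (t i : ℂ)))))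
      (0 : Fin N → ℝ)
    = Vc ^ (n - 2) * ((List.ofFn a).foldr (pd N) (fun s => Real.log (PNdet N Vc lam s)))
        (fun j => Ev j ^ ((3 : ℝ) / 2) / Real.sqrt lam - kap) := by
  have h := main_aux (N := N) hN Vc lam kap hV hlam Ev hE hEdist (List.ofFn a) (List.nodup_ofFn.2 ha)
    (by rw [List.length_ofFn]; exact hn)
  exact ⟨h, by rw [h]⟩
end

section
/- Fix reals V > 0 and E > 0, and for λ > 0 set C′(λ) = √(π√λ/(3√V·E)) · exp(3VE²/(4λ)). Then, as λ → 0⁺, (1/C′(λ)) ∫_ℝ exp(−(λV/4)x⁴ + Vx·E^{3/2}/√λ) dx − ( √2/(λ^{1/4}V^{1/4}) + 7λ^{3/4}/(18√2·E²·V^{5/4}) + 385λ^{7/4}/(1296√2·E⁴·V^{9/4}) ) = O(λ^{11/4}). -/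
open MeasureTheory Filter Asymptotics

lemma sp_exp_rem (x : ℝ) :
    |Real.exp x - (1 + x + x^2/2 + x^3/6 + x^4/24 + x^5/120)| ≤ 4 * x^6 * (1 + Real.exp x) := by
  have key : |Real.exp x - (1 + x + x^2/2 + x^3/6 + x^4/24 + x^5/120)| ≤ x^6 * Real.exp |x| := by
    have h := Complex.norm_exp_sub_sum_le_norm_mul_exp (x : ℂ) 6
    have e : (Complex.exp (x:ℂ) - ∑ m ∈ Finset.range 6, (x:ℂ)^m / (m.factorial : ℂ)) =
        ((Real.exp x - (1 + x + x^2/2 + x^3/6 + x^4/24 + x^5/120) : ℝ) : ℂ) := by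
      simp [Finset.sum_range_succ, Nat.factorial]
    rw [e, Complex.norm_real, Complex.norm_real, Real.norm_eq_abs, Real.norm_eq_abs] at h
    have : |x|^6 = x^6 := by rw [Even.pow_abs (by decide)]
    rwa [this] at h
  have h6 : 0 ≤ x^6 := by positivity
  have hpos := Real.exp_pos x
  rcases le_total 0 x with hx | hx
  · rw [abs_of_nonneg hx] at key
    nlinarith [mul_nonneg h6 hpos.le]
  · rcases le_total (-1) x with h1 | h1
    · have : Real.exp |x| ≤ 3 := by
        have : |x| ≤ 1 := abs_le.2 ⟨h1, by linarith⟩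
        have := Real.exp_le_exp.2 this
        linarith [Real.exp_one_lt_d9]
      nlinarith [mul_nonneg h6 hpos.le]
    · have he : Real.exp x ≤ 1 := Real.exp_le_one_iff.2 hx
      obtain ⟨y, rfl⟩ : ∃ y, x = -y := ⟨-x, by ring⟩
      have hy : 1 ≤ y := by linarith
      have p : ∀ n, n ≤ 6 → y^n ≤ y^6 := fun n hn => pow_le_pow_right₀ hy hn
      have p0 := p 0 (by norm_num)
      have p1 := p 1 (by norm_num)
      have p2 := p 2 (by norm_num)
      have p3 := p 3 (by norm_num)
      have p4 := p 4 (by norm_num)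
      have p5 := p 5 (by norm_num)
      have q : ∀ n, 0 ≤ y^n := fun n => by positivity
      have q2 := q 2
      have q3 := q 3
      have q4 := q 4
      have q5 := q 5
      have z : 0 ≤ y^6 * Real.exp (-y) := by positivity
      have e6 : (-y)^6 = y^6 := by ring
      rw [e6, abs_le]
      constructor <;> ring_nf at * <;> linarith

lemma sp_int {b : ℝ} (hb : 0 < b) (n : ℕ) : Integrable (fun s : ℝ => s^n * Real.exp (-b * s^2)) := by
  have := integrable_rpow_mul_exp_neg_mul_sq hb (s := (n:ℝ)) (by have : (0:ℝ) ≤ n := n.cast_nonneg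
                                                                 linarith)
  simpa using this

noncomputable def spM (n : ℕ) : ℝ := ∫ s : ℝ, s^n * Real.exp (-(3/2) * s^2)

lemma sp_M0 : spM 0 = Real.sqrt (2 * Real.pi / 3) := by
  unfold spM
  simp only [pow_zero, one_mul]
  rw [integral_gaussian]
  congr 1; ring

lemma sp_M1 : spM 1 = 0 := by
  have h := integral_eq_zero_of_hasDerivAt_of_integrable
    (f := fun s : ℝ => Real.exp (-(3/2) * s^2)) (f' := fun s : ℝ => -3 * (s^1 * Real.exp (-(3/2) * s^2)))
    (fun s => by
      have := (((hasDerivAt_id s).pow 2).const_mul (-(3/2))).exp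
      refine this.congr_deriv ?_
      simp only [id, Pi.pow_apply]; push_cast; ring_nf)
    ((sp_int (by norm_num) 1).const_mul _) (by simpa using sp_int (b := 3/2) (by norm_num) 0)
  rw [integral_const_mul] at h
  unfold spM
  linarith

lemma sp_Mrec (n : ℕ) : spM (n+2) = (n+1)/3 * spM n := by
  have h := integral_eq_zero_of_hasDerivAt_of_integrable
    (f := fun s : ℝ => s^(n+1) * Real.exp (-(3/2) * s^2))
    (f' := fun s : ℝ => (n+1) * (s^n * Real.exp (-(3/2) * s^2)) - 3 * (s^(n+2) * Real.exp (-(3/2) * s^2)))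
    (fun s => by
      have := (hasDerivAt_pow (n+1) s).mul (((hasDerivAt_id s).pow 2).const_mul (-(3/2))).exp
      refine this.congr_deriv ?_
      simp only [id, Pi.pow_apply]; push_cast; ring_nf)
    (((sp_int (by norm_num) n).const_mul _).sub ((sp_int (by norm_num) (n+2)).const_mul _))
    (sp_int (b := 3/2) (by norm_num) _)
  rw [integral_sub ((sp_int (by norm_num) n).const_mul _) ((sp_int (by norm_num) (n+2)).const_mul _),
    integral_const_mul, integral_const_mul] at h
  unfold spM
  linarith

noncomputable def spF (ε : ℝ) : ℝ := ∫ s : ℝ, Real.exp (-(3/2*s^2 + ε*s^3 + ε^2*s^4/4))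

noncomputable def spP (ε s : ℝ) : ℝ :=
  let x := -(ε*s^3 + ε^2*s^4/4)
  1 + x + x^2/2 + x^3/6 + x^4/24 + x^5/120

lemma sp_pt (ε s : ℝ) (h0 : 0 < ε) (h1 : ε ≤ 1) :
    |Real.exp (-(3/2*s^2 + ε*s^3 + ε^2*s^4/4)) - spP ε s * Real.exp (-(3/2)*s^2)|
      ≤ ε^6 * (8 * 64 * (s^18 * Real.exp (-(1/2)*s^2) + s^24 * Real.exp (-(1/2)*s^2))) := by
  set x := -(ε*s^3 + ε^2*s^4/4) with hx
  have e1 : Real.exp (-(3/2*s^2 + ε*s^3 + ε^2*s^4/4)) = Real.exp x * Real.exp (-(3/2)*s^2) := by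
    rw [← Real.exp_add]; congr 1; rw [hx]; ring
  have e2 : spP ε s = 1 + x + x^2/2 + x^3/6 + x^4/24 + x^5/120 := rfl
  have b1 : Real.exp x * Real.exp (-(3/2)*s^2) ≤ Real.exp (-(1/2)*s^2) := by
    rw [← Real.exp_add, Real.exp_le_exp, hx]
    nlinarith [sq_nonneg (s + ε*s^2/2)]
  have b2 : Real.exp (-(3/2)*s^2) ≤ Real.exp (-(1/2)*s^2) := by
    rw [Real.exp_le_exp]; nlinarith [sq_nonneg s]
  have hx6 : x^6 ≤ ε^6 * (64 * (s^18 + s^24)) := by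
    have t : x = -ε * (s^3 + ε * s^4/4) := by rw [hx]; ring
    have : |s^3 + ε*s^4/4| ≤ |s|^3 + |s|^4 := by
      refine (abs_add_le _ _).trans ?_
      rw [abs_pow]
      gcongr
      rw [abs_div, abs_mul, abs_pow, abs_of_pos h0, abs_of_pos (by norm_num : (0:ℝ) < 4)]
      have : 0 ≤ |s|^4 := by positivity
      nlinarith
    have h6 : (s^3 + ε*s^4/4)^6 ≤ (|s|^3 + |s|^4)^6 := by
      rw [← Even.pow_abs (by decide : Even 6) (s^3 + ε*s^4/4)]
      gcongr
    have h7 : (|s|^3 + |s|^4)^6 ≤ 2^(6-1) * ((|s|^3)^6 + (|s|^4)^6) :=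
      add_pow_le (by positivity) (by positivity) 6
    have s18 : (|s|^3)^6 = s^18 := by rw [← pow_mul, Even.pow_abs (by decide)]
    have s24 : (|s|^4)^6 = s^24 := by rw [← pow_mul, Even.pow_abs (by decide)]
    rw [s18, s24] at h7
    have : 0 ≤ s^18 + s^24 := by positivity
    rw [t, mul_pow, Even.neg_pow (by decide)]
    gcongr
    norm_num at h7
    linarith
  rw [e1, e2, ← sub_mul, abs_mul, abs_of_pos (Real.exp_pos _)]
  calc _ ≤ 4 * x^6 * (1 + Real.exp x) * Real.exp (-(3/2)*s^2) := by gcongr; exact sp_exp_rem x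
    _ = 4 * x^6 * (Real.exp (-(3/2)*s^2) + Real.exp x * Real.exp (-(3/2)*s^2)) := by ring
    _ ≤ 4 * (ε^6 * (64 * (s^18 + s^24))) * (Real.exp (-(1/2)*s^2) + Real.exp (-(1/2)*s^2)) := by
        gcongr
    _ = _ := by ring

noncomputable def spC (ε : ℝ) (j : ℕ) : ℝ :=
  match j with
  | 0 => 1
  | 3 => -ε
  | 4 => -ε^2/4
  | 6 => ε^2/2
  | 7 => ε^3/4
  | 8 => ε^4/32
  | 9 => -ε^3/6
  | 10 => -ε^4/8
  | 11 => -ε^5/32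
  | 12 => -ε^6/384 + ε^4/24
  | 13 => ε^5/24
  | 14 => ε^6/64
  | 15 => ε^7/384 - ε^5/120
  | 16 => ε^8/6144 - ε^6/96
  | 17 => -ε^7/192
  | 18 => -ε^8/768
  | 19 => -ε^9/6144
  | 20 => -ε^10/122880
  | _ => 0

lemma sp_P_eq (ε s : ℝ) : spP ε s * Real.exp (-(3/2)*s^2) =
    ∑ j ∈ Finset.range 21, spC ε j * (s^j * Real.exp (-(3/2)*s^2)) := by
  have : spP ε s = ∑ j ∈ Finset.range 21, spC ε j * s^j := by
    simp only [Finset.sum_range_succ, Finset.sum_range_zero, spC, spP]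
    ring
  rw [this, Finset.sum_mul]
  exact Finset.sum_congr rfl fun j _ => by ring

lemma sp_P_int (ε : ℝ) : Integrable (fun s => spP ε s * Real.exp (-(3/2)*s^2)) := by
  simp only [sp_P_eq]
  exact integrable_finsetSum _ fun j _ => (sp_int (by norm_num) j).const_mul _

lemma sp_P_val : ∃ a b c : ℝ, ∀ ε : ℝ, ∫ s, spP ε s * Real.exp (-(3/2)*s^2) =
    Real.sqrt (2 * Real.pi / 3) * (1 + 7/36*ε^2 + 385/2592 * ε^4) + ε^6 * (a + b * ε^2 + c * ε^4) := by
  have h0 := sp_M0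
  have h1 := sp_M1
  have h2 := sp_Mrec 0
  have h3 := sp_Mrec 1
  have h4 := sp_Mrec 2
  have h5 := sp_Mrec 3
  have h6 := sp_Mrec 4
  have h7 := sp_Mrec 5
  have h8 := sp_Mrec 6
  have h9 := sp_Mrec 7
  have h10 := sp_Mrec 8
  have h11 := sp_Mrec 9
  have h12 := sp_Mrec 10
  have h13 := sp_Mrec 11
  have h15 := sp_Mrec 13
  have h17 := sp_Mrec 15
  have h19 := sp_Mrec 17
  norm_num at h2 h3 h4 h5 h6 h7 h8 h9 h10 h11 h12 h13 h15 h17 h19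
  refine ⟨-spM 12/384 + spM 14/64 - spM 16/96, spM 16/6144 - spM 18/768, -spM 20/122880, fun ε => ?_⟩
  simp only [sp_P_eq]
  rw [integral_finset_sum _ fun j _ => (sp_int (by norm_num) j).const_mul _]
  simp only [integral_const_mul]
  change ∑ j ∈ Finset.range 21, spC ε j * spM j = _
  simp only [Finset.sum_range_succ, Finset.sum_range_zero, spC]
  simp only [← h0]
  simp only [h19, h17, h15, h13, h12, h11, h10, h9, h8, h7, h6, h5, h4, h3, h2, h1]
  ring

lemma sp_F : ∃ C : ℝ, 0 ≤ C ∧ ∀ ε : ℝ, 0 < ε → ε ≤ 1 →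
    |spF ε - Real.sqrt (2 * Real.pi / 3) * (1 + 7/36*ε^2 + 385/2592 * ε^4)| ≤ C * ε^6 := by
  obtain ⟨a, b, c, h⟩ := sp_P_val
  set B := ∫ s : ℝ, (8 * 64 * (s^18 * Real.exp (-(1/2)*s^2) + s^24 * Real.exp (-(1/2)*s^2)))
  have hBi : Integrable (fun s : ℝ => (8 * 64 * (s^18 * Real.exp (-(1/2)*s^2) + s^24 * Real.exp (-(1/2)*s^2)))) :=
    ((sp_int (by norm_num) 18).add (sp_int (by norm_num) 24)).const_mul _
  have hB0 : 0 ≤ B := integral_nonneg fun s => by positivity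
  refine ⟨B + (|a| + |b| + |c|), by positivity, fun ε h0 h1 => ?_⟩
  have hFi : Integrable (fun s : ℝ => Real.exp (-(3/2*s^2 + ε*s^3 + ε^2*s^4/4))) := by
    have := integrable_exp_neg_mul_sq (b := 1/2) (by norm_num)
    refine this.mono' (by fun_prop) (Eventually.of_forall fun s => ?_)
    rw [Real.norm_eq_abs, abs_of_pos (Real.exp_pos _), Real.exp_le_exp]
    nlinarith [sq_nonneg (s + ε*s^2/2)]
  have e : spF ε - ∫ s, spP ε s * Real.exp (-(3/2)*s^2) =
      ∫ s, (Real.exp (-(3/2*s^2 + ε*s^3 + ε^2*s^4/4)) - spP ε s * Real.exp (-(3/2)*s^2)) := by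
    rw [integral_sub hFi (sp_P_int ε)]; rfl
  have k1 : |spF ε - ∫ s, spP ε s * Real.exp (-(3/2)*s^2)| ≤ ε^6 * B := by
    rw [e, ← integral_const_mul, ← Real.norm_eq_abs]
    exact norm_integral_le_of_norm_le (hBi.const_mul _)
      (Eventually.of_forall fun s => sp_pt ε s h0 h1)
  rw [h ε] at k1
  have k2 : |ε^6 * (a + b * ε^2 + c * ε^4)| ≤ ε^6 * (|a| + |b| + |c|) := by
    rw [abs_mul, abs_of_pos (by positivity : 0 < ε^6)]
    gcongr
    refine (abs_add_three _ _ _).trans ?_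
    rw [abs_mul, abs_mul, abs_of_pos (by positivity : 0 < ε^2), abs_of_pos (by positivity : 0 < ε^4)]
    have := pow_le_one₀ h0.le h1 (n := 2)
    have := pow_le_one₀ h0.le h1 (n := 4)
    nlinarith [abs_nonneg b, abs_nonneg c]
  have := abs_add_le (spF ε - (Real.sqrt (2 * Real.pi / 3) * (1 + 7/36*ε^2 + 385/2592 * ε^4) + ε^6 * (a + b * ε^2 + c * ε^4))) (ε^6 * (a + b * ε^2 + c * ε^4))
  ring_nf at *
  linarith

lemma sp_subst (a v e : ℝ) (ha : 0 < a) (hv : 0 < v) (he : 0 < e) :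
    ∫ x : ℝ, Real.exp (-(a^4 * v^4 / 4) * x^4 + v^4 * x * (e^3 / a^2)) =
      1 / (v^2 * e) * Real.exp (3 * v^4 * e^4 / (4 * a^4)) * spF (a^2 / (v^2 * e^2)) := by
  set g := fun x : ℝ => Real.exp (-(a^4 * v^4 / 4) * x^4 + v^4 * x * (e^3 / a^2)) with hg
  have t1 : ∫ s : ℝ, g (s / (v^2*e) + e/a^2) = v^2 * e * ∫ x, g x := by
    rw [Measure.integral_comp_div (fun x => g (x + e/a^2)) (v^2*e), integral_add_right_eq_self,
      abs_of_pos (by positivity), smul_eq_mul]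
  have t2 : ∫ s : ℝ, g (s / (v^2*e) + e/a^2) =
      Real.exp (3 * v^4 * e^4 / (4 * a^4)) * spF (a^2 / (v^2 * e^2)) := by
    unfold spF
    rw [← integral_const_mul]
    congr 1
    ext s
    simp only [hg]
    rw [← Real.exp_add]
    congr 1
    field_simp
    ring
  rw [t2] at t1
  rw [mul_assoc, t1]
  field_simp

theorem saddle_point_P
    (Vc E : ℝ) (hV : 0 < Vc) (hE : 0 < E) :
    (fun lam : ℝ =>
        (∫ x : ℝ, Real.exp (- (lam * Vc / 4) * x ^ 4
            + Vc * x * (E ^ ((3 : ℝ) / 2) / Real.sqrt lam)))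
          / (Real.sqrt (Real.pi * Real.sqrt lam / (3 * Real.sqrt Vc * E))
              * Real.exp (3 * Vc * E ^ 2 / (4 * lam)))
        - (Real.sqrt 2 / (lam ^ ((1 : ℝ) / 4) * Vc ^ ((1 : ℝ) / 4))
            + 7 * lam ^ ((3 : ℝ) / 4) / (18 * Real.sqrt 2 * E ^ 2 * Vc ^ ((5 : ℝ) / 4))
            + 385 * lam ^ ((7 : ℝ) / 4)
                / (1296 * Real.sqrt 2 * E ^ 4 * Vc ^ ((9 : ℝ) / 4))))
      =O[nhdsWithin 0 (Set.Ioi 0)] fun lam : ℝ => lam ^ ((11 : ℝ) / 4) := by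
  obtain ⟨C, hC0, hC⟩ := sp_F
  obtain ⟨v, hv, rfl⟩ : ∃ v : ℝ, 0 < v ∧ Vc = v^4 :=
    ⟨Vc ^ ((1:ℝ)/4), by positivity, by rw [← Real.rpow_natCast, ← Real.rpow_mul hV.le]; norm_num⟩
  obtain ⟨e, he, rfl⟩ : ∃ e : ℝ, 0 < e ∧ E = e^2 :=
    ⟨Real.sqrt E, by positivity, (Real.sq_sqrt hE.le).symm⟩
  have r4 : ∀ a : ℝ, 0 < a → ∀ n : ℕ, (a^4) ^ ((n:ℝ)/4) = a^n := fun a ha n => by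
    rw [← Real.rpow_natCast, ← Real.rpow_mul ha.le, ← Real.rpow_natCast]; congr 1; push_cast; ring
  have sq4 : ∀ a : ℝ, 0 < a → Real.sqrt (a^4) = a^2 := fun a ha => by
    rw [show a^4 = (a^2)^2 by ring, Real.sqrt_sq (by positivity)]
  have e3 : (e^2) ^ ((3:ℝ)/2) = e^3 := by
    rw [← Real.rpow_natCast, ← Real.rpow_mul he.le, ← Real.rpow_natCast]; norm_num
  refine IsBigO.of_bound (Real.sqrt (3 / Real.pi) / v * (C / (v^12 * e^12))) ?_
  have hev : ∀ᶠ lam : ℝ in nhdsWithin 0 (Set.Ioi 0), lam ∈ Set.Ioo (0:ℝ) (v^4*e^4) :=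
    Ioo_mem_nhdsGT (by positivity)
  filter_upwards [hev] with lam hl
  obtain ⟨hl0, hl1⟩ := hl
  obtain ⟨a, ha, rfl⟩ : ∃ a : ℝ, 0 < a ∧ lam = a^4 :=
    ⟨lam ^ ((1:ℝ)/4), by positivity, by rw [← Real.rpow_natCast, ← Real.rpow_mul hl0.le]; norm_num⟩
  have q1 := r4 a ha 1
  have q3 := r4 a ha 3
  have q7 := r4 a ha 7
  have q11 := r4 a ha 11
  have v1 := r4 v hv 1
  have v5 := r4 v hv 5
  have v9 := r4 v hv 9
  push_cast at q1 q3 q7 q11 v1 v5 v9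
  rw [q1, q3, q7, q11, v1, v5, v9, e3, sq4 a ha, sq4 v hv, sp_subst a v e ha hv he]
  have hε : a^2 / (v^2 * e^2) ≤ 1 := by
    rw [div_le_one (by positivity)]
    refine le_of_lt (lt_of_pow_lt_pow_left₀ 2 (by positivity) ?_)
    calc (a^2)^2 = a^4 := by ring
      _ < v^4 * e^4 := hl1
      _ = _ := by ring
  have hF := hC _ (by positivity) hε
  set ε := a^2 / (v^2 * e^2) with hεd
  set F := spF ε
  have hp := Real.pi_pos
  have s1 : Real.sqrt (Real.pi * a^2 / (3 * v^2 * e^2)) = Real.sqrt (Real.pi/3) * (a / (v * e)) := by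
    rw [show Real.pi * a^2 / (3 * v^2 * e^2) = Real.pi/3 * (a / (v * e))^2 by field_simp,
      Real.sqrt_mul (by positivity), Real.sqrt_sq (by positivity)]
  have s2 : Real.sqrt (3/Real.pi) * Real.sqrt (Real.pi/3) = 1 := by
    rw [← Real.sqrt_mul (by positivity), show 3/Real.pi*(Real.pi/3) = 1 by field_simp, Real.sqrt_one]
  have s3 : Real.sqrt (3/Real.pi) * Real.sqrt (2*Real.pi/3) = Real.sqrt 2 := by
    rw [← Real.sqrt_mul (by positivity), show 3/Real.pi*(2*Real.pi/3) = 2 by field_simp]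
  have s4 : Real.sqrt 2 * Real.sqrt 2 = 2 := Real.mul_self_sqrt (by norm_num)
  rw [s1]
  set K := Real.sqrt (3/Real.pi) with hK
  set L := Real.sqrt (Real.pi/3)
  set A := Real.sqrt (2*Real.pi/3)
  have hKp : 0 < K := by positivity
  have hLp : 0 < L := by positivity
  set S := Real.sqrt 2 with hS
  have hSp : 0 < S := by positivity
  have x1 : Real.exp (3 * v^4 * (e^2)^2 / (4 * a^4)) = Real.exp (3 * v^4 * e^4 / (4 * a^4)) := by
    congr 1; ring
  rw [x1]
  set X := Real.exp (3 * v^4 * e^4 / (4 * a^4))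
  have hX : 0 < X := Real.exp_pos _
  have m1 : 1 / (v^2 * e) * X * F / (L * (a / (v * e)) * X) = K / (v * a) * F := by
    have : K = 1 / L := by field_simp; exact s2
    rw [this]; field_simp
  have m2 : S / (a^1 * v^1) + 7 * a^3 / (18 * S * (e^2)^2 * v^5) + 385 * a^7 / (1296 * S * (e^2)^4 * v^9)
      = K / (v * a) * (A * (1 + 7/36*ε^2 + 385/2592*ε^4)) := by
    have hi : 1 / S = S / 2 := by field_simp; nlinarith
    calc _ = S / (a * v) + 7 * a^3 / (18 * (e^2)^2 * v^5) * (1/S) + 385 * a^7 / (1296 * (e^2)^4 * v^9) * (1/S) := by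
          field_simp
      _ = (K * A) / (v * a) * (1 + 7/36*ε^2 + 385/2592*ε^4) := by
          rw [hi, s3, hεd]; field_simp; ring
      _ = _ := by ring
  simp only [pow_one] at m2 ⊢
  rw [m1, m2, ← mul_sub, norm_mul, Real.norm_eq_abs, Real.norm_eq_abs, Real.norm_eq_abs,
    abs_of_pos (by positivity : 0 < K / (v*a)), abs_of_pos (by positivity : 0 < a^11)]
  calc _ ≤ K / (v*a) * (C * ε^6) := by gcongr
    _ = _ := by rw [hεd]; field_simp
end
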